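/- Let α < 1/2, let μ be a *-infinitely divisible probability measure on [0,∞), and let {μ_t} be the unique *-convolution semigroup with μ₁ = μ. The following are equivalent: (i) μ is a *-Gaussian measure; (ii) lim_{t↓0} (1/t) μ_t([ε,∞)) = 0 for every ε > 0; (iii) lim_{t↓0} (1/t) (μ_t * δ_x)([0,∞) \ (x−ε, x+ε)) = 0 for every x ≥ 0 and ε > 0. -/

import Mathlib

open MeasureTheory Measure Set Filter Topology

noncomputable section

/-- The Pochhammer symbol `(a)ₙ`. -/
def poch (a : ℂ) (n : ℕ) : ℂ := ∏ i ∈ Finset.range n, (a + i)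

/-- Kummer's confluent hypergeometric function `M(a,b;z)` (power series). -/
def kummerM (a b z : ℂ) : ℂ := ∑' n : ℕ, poch a n / poch b n * z ^ n / (n.factorial : ℂ)

/-- Tricomi's confluent hypergeometric function `Ψ(a,b;z)`. -/
def tricomiU (a b z : ℂ) : ℂ :=
  Complex.Gamma (1 - b) / Complex.Gamma (a + 1 - b) * kummerM a b z
    + Complex.Gamma (b - 1) / Complex.Gamma a * z ^ ((1 : ℂ) - b) * kummerM (a - b + 1) (2 - b) z

/-- The parabolic cylinder function `D_μ(z)` (real argument). -/
def cylinderD (μ : ℂ) (z : ℝ) : ℂ :=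
  (2 : ℂ) ^ (μ / 2) * Complex.exp (-(z : ℂ) ^ 2 / 4) * tricomiU (-μ / 2) (1 / 2) ((z : ℂ) ^ 2 / 2)

/-- The Whittaker function of the second kind `W_{κ,ν}(z)` (positive real argument). -/
def whittakerW (κ ν : ℂ) (z : ℝ) : ℂ :=
  Complex.exp (-(z : ℂ) / 2) * (z : ℂ) ^ ((1 : ℂ) / 2 + ν) * tricomiU (1 / 2 - κ + ν) (1 + 2 * ν) z

/-- The modified Whittaker-type kernel `𝑾_{α,ν}(x) = 2^α x^{2α} e^{1/(4x²)} W_{α,ν}(1/(2x²))`,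
extended continuously by `𝑾_{α,ν}(0) = 1`. -/
def bW (α ν : ℂ) (x : ℝ) : ℂ :=
  if x = 0 then 1
  else (2 : ℂ) ^ α * (x : ℂ) ^ (2 * α) * Complex.exp (1 / (4 * (x : ℂ) ^ 2)) *
      whittakerW α ν (1 / (2 * x ^ 2))

/-- Real-valued version of `𝑾_{α,ν}(x)` (real `α`; `𝑾` is real for the relevant `ν`). -/
def bWr (α : ℝ) (ν : ℂ) (x : ℝ) : ℝ := (bW α ν x).re

/-- `Δ_λ := √((1/2 − α)² − λ)` (principal square root, so `= i√(λ − (1/2 − α)²)` for large λ). -/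
def Δl (α lam : ℝ) : ℂ := ((((1 / 2 - α) ^ 2 - lam : ℝ) : ℂ)) ^ ((1 : ℂ) / 2)

/-- The weight `m(x) = x^{1−4α} e^{−1/(2x²)}`. -/
def mw (α x : ℝ) : ℝ := x ^ (1 - 4 * α) * Real.exp (-1 / (2 * x ^ 2))

/-- The measure `m(x) dx` on `(0,∞)`. -/
def mMeas (α : ℝ) : Measure ℝ :=
  (volume.restrict (Ioi 0)).withDensity fun x => ENNReal.ofReal (mw α x)

/-- Real-valued parabolic cylinder function. -/
def Dr (μ z : ℝ) : ℝ := (cylinderD μ z).re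

/-- The kernel `q(x,y,ξ)` of the index Whittaker product formula. -/
def qk (α x y ξ : ℝ) : ℝ :=
  (2 * Real.pi) ^ (-(1 : ℝ) / 2) * (x * y * ξ) ^ (-1 + 2 * α) *
    Real.exp (1 / (2 * x ^ 2) + 1 / (2 * y ^ 2) + 1 / (2 * ξ ^ 2)
      - ((x ^ 2 + y ^ 2 + ξ ^ 2) / (4 * x * y * ξ)) ^ 2) *
    Dr (2 * α) ((x ^ 2 + y ^ 2 + ξ ^ 2) / (2 * x * y * ξ))

/-- Index Whittaker transform of a measure. -/
def iwHat (α : ℝ) (μ : Measure ℝ) (lam : ℝ) : ℝ := ∫ x, bWr α (Δl α lam) x ∂μ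

/-- Index Whittaker translation `(T^y f)(x)` for `x, y > 0`. -/
def translPos (α : ℝ) (f : ℝ → ℝ) (y x : ℝ) : ℝ :=
  ∫ ξ in Ioi (0 : ℝ), f ξ * qk α x y ξ * mw α ξ

/-- Index Whittaker translation with the boundary conventions
`(T^x f)(0) = (T^0 f)(x) = f(x)`. -/
def transl (α : ℝ) (f : ℝ → ℝ) (y x : ℝ) : ℝ :=
  if x = 0 then f y else if y = 0 then f x else translPos α f y x

/-- The transition kernel `δ_x * δ_y` of the index Whittaker convolution. -/
def iwKernel (α x y : ℝ) : Measure ℝ :=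
  if x = 0 then Measure.dirac y
  else if y = 0 then Measure.dirac x
  else (volume.restrict (Ioi 0)).withDensity fun ξ => ENNReal.ofReal (qk α x y ξ * mw α ξ)

/-- The index Whittaker convolution of two measures on `[0,∞)`. -/
def iwConv (α : ℝ) (μ ν : Measure ℝ) : Measure ℝ :=
  (μ.prod ν).bind fun p => iwKernel α p.1 p.2

/-- `n`-fold index Whittaker convolution power. -/
def iwConvPow (α : ℝ) (μ : Measure ℝ) : ℕ → Measure ℝ
  | 0 => Measure.dirac 0
  | n + 1 => iwConv α (iwConvPow α μ n) μ

/-- A measure on `ℝ` is supported on the half-line `[0,∞)`. -/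
def OnHalfLine (μ : Measure ℝ) : Prop := μ {x | x < 0} = 0

/-- `*`-infinite divisibility with respect to the index Whittaker convolution. -/
def IsIWInfDiv (α : ℝ) (μ : Measure ℝ) : Prop :=
  IsProbabilityMeasure μ ∧ OnHalfLine μ ∧
    ∀ n : ℕ, 0 < n → ∃ ν : Measure ℝ,
      IsProbabilityMeasure ν ∧ OnHalfLine ν ∧ μ = iwConvPow α ν n

/-- The `*`-compound Poisson measure `e(aμ)`. -/
def iwCompoundPoisson (α a : ℝ) (μ : Measure ℝ) : Measure ℝ :=
  Measure.sum fun k : ℕ =>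
    (ENNReal.ofReal (Real.exp (-a) * a ^ k / k.factorial)) • iwConvPow α μ k

/-- `*`-Gaussian measures. -/
def IsIWGaussian (α : ℝ) (μ : Measure ℝ) : Prop :=
  IsIWInfDiv α μ ∧
    ∀ a : ℝ, 0 < a → ∀ ν ϑ : Measure ℝ, IsProbabilityMeasure ν → OnHalfLine ν →
      IsIWInfDiv α ϑ → μ = iwConv α (iwCompoundPoisson α a ν) ϑ → ν = Measure.dirac 0

/-- `*`-convolution semigroups. -/
structure IsIWConvSemigroup (α : ℝ) (μ : ℝ → Measure ℝ) : Prop where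
  prob : ∀ t, 0 ≤ t → IsProbabilityMeasure (μ t)
  half : ∀ t, 0 ≤ t → OnHalfLine (μ t)
  conv : ∀ s t, 0 ≤ s → 0 ≤ t → μ (s + t) = iwConv α (μ s) (μ t)
  zero : μ 0 = Measure.dirac 0
  cont : ∀ f : BoundedContinuousFunction ℝ ℝ,
    Tendsto (fun t => ∫ x, f x ∂(μ t)) (𝓝[>] (0 : ℝ)) (𝓝 (f 0))


lemma integral_rpow_mul_exp_neg_sq_div_two {s : ℝ} (hs : 0 < s) :
    ∫ u in Ioi (0 : ℝ), u ^ (s - 1) * Real.exp (-u ^ 2 / 2) = 2 ^ (s / 2 - 1) * Real.Gamma (s / 2) := by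
  have h := integral_rpow_mul_exp_neg_mul_rpow (p := 2) (q := s - 1) (b := 1 / 2)
    (by norm_num) (by linarith) (by norm_num)
  have e : (2 : ℝ) ^ (s / 2 - 1) * Real.Gamma (s / 2)
      = (1 / 2 : ℝ) ^ (-(s - 1 + 1) / 2) * (1 / 2) * Real.Gamma ((s - 1 + 1) / 2) := by
    rw [one_div, Real.inv_rpow (by norm_num), ← Real.rpow_neg (by norm_num),
      Real.rpow_sub (by norm_num), Real.rpow_one]
    ring_nf
  rw [e, ← h]
  refine setIntegral_congr_fun measurableSet_Ioi fun u _ => ?_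
  simp only [Real.rpow_two]
  ring_nf

lemma integrableOn_rpow_mul_exp_quadratic {s : ℝ} (hs : 0 < s) (z : ℝ) :
    IntegrableOn (fun u : ℝ => u ^ (s - 1) * Real.exp (z * u - u ^ 2 / 2)) (Ioi 0) := by
  have h := (integrableOn_rpow_mul_exp_neg_mul_sq (b := 1 / 4) (by norm_num)
    (s := s - 1) (by linarith)).const_mul (Real.exp (z ^ 2))
  refine Integrable.mono' h (by fun_prop) ?_
  refine (ae_restrict_iff' measurableSet_Ioi).2 (.of_forall fun u hu => ?_)
  have hu' : 0 < u := hu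
  rw [Real.norm_of_nonneg (by positivity), mul_left_comm, ← Real.exp_add]
  gcongr
  nlinarith [sq_nonneg (u - 2 * z)]

/-- Termwise integration of the exponential series of `e^{-zu}`. -/
lemma hasSum_integral_rpow_mul_exp_quadratic {s : ℝ} (hs : 0 < s) (z : ℝ) :
    HasSum (fun n : ℕ => (-z) ^ n / n.factorial * (2 ^ ((s + n) / 2 - 1) * Real.Gamma ((s + n) / 2)))
      (∫ u in Ioi (0 : ℝ), u ^ (s - 1) * Real.exp (-z * u - u ^ 2 / 2)) := by
  have key := hasSum_integral_of_dominated_convergence (μ := volume.restrict (Ioi (0 : ℝ)))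
    (F := fun (n : ℕ) u => (-z) ^ n / n.factorial * (u ^ (s + n - 1) * Real.exp (-u ^ 2 / 2)))
    (f := fun u => u ^ (s - 1) * Real.exp (-z * u - u ^ 2 / 2))
    (fun (n : ℕ) u => u ^ (s - 1) * Real.exp (-u ^ 2 / 2) * ((|z| * |u|) ^ n / n.factorial))
    (fun n => by fun_prop) ?_ ?_ ?_ ?_
  · have e : (fun n : ℕ => (-z) ^ n / n.factorial *
          (2 ^ ((s + n) / 2 - 1) * Real.Gamma ((s + n) / 2)))
        = fun n : ℕ => ∫ u in Ioi (0 : ℝ), (-z) ^ n / n.factorial *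
          (u ^ (s + n - 1) * Real.exp (-u ^ 2 / 2)) := by
      funext n
      rw [integral_const_mul, integral_rpow_mul_exp_neg_sq_div_two (by positivity)]
    rw [e]
    exact key
  · intro n
    refine (ae_restrict_iff' measurableSet_Ioi).2 (.of_forall fun u hu => ?_)
    have hu' : 0 < u := hu
    rw [show s + n - 1 = s - 1 + n by ring, Real.rpow_add hu', Real.rpow_natCast]
    simp only [norm_mul, norm_div, norm_pow, Real.norm_eq_abs, abs_neg, Nat.abs_cast, Real.abs_exp,
      abs_of_pos hu', abs_of_pos (Real.rpow_pos_of_pos hu' (s - 1)), mul_pow]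
    apply le_of_eq
    ring
  · exact .of_forall fun u => (Real.summable_pow_div_factorial _).mul_left _
  · have : ∀ u : ℝ, ∑' n : ℕ, u ^ (s - 1) * Real.exp (-u ^ 2 / 2) * ((|z| * |u|) ^ n / n.factorial)
        = u ^ (s - 1) * Real.exp (-u ^ 2 / 2) * Real.exp (|z| * |u|) := fun u => by
      rw [tsum_mul_left, Real.exp_eq_exp_ℝ, NormedSpace.exp_eq_tsum_div]
    simp_rw [this]
    refine (integrableOn_congr_fun (fun u hu => ?_) measurableSet_Ioi).1
      (integrableOn_rpow_mul_exp_quadratic hs |z|)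
    rw [mul_assoc, ← Real.exp_add, abs_of_pos (show 0 < u from hu)]
    ring_nf
  · refine (ae_restrict_iff' measurableSet_Ioi).2 (.of_forall fun u hu => ?_)
    have hu' : 0 < u := hu
    have h := (NormedSpace.exp_series_hasSum_exp' (𝕂 := ℝ) (-z * u)).mul_left
      (u ^ (s - 1) * Real.exp (-u ^ 2 / 2))
    rw [← Real.exp_eq_exp_ℝ] at h
    have e₁ : (fun n : ℕ => (-z) ^ n / n.factorial * (u ^ (s + n - 1) * Real.exp (-u ^ 2 / 2)))
        = fun n : ℕ => u ^ (s - 1) * Real.exp (-u ^ 2 / 2) *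
          ((n.factorial : ℝ)⁻¹ • (-z * u) ^ n) := by
      funext n
      rw [show s + n - 1 = s - 1 + n by ring, Real.rpow_add hu', Real.rpow_natCast, smul_eq_mul,
        mul_pow]
      field_simp
    have e₂ : u ^ (s - 1) * Real.exp (-z * u - u ^ 2 / 2)
        = u ^ (s - 1) * Real.exp (-u ^ 2 / 2) * Real.exp (-z * u) := by
      rw [mul_assoc, ← Real.exp_add]
      ring_nf
    rw [e₁, e₂]
    exact h

/-- Real Pochhammer symbols, used to expand `D_{2α}` on the positive half-line. -/
def rpoch (a : ℝ) (n : ℕ) : ℝ := ∏ i ∈ Finset.range n, (a + i)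

lemma poch_ofReal (a : ℝ) (n : ℕ) : poch (a : ℂ) n = (rpoch a n : ℂ) := by
  simp [poch, rpoch]

lemma kummerM_ofReal (a b w : ℝ) :
    kummerM a b w = ((∑' n : ℕ, rpoch a n / rpoch b n * w ^ n / n.factorial : ℝ) : ℂ) := by
  simp only [kummerM, poch_ofReal, Complex.ofReal_tsum]
  push_cast
  rfl

lemma Gamma_add_nat (b : ℝ) (hb : 0 < b) (m : ℕ) :
    Real.Gamma (b + m) = rpoch b m * Real.Gamma b := by
  induction m with
  | zero => simp [rpoch]
  | succ m ih =>
    rw [Nat.cast_succ, ← add_assoc, Real.Gamma_add_one (by positivity), ih, rpoch, rpoch,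
      Finset.prod_range_succ]
    ring

lemma rpoch_succ_left (b : ℝ) (m : ℕ) : rpoch b (m + 1) = b * rpoch (b + 1) m := by
  rw [rpoch, Finset.prod_range_succ', rpoch, mul_comm]
  simp [add_assoc, add_comm (1 : ℝ)]

lemma rpoch_half (m : ℕ) : rpoch (1 / 2) m * (4 ^ m * m.factorial) = ((2 * m).factorial : ℝ) := by
  induction m with
  | zero => simp [rpoch]
  | succ m ih =>
    rw [show 2 * (m + 1) = 2 * m + 1 + 1 by ring, Nat.factorial_succ, Nat.factorial_succ,
      Nat.factorial_succ]
    push_cast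
    rw [← ih, rpoch, Finset.prod_range_succ, ← rpoch, pow_succ]
    ring

lemma rpoch_three_half (m : ℕ) :
    rpoch (3 / 2) m * (4 ^ m * m.factorial) = ((2 * m + 1).factorial : ℝ) := by
  induction m with
  | zero => simp [rpoch]
  | succ m ih =>
    rw [show 2 * (m + 1) + 1 = 2 * m + 1 + 1 + 1 by ring, Nat.factorial_succ m,
      Nat.factorial_succ (2 * m + 1 + 1), Nat.factorial_succ (2 * m + 1)]
    push_cast
    rw [← ih, rpoch, Finset.prod_range_succ, ← rpoch, pow_succ]
    ring

/-- The half-Gaussian moments `∫₀^∞ u^{s-1} e^{-u²/2} du` in closed form. -/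
def halfGaussMoment (s : ℝ) : ℝ := 2 ^ (s / 2 - 1) * Real.Gamma (s / 2)

lemma halfGaussMoment_add_two {s : ℝ} (hs : 0 < s) :
    halfGaussMoment (s + 2) = s * halfGaussMoment s := by
  rw [halfGaussMoment, halfGaussMoment, show (s + 2) / 2 = s / 2 + 1 by ring,
    Real.Gamma_add_one (by positivity), show s / 2 + 1 - 1 = (s / 2 - 1) + 1 by ring,
    Real.rpow_add (by norm_num), Real.rpow_one]
  ring

/-- The coefficients of the power series in `z` of
`∫₀^∞ (z + u) u^{A-1} e^{-zu-u²/2} du`. -/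
def cylCoeff (A z : ℝ) (n : ℕ) : ℝ :=
  (-z) ^ n / n.factorial * (halfGaussMoment (A + 1 + n) - n * halfGaussMoment (A + n - 1))

lemma hasSum_cylCoeff {A : ℝ} (hA : 0 < A) (z : ℝ) :
    HasSum (cylCoeff A z)
      (∫ u in Ioi (0 : ℝ), (z + u) * (u ^ (A - 1) * Real.exp (-z * u - u ^ 2 / 2))) := by
  have h₀ := (hasSum_integral_rpow_mul_exp_quadratic hA z).mul_left z
  have h₁ := hasSum_integral_rpow_mul_exp_quadratic (s := A + 1) (by linarith) z
  have h₀' : HasSum (fun n : ℕ => -((-z) ^ n / n.factorial * (n * halfGaussMoment (A + n - 1))))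
      (z * ∫ u in Ioi (0 : ℝ), u ^ (A - 1) * Real.exp (-z * u - u ^ 2 / 2)) := by
    rw [← hasSum_nat_add_iff' 1]
    simp only [Finset.range_one, Finset.sum_singleton, Nat.cast_zero, zero_mul, mul_zero, neg_zero,
      sub_zero]
    refine h₀.congr_fun ?_
    intro n
    rw [halfGaussMoment, pow_succ, Nat.factorial_succ,
      show A + ((n + 1 : ℕ) : ℝ) - 1 = A + n by push_cast; ring]
    push_cast
    field_simp
  have hi : ∫ u in Ioi (0 : ℝ), (z + u) * (u ^ (A - 1) * Real.exp (-z * u - u ^ 2 / 2))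
      = (z * ∫ u in Ioi (0 : ℝ), u ^ (A - 1) * Real.exp (-z * u - u ^ 2 / 2))
        + ∫ u in Ioi (0 : ℝ), u ^ (A + 1 - 1) * Real.exp (-z * u - u ^ 2 / 2) := by
    rw [← integral_const_mul, ← integral_add]
    · refine setIntegral_congr_fun measurableSet_Ioi fun u hu => ?_
      have hu' : 0 < u := hu
      rw [show A + 1 - 1 = (A - 1) + 1 by ring, Real.rpow_add hu', Real.rpow_one]
      ring
    · exact (integrableOn_rpow_mul_exp_quadratic hA (-z)).const_mul z
    · exact integrableOn_rpow_mul_exp_quadratic (by linarith) (-z)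
  rw [hi]
  refine (h₀'.add h₁).congr_fun ?_
  intro n
  rw [cylCoeff, halfGaussMoment]
  ring

lemma cylCoeff_even {A : ℝ} (hA : 0 < A) (z : ℝ) (m : ℕ) :
    cylCoeff A z (2 * m) = 2 ^ ((A - 1) / 2) * Real.Gamma ((A - 1) / 2 + 1) *
      (rpoch ((A - 1) / 2) m / rpoch (1 / 2) m * (z ^ 2 / 2) ^ m / m.factorial) := by
  have hp : rpoch (1 / 2) m ≠ 0 := by
    have := rpoch_half m
    intro h
    rw [h, zero_mul] at this
    exact absurd this.symm (by positivity)
  have hf : ((2 * m).factorial : ℝ) = rpoch (1 / 2) m * (4 ^ m * m.factorial) := (rpoch_half m).symm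
  have key : halfGaussMoment (A + 1 + (2 * m : ℕ))
      - (2 * m : ℕ) * halfGaussMoment (A + (2 * m : ℕ) - 1)
      = 2 ^ ((A - 1) / 2) * Real.Gamma ((A - 1) / 2 + 1) * rpoch ((A - 1) / 2) m * 2 ^ m := by
    cases m with
    | zero =>
      simp only [halfGaussMoment, rpoch]
      norm_num
      ring_nf
    | succ k =>
      have hs : 0 < A + ((2 * (k + 1) : ℕ) : ℝ) - 1 := by push_cast; nlinarith [k.cast_nonneg (α := ℝ)]
      have h2 := halfGaussMoment_add_two hs
      rw [show A + 1 + ((2 * (k + 1) : ℕ) : ℝ) = A + ((2 * (k + 1) : ℕ) : ℝ) - 1 + 2 by ring, h2,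
        rpoch_succ_left]
      have hG := Gamma_add_nat ((A - 1) / 2 + 1) (by linarith) k
      rw [halfGaussMoment, show (A + ((2 * (k + 1) : ℕ) : ℝ) - 1) / 2 = (A - 1) / 2 + 1 + k by
        push_cast; ring, hG, show (A - 1) / 2 + 1 + (k : ℝ) - 1 = (A - 1) / 2 + k by ring,
        Real.rpow_add (by norm_num), Real.rpow_natCast, pow_succ]
      push_cast
      ring
  rw [cylCoeff, key, hf, pow_mul, neg_sq, div_pow, show (4 : ℝ) = 2 * 2 by norm_num, mul_pow]
  field_simp

lemma cylCoeff_odd {A : ℝ} (hA : 0 < A) (z : ℝ) (m : ℕ) :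
    cylCoeff A z (2 * m + 1) = -(A - 1) * 2 ^ (A / 2 - 1) * Real.Gamma (A / 2) * z *
      (rpoch (A / 2) m / rpoch (3 / 2) m * (z ^ 2 / 2) ^ m / m.factorial) := by
  have hp : rpoch (3 / 2) m ≠ 0 := by
    have := rpoch_three_half m
    intro h
    rw [h, zero_mul] at this
    exact absurd this.symm (by positivity)
  have hf := (rpoch_three_half m).symm
  have hs : 0 < A + 2 * (m : ℝ) := by positivity
  have h2 := halfGaussMoment_add_two hs
  have hG := Gamma_add_nat (A / 2) (by linarith) m
  rw [cylCoeff, hf, pow_succ, pow_mul, neg_sq, div_pow, show (4 : ℝ) = 2 * 2 by norm_num, mul_pow]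
  push_cast
  rw [show A + 1 + (2 * (m : ℝ) + 1) = A + 2 * m + 2 by ring, h2,
    show A + (2 * (m : ℝ) + 1) - 1 = A + 2 * m by ring, halfGaussMoment,
    show (A + 2 * (m : ℝ)) / 2 = A / 2 + m by ring, hG,
    show A / 2 + (m : ℝ) - 1 = A / 2 - 1 + m by ring,
    Real.rpow_add (by norm_num), Real.rpow_natCast]
  field_simp
  ring

lemma cylinderD_eq_series (b : ℝ) {z : ℝ} (hz : 0 < z) :
    Dr (-(2 * b)) z = 2 ^ (-b) * Real.exp (-z ^ 2 / 4) *
      (√Real.pi / Real.Gamma (b + 1 / 2) *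
          (∑' n : ℕ, rpoch b n / rpoch (1 / 2) n * (z ^ 2 / 2) ^ n / n.factorial)
        + -2 * √Real.pi / Real.Gamma b * (z / √2) *
          (∑' n : ℕ, rpoch (b + 1 / 2) n / rpoch (3 / 2) n * (z ^ 2 / 2) ^ n / n.factorial)) := by
  have hM₁ := kummerM_ofReal b (1 / 2) (z ^ 2 / 2)
  have hM₂ := kummerM_ofReal (b + 1 / 2) (3 / 2) (z ^ 2 / 2)
  have hg : Real.Gamma (-1 / 2) = -2 * √Real.pi := by
    have := Real.Gamma_add_one (s := -1 / 2) (by norm_num)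
    rw [show (-1 / 2 : ℝ) + 1 = 1 / 2 by norm_num, Real.Gamma_one_half_eq] at this
    linarith
  have hw : ((z : ℂ) ^ 2 / 2) ^ ((1 : ℂ) - 1 / 2) = ((z / √2 : ℝ) : ℂ) := by
    rw [show ((1 : ℂ) - 1 / 2) = ((1 / 2 : ℝ) : ℂ) by push_cast; norm_num,
      show ((z : ℂ) ^ 2 / 2) = ((z ^ 2 / 2 : ℝ) : ℂ) by push_cast; rfl,
      ← Complex.ofReal_cpow (by positivity), ← Real.sqrt_eq_rpow, Real.sqrt_div (by positivity),
      Real.sqrt_sq hz.le]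
  have h2 : (2 : ℂ) ^ (-(b : ℂ)) = ((2 ^ (-b) : ℝ) : ℂ) := by
    rw [Complex.ofReal_cpow (by norm_num)]
    push_cast
    rfl
  rw [Dr, cylinderD, tricomiU, hw,
    show (((-(2 * b) : ℝ) : ℂ)) / 2 = -(b : ℂ) by push_cast; ring, h2,
    show -(((-(2 * b) : ℝ) : ℂ)) / 2 = (b : ℂ) by push_cast; ring,
    show (b : ℂ) + 1 - 1 / 2 = ((b + 1 / 2 : ℝ) : ℂ) by push_cast; ring,
    show (b : ℂ) - 1 / 2 + 1 = ((b + 1 / 2 : ℝ) : ℂ) by push_cast; ring,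
    show (1 : ℂ) - 1 / 2 = ((1 / 2 : ℝ) : ℂ) by push_cast; ring,
    show (1 : ℂ) / 2 - 1 = ((-1 / 2 : ℝ) : ℂ) by push_cast; ring,
    show (2 : ℂ) - 1 / 2 = ((3 / 2 : ℝ) : ℂ) by push_cast; ring,
    show (1 : ℂ) / 2 = ((1 / 2 : ℝ) : ℂ) by push_cast; ring,
    show ((z : ℂ) ^ 2 / 2) = ((z ^ 2 / 2 : ℝ) : ℂ) by push_cast; rfl, hM₁, hM₂,
    show -(z : ℂ) ^ 2 / 4 = ((-z ^ 2 / 4 : ℝ) : ℂ) by push_cast; rfl, ← Complex.ofReal_exp,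
    Complex.Gamma_ofReal, Complex.Gamma_ofReal, Complex.Gamma_ofReal, Complex.Gamma_ofReal,
    Real.Gamma_one_half_eq, hg]
  norm_cast

/-- Integral representation of `D_{2α}` on the positive half-line, with `A = 1 - 2α`. -/
lemma Dr_eq_integral {A : ℝ} (hA : 0 < A) {z : ℝ} (hz : 0 < z) :
    Dr (1 - A) z = Real.exp (-z ^ 2 / 4) / Real.Gamma A *
      ∫ u in Ioi (0 : ℝ), (z + u) * (u ^ (A - 1) * Real.exp (-z * u - u ^ 2 / 2)) := by
  have hs := hasSum_cylCoeff hA z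
  have he : Summable fun m => cylCoeff A z (2 * m) :=
    hs.summable.comp_injective (i := fun m : ℕ => 2 * m) fun a b h => by simpa using h
  have ho : Summable fun m => cylCoeff A z (2 * m + 1) :=
    hs.summable.comp_injective (i := fun m : ℕ => 2 * m + 1) fun a b h => by simpa using h
  rw [← hs.tsum_eq, ← tsum_even_add_odd he ho]
  simp_rw [cylCoeff_even hA, cylCoeff_odd hA]
  rw [tsum_mul_left, tsum_mul_left, show 1 - A = -(2 * ((A - 1) / 2)) by ring,
    cylinderD_eq_series _ hz, show (A - 1) / 2 + 1 / 2 = A / 2 by ring]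
  set M₁ := ∑' n : ℕ, rpoch ((A - 1) / 2) n / rpoch (1 / 2) n * (z ^ 2 / 2) ^ n / n.factorial
  set M₂ := ∑' n : ℕ, rpoch (A / 2) n / rpoch (3 / 2) n * (z ^ 2 / 2) ^ n / n.factorial
  have hd := Real.Gamma_mul_Gamma_add_half (A / 2)
  rw [show A / 2 + 1 / 2 = (A - 1) / 2 + 1 by ring, show 2 * (A / 2) = A by ring] at hd
  have hb : 1 / Real.Gamma ((A - 1) / 2) = ((A - 1) / 2) / Real.Gamma ((A - 1) / 2 + 1) := by
    rcases eq_or_ne ((A - 1) / 2) 0 with h | h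
    · simp [h]
    · have := Real.Gamma_add_one h
      rw [this]
      rcases eq_or_ne (Real.Gamma ((A - 1) / 2)) 0 with h' | h'
      · simp [h']
      · rw [mul_comm, ← div_div, div_right_comm, div_self h]
  have hG1 : 0 < Real.Gamma (A / 2) := Real.Gamma_pos_of_pos (by linarith)
  have hG2 : 0 < Real.Gamma ((A - 1) / 2 + 1) := Real.Gamma_pos_of_pos (by linarith)
  have hG3 : 0 < Real.Gamma A := Real.Gamma_pos_of_pos hA
  have hpi : √Real.pi = Real.Gamma (A / 2) * Real.Gamma ((A - 1) / 2 + 1) / Real.Gamma A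
      * 2 ^ (A - 1) := by
    rw [hd, mul_div_right_comm]
    have : (2 : ℝ) ^ (1 - A) * 2 ^ (A - 1) = 1 := by
      rw [← Real.rpow_add (by norm_num)]; simp
    field_simp
    exact this.symm
  have hq : (2 : ℝ) ^ (-((A - 1) / 2)) * 2 ^ (A - 1) = 2 ^ ((A - 1) / 2) := by
    rw [← Real.rpow_add (by norm_num)]; congr 1; ring
  have hq2 : (2 : ℝ) ^ (A / 2 - 1) = 2 ^ ((A - 1) / 2) / √2 := by
    rw [Real.sqrt_eq_rpow, ← Real.rpow_sub (by norm_num)]; congr 1; ring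
  rw [div_eq_mul_one_div _ (Real.Gamma ((A - 1) / 2)), hb, hq2, hpi, ← hq]
  generalize Real.Gamma ((A - 1) / 2 + 1) = g₂ at *
  generalize Real.Gamma (A / 2) = g₁ at *
  field_simp

lemma lintegral_Ioi_comp_mul_left {c : ℝ} (hc : 0 < c) (f : ℝ → ENNReal) :
    ∫⁻ t in Ioi (0 : ℝ), f t = ∫⁻ t in Ioi (0 : ℝ), ENNReal.ofReal c * f (c * t) := by
  have h := lintegral_image_eq_lintegral_deriv_mul_of_monotoneOn (s := Ioi (0 : ℝ))
    (f := fun t => c * t) (f' := fun _ => c) measurableSet_Ioi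
    (fun t _ => by simpa using ((hasDerivAt_id t).const_mul c).hasDerivWithinAt)
    (fun a _ b _ hab => by beta_reduce; gcongr) f
  rwa [show (fun t => c * t) '' Ioi (0 : ℝ) = Ioi 0 by
    rw [image_const_mul_Ioi_zero hc]] at h

lemma hasDerivAt_sub_div (B c : ℝ) {ξ : ℝ} (hξ : 0 < ξ) :
    HasDerivAt (fun ξ => c * (ξ - B / ξ)) (c * (1 + B / ξ ^ 2)) ξ := by
  have h1 := ((hasDerivAt_id ξ).sub ((hasDerivAt_inv hξ.ne').const_mul B)).const_mul c
  refine (h1.congr_deriv ?_).congr_of_eventuallyEq ?_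
  · field_simp
    ring
  · exact .of_forall fun t => by simp [div_eq_mul_inv]

lemma lintegral_eq_lintegral_sub_div {B c : ℝ} (hB : 0 < B) (hc : 0 < c) (F : ℝ → ENNReal) :
    ∫⁻ g, F g = ∫⁻ ξ in Ioi (0 : ℝ),
      ENNReal.ofReal (c * (1 + B / ξ ^ 2)) * F (c * (ξ - B / ξ)) := by
  have h := lintegral_image_eq_lintegral_deriv_mul_of_monotoneOn (s := Ioi (0 : ℝ))
    (f := fun ξ => c * (ξ - B / ξ)) (f' := fun ξ => c * (1 + B / ξ ^ 2)) measurableSet_Ioi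
    (fun ξ hξ => (hasDerivAt_sub_div B c hξ).hasDerivWithinAt)
    (fun a ha b _ hab => by
      have : (0 : ℝ) < a := ha
      beta_reduce; gcongr) F
  rw [← h, show (fun ξ => c * (ξ - B / ξ)) '' Ioi (0 : ℝ) = univ from ?_, setLIntegral_univ]
  refine eq_univ_of_forall fun g => ?_
  have hs : (√((g / c) ^ 2 + 4 * B)) ^ 2 = (g / c) ^ 2 + 4 * B := Real.sq_sqrt (by positivity)
  have hlt : -(g / c) < √((g / c) ^ 2 + 4 * B) :=
    Real.lt_sqrt_of_sq_lt (by rw [neg_sq]; linarith)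
  set r := √((g / c) ^ 2 + 4 * B)
  have hpos : 0 < g / c + r := by linarith
  refine ⟨(g / c + r) / 2, by simpa using by positivity, ?_⟩
  beta_reduce
  rw [show B = ((g / c + r) / 2) * ((r - g / c) / 2) by nlinarith, mul_div_cancel_left₀ _ (by positivity)]
  field_simp
  ring

lemma lintegral_gammaMeasure_one {a : ℝ} {f : ℝ → ENNReal} (hf : Measurable f) :
    ∫⁻ s, f s ∂(ProbabilityTheory.gammaMeasure a 1) =
      ∫⁻ s in Ioi (0 : ℝ), ENNReal.ofReal ((Real.Gamma a)⁻¹ * (s ^ (a - 1) * Real.exp (-s))) * f s := by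
  have hm : Measurable (ProbabilityTheory.gammaPDF a 1) :=
    (ProbabilityTheory.measurable_gammaPDFReal a 1).ennreal_ofReal
  rw [ProbabilityTheory.gammaMeasure, lintegral_withDensity_eq_lintegral_mul _ hm hf,
    ← lintegral_add_compl _ (measurableSet_Ici (a := (0 : ℝ))), compl_Ici]
  have h0 : ∫⁻ s in Iio (0 : ℝ), (ProbabilityTheory.gammaPDF a 1 * f) s = 0 := by
    rw [setLIntegral_congr_fun (g := fun _ => 0) measurableSet_Iio, lintegral_zero]
    intro s hs
    simp [ProbabilityTheory.gammaPDF_of_neg hs]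
  rw [h0, add_zero, setLIntegral_congr Ioi_ae_eq_Ici.symm]
  refine setLIntegral_congr_fun measurableSet_Ioi fun s hs => ?_
  have hs' : 0 < s := hs
  rw [Pi.mul_apply, ProbabilityTheory.gammaPDF_of_nonneg hs'.le]
  simp [mul_assoc]

lemma lintegral_gaussianReal_zero_one {f : ℝ → ENNReal} (hf : Measurable f) :
    ∫⁻ g, f g ∂(ProbabilityTheory.gaussianReal 0 1) =
      ∫⁻ g, ENNReal.ofReal ((2 * Real.pi) ^ (-(1 : ℝ) / 2) * Real.exp (-g ^ 2 / 2)) * f g := by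
  rw [ProbabilityTheory.gaussianReal_of_var_ne_zero _ one_ne_zero,
    lintegral_withDensity_eq_lintegral_mul _ (by fun_prop) hf]
  refine lintegral_congr fun g => ?_
  rw [Pi.mul_apply, ProbabilityTheory.gaussianPDF_def, ProbabilityTheory.gaussianPDFReal_def,
    neg_div, Real.rpow_neg (by positivity), ← Real.sqrt_eq_rpow]
  simp

/-- The law of an independent pair (standard Gaussian, Gamma variable of shape `A`). -/
def gaussGamma (A : ℝ) : Measure (ℝ × ℝ) :=
  (ProbabilityTheory.gaussianReal 0 1).prod (ProbabilityTheory.gammaMeasure A 1)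

lemma isProbabilityMeasure_gaussGamma {A : ℝ} (hA : 0 < A) :
    IsProbabilityMeasure (gaussGamma A) := by
  have := ProbabilityTheory.isProbabilityMeasure_gammaMeasure hA one_pos
  rw [gaussGamma]
  infer_instance

/-- The random variable whose law under `gaussGamma` is the product of two point masses. -/
def iwPsi (P Q : ℝ) (ω : ℝ × ℝ) : ℝ := Q * ω.1 + √(P + Q ^ 2 * (ω.1 ^ 2 + 2 * |ω.2|))

@[fun_prop]
lemma measurable_iwPsi (P Q : ℝ) : Measurable (iwPsi P Q) := by
  unfold iwPsi
  fun_prop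

lemma abs_le_sqrt_iwPsi {P Q : ℝ} (hP : 0 ≤ P) (ω : ℝ × ℝ) :
    |Q * ω.1| ≤ √(P + Q ^ 2 * (ω.1 ^ 2 + 2 * |ω.2|)) := by
  apply Real.abs_le_sqrt
  have := abs_nonneg ω.2
  nlinarith [mul_nonneg (sq_nonneg Q) this]

lemma iwPsi_nonneg {P Q : ℝ} (hP : 0 ≤ P) (ω : ℝ × ℝ) : 0 ≤ iwPsi P Q ω := by
  have h := abs_le_sqrt_iwPsi (Q := Q) hP ω
  have := neg_abs_le (Q * ω.1)
  rw [iwPsi]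
  linarith

/-- Integration against the law of `iwPsi`, conditioning on the Gamma variable. -/
lemma lintegral_iwPsi {A P Q : ℝ} (hA : 0 < A) (hP : 0 < P) (hQ : 0 < Q) {f : ℝ → ENNReal}
    (hf : Measurable f) :
    ∫⁻ ω, f (iwPsi P Q ω) ∂(gaussGamma A) =
      ∫⁻ γ in Ioi (0 : ℝ), ENNReal.ofReal ((Real.Gamma A)⁻¹ * (γ ^ (A - 1) * Real.exp (-γ))) *
        ∫⁻ ξ in Ioi (0 : ℝ), ENNReal.ofReal ((1 / (2 * Q)) * (1 + (P + 2 * Q ^ 2 * γ) / ξ ^ 2)) *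
          (ENNReal.ofReal ((2 * Real.pi) ^ (-(1 : ℝ) / 2) *
            Real.exp (-((1 / (2 * Q)) * (ξ - (P + 2 * Q ^ 2 * γ) / ξ)) ^ 2 / 2)) * f ξ) := by
  have := ProbabilityTheory.isProbabilityMeasure_gammaMeasure hA one_pos
  have hm : Measurable fun ω => f (iwPsi P Q ω) := hf.comp (measurable_iwPsi P Q)
  rw [gaussGamma, lintegral_prod_symm _ hm.aemeasurable,
    lintegral_gammaMeasure_one hm.lintegral_prod_left']
  refine setLIntegral_congr_fun measurableSet_Ioi fun γ hγ => ?_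
  have hγ' : 0 < γ := hγ
  congr 1
  rw [lintegral_gaussianReal_zero_one (by fun_prop),
    lintegral_eq_lintegral_sub_div (B := P + 2 * Q ^ 2 * γ) (c := 1 / (2 * Q)) (by positivity)
      (by positivity)]
  refine setLIntegral_congr_fun measurableSet_Ioi fun ξ hξ => ?_
  have hξ' : 0 < ξ := hξ
  congr 3
  rw [iwPsi]
  have : P + Q ^ 2 * ((1 / (2 * Q) * (ξ - (P + 2 * Q ^ 2 * γ) / ξ)) ^ 2 + 2 * |γ|)
      = ((ξ + (P + 2 * Q ^ 2 * γ) / ξ) / 2) ^ 2 := by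
    rw [abs_of_pos hγ']
    field_simp
    ring
  simp only [this]
  rw [Real.sqrt_sq (by positivity)]
  field_simp
  ring

/-- Disintegration of the product formula kernel over the Gamma variable. -/
lemma lintegral_gamma_eq_qk_mul_mw {α : ℝ} (hα : α < 1 / 2) {x y ξ : ℝ} (hx : 0 < x) (hy : 0 < y)
    (hξ : 0 < ξ) :
    ∫⁻ γ in Ioi (0 : ℝ), ENNReal.ofReal ((Real.Gamma (1 - 2 * α))⁻¹ *
        (γ ^ (1 - 2 * α - 1) * Real.exp (-γ)) *
        ((1 / (2 * (x * y))) * (1 + (x ^ 2 + y ^ 2 + 2 * (x * y) ^ 2 * γ) / ξ ^ 2)) *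
        ((2 * Real.pi) ^ (-(1 : ℝ) / 2) * Real.exp (-((1 / (2 * (x * y))) *
          (ξ - (x ^ 2 + y ^ 2 + 2 * (x * y) ^ 2 * γ) / ξ)) ^ 2 / 2)))
      = ENNReal.ofReal (qk α x y ξ * mw α ξ) := by
  obtain ⟨A, rfl⟩ : ∃ A, α = (1 - A) / 2 := ⟨1 - 2 * α, by ring⟩
  have hA : 0 < A := by linarith
  have hQ : 0 < x * y := by positivity
  have hxy : x ≠ 0 ∧ y ≠ 0 := ⟨hx.ne', hy.ne'⟩
  set z : ℝ := (x ^ 2 + y ^ 2 + ξ ^ 2) / (2 * x * y * ξ) with hz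
  have hzp : 0 < z := by positivity
  set K : ℝ := (ξ / (x * y)) ^ A * ξ⁻¹ * (2 * Real.pi) ^ (-(1 : ℝ) / 2) * (Real.Gamma A)⁻¹ *
    Real.exp ((x ^ 2 + y ^ 2) / (2 * (x * y) ^ 2) - z ^ 2 / 2) with hK
  have hGA : 0 < Real.Gamma A := Real.Gamma_pos_of_pos hA
  have hint : IntegrableOn (fun u : ℝ => (z + u) * (u ^ (A - 1) * Real.exp (-z * u - u ^ 2 / 2)))
      (Ioi 0) := by
    have h1 := (integrableOn_rpow_mul_exp_quadratic hA (-z)).const_mul z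
    have h2 := integrableOn_rpow_mul_exp_quadratic (s := A + 1) (by linarith) (-z)
    refine (h1.add h2).congr ((ae_restrict_iff' measurableSet_Ioi).2 (.of_forall fun u hu => ?_))
    have hu' : 0 < u := hu
    rw [Pi.add_apply, show A + 1 - 1 = (A - 1) + 1 by ring, Real.rpow_add hu', Real.rpow_one]
    ring
  have hqm : qk ((1 - A) / 2) x y ξ * mw ((1 - A) / 2) ξ
      = K * ∫ u in Ioi (0 : ℝ), (z + u) * (u ^ (A - 1) * Real.exp (-z * u - u ^ 2 / 2)) := by
    rw [qk, mw, show 2 * ((1 - A) / 2) = 1 - A by ring, ← hz, Dr_eq_integral hA hzp, hK,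
      show -1 + (1 - A) = -A by ring, show 1 - 4 * ((1 - A) / 2) = A + A - 1 by ring,
      Real.mul_rpow hQ.le hξ.le, Real.div_rpow hξ.le hQ.le, Real.rpow_neg hQ.le, Real.rpow_neg hξ.le,
      Real.rpow_sub hξ, Real.rpow_add hξ, Real.rpow_one]
    have he : Real.exp ((x ^ 2 + y ^ 2) / (2 * (x * y) ^ 2) - z ^ 2 / 2)
        = Real.exp (1 / (2 * x ^ 2) + 1 / (2 * y ^ 2) + 1 / (2 * ξ ^ 2)
          - ((x ^ 2 + y ^ 2 + ξ ^ 2) / (4 * x * y * ξ)) ^ 2) * Real.exp (-z ^ 2 / 4) *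
          Real.exp (-1 / (2 * ξ ^ 2)) := by
      rw [← Real.exp_add, ← Real.exp_add, hz]
      congr 1
      field_simp
      ring
    rw [he]
    have : 0 < ξ ^ A := by positivity
    field_simp
  have hcore : ∀ u ∈ Ioi (0 : ℝ), ENNReal.ofReal (ξ / (x * y)) *
      ENNReal.ofReal ((Real.Gamma A)⁻¹ *
        ((ξ / (x * y) * u) ^ (A - 1) * Real.exp (-(ξ / (x * y) * u))) *
        ((1 / (2 * (x * y))) * (1 + (x ^ 2 + y ^ 2 + 2 * (x * y) ^ 2 * (ξ / (x * y) * u)) / ξ ^ 2)) *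
        ((2 * Real.pi) ^ (-(1 : ℝ) / 2) * Real.exp (-((1 / (2 * (x * y))) *
          (ξ - (x ^ 2 + y ^ 2 + 2 * (x * y) ^ 2 * (ξ / (x * y) * u)) / ξ)) ^ 2 / 2)))
      = ENNReal.ofReal (K * ((z + u) * (u ^ (A - 1) * Real.exp (-z * u - u ^ 2 / 2)))) := by
    intro u hu
    have hu' : 0 < u := hu
    rw [← ENNReal.ofReal_mul (by positivity)]
    congr 1
    rw [Real.mul_rpow (by positivity) hu'.le, hK, Real.rpow_sub (by positivity) A 1 (x := ξ / (x * y)),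
      Real.rpow_one]
    have he : Real.exp (-(ξ / (x * y) * u)) * Real.exp (-((1 / (2 * (x * y))) *
          (ξ - (x ^ 2 + y ^ 2 + 2 * (x * y) ^ 2 * (ξ / (x * y) * u)) / ξ)) ^ 2 / 2)
        = Real.exp ((x ^ 2 + y ^ 2) / (2 * (x * y) ^ 2) - z ^ 2 / 2) *
          Real.exp (-z * u - u ^ 2 / 2) := by
      rw [← Real.exp_add, ← Real.exp_add, hz]
      congr 1
      field_simp
      ring
    have hc : ξ / (x * y) * ((1 / (2 * (x * y))) *
        (1 + (x ^ 2 + y ^ 2 + 2 * (x * y) ^ 2 * (ξ / (x * y) * u)) / ξ ^ 2))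
        = (ξ / (x * y)) * (ξ⁻¹ * (z + u)) := by
      rw [hz]
      field_simp
      ring
    have hp : (ξ / (x * y)) ≠ 0 := by positivity
    calc _ = (Real.Gamma A)⁻¹ * ((ξ / (x * y)) ^ A / (ξ / (x * y)) * u ^ (A - 1)) *
          (ξ / (x * y) * ((1 / (2 * (x * y))) *
            (1 + (x ^ 2 + y ^ 2 + 2 * (x * y) ^ 2 * (ξ / (x * y) * u)) / ξ ^ 2))) *
          (2 * Real.pi) ^ (-(1 : ℝ) / 2) *
          (Real.exp (-(ξ / (x * y) * u)) * Real.exp (-((1 / (2 * (x * y))) *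
          (ξ - (x ^ 2 + y ^ 2 + 2 * (x * y) ^ 2 * (ξ / (x * y) * u)) / ξ)) ^ 2 / 2)) := by ring
      _ = _ := by
        rw [he, hc]
        field_simp
  have hKp : 0 < K := by positivity
  rw [hqm, ← integral_const_mul, ofReal_integral_eq_lintegral_ofReal (hint.const_mul K)
    ((ae_restrict_iff' measurableSet_Ioi).2 (.of_forall fun u hu => by
      have hu' : 0 < u := hu
      simp only [Pi.zero_apply]
      positivity)),
    lintegral_Ioi_comp_mul_left (c := ξ / (x * y)) (by positivity),
    show 1 - 2 * ((1 - A) / 2) = A by ring]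
  exact setLIntegral_congr_fun measurableSet_Ioi hcore

/-- For positive arguments, `δ_x * δ_y` is the law of `iwPsi (x² + y²) (xy)`. -/
lemma lintegral_iwKernel_of_pos {α : ℝ} (hα : α < 1 / 2) {x y : ℝ} (hx : 0 < x) (hy : 0 < y)
    {f : ℝ → ENNReal} (hf : Measurable f) :
    ∫⁻ ω, f (iwPsi (x ^ 2 + y ^ 2) (x * y) ω) ∂(gaussGamma (1 - 2 * α)) =
      ∫⁻ ξ in Ioi (0 : ℝ), f ξ * ENNReal.ofReal (qk α x y ξ * mw α ξ) := by
  have hGA : 0 < Real.Gamma (1 - 2 * α) := Real.Gamma_pos_of_pos (by linarith)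
  have hstep : ∫⁻ ω, f (iwPsi (x ^ 2 + y ^ 2) (x * y) ω) ∂(gaussGamma (1 - 2 * α)) =
      ∫⁻ γ in Ioi (0 : ℝ), ∫⁻ ξ in Ioi (0 : ℝ),
        f ξ * ENNReal.ofReal ((Real.Gamma (1 - 2 * α))⁻¹ *
        (γ ^ (1 - 2 * α - 1) * Real.exp (-γ)) *
        ((1 / (2 * (x * y))) * (1 + (x ^ 2 + y ^ 2 + 2 * (x * y) ^ 2 * γ) / ξ ^ 2)) *
        ((2 * Real.pi) ^ (-(1 : ℝ) / 2) * Real.exp (-((1 / (2 * (x * y))) *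
          (ξ - (x ^ 2 + y ^ 2 + 2 * (x * y) ^ 2 * γ) / ξ)) ^ 2 / 2))) := by
    rw [lintegral_iwPsi (by linarith) (by positivity) (by positivity) hf]
    refine setLIntegral_congr_fun measurableSet_Ioi fun γ hγ => ?_
    have hγ' : 0 < γ := hγ
    rw [← lintegral_const_mul _ (by fun_prop)]
    refine setLIntegral_congr_fun measurableSet_Ioi fun ξ hξ => ?_
    have hξ' : 0 < ξ := hξ
    rw [mul_comm (f ξ), ← mul_assoc, ← mul_assoc, ← ENNReal.ofReal_mul (by positivity),
      ← ENNReal.ofReal_mul (by positivity)]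
  rw [hstep, lintegral_lintegral_swap (by fun_prop)]
  refine setLIntegral_congr_fun measurableSet_Ioi fun ξ hξ => ?_
  rw [lintegral_const_mul _ (by fun_prop), lintegral_gamma_eq_qk_mul_mw hα hx hy hξ]

lemma lintegral_rpow_mul_exp_neg_mul {a r : ℝ} (ha : 0 < a) (hr : 0 < r) :
    ∫⁻ t in Ioi (0 : ℝ), ENNReal.ofReal (t ^ (a - 1) * Real.exp (-(r * t)))
      = ENNReal.ofReal (r ^ (-a) * Real.Gamma a) := by
  have hi := integrableOn_rpow_mul_exp_neg_mul_rpow (p := 1) (s := a - 1) (b := r) (by linarith)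
    one_pos hr
  simp only [Real.rpow_one, neg_mul] at hi
  rw [← ofReal_integral_eq_lintegral_ofReal hi
    ((ae_restrict_iff' measurableSet_Ioi).2 (.of_forall fun u hu => by
      have hu' : 0 < u := hu
      simp only [Pi.zero_apply]
      positivity)), Real.integral_rpow_mul_exp_neg_mul_Ioi ha hr, one_div, Real.inv_rpow hr.le,
    Real.rpow_neg hr.le]

lemma lintegral_Ioi_comp_const_div {D : ℝ} (hD : 0 < D) (f : ℝ → ENNReal) :
    ∫⁻ t in Ioi (0 : ℝ), f t = ∫⁻ t in Ioi (0 : ℝ), ENNReal.ofReal (D / t ^ 2) * f (D / t) := by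
  have h := lintegral_image_eq_lintegral_deriv_mul_of_antitoneOn (s := Ioi (0 : ℝ))
    (f := fun t => D / t) (f' := fun t => -(D / t ^ 2)) measurableSet_Ioi
    (fun t ht => by
      have h1 := ((hasDerivAt_inv (ne_of_gt ht)).const_mul D).hasDerivWithinAt (s := Ioi (0 : ℝ))
      exact (h1.congr_deriv (by ring)).congr (fun t _ => by simp [div_eq_mul_inv])
        (by simp [div_eq_mul_inv]))
    (fun a ha b _ hab => by
      have : (0 : ℝ) < a := ha
      beta_reduce; gcongr) f
  simp only [neg_neg] at h
  rw [← h, show (fun t => D / t) '' Ioi (0 : ℝ) = Ioi 0 from ?_]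
  ext t
  constructor
  · rintro ⟨s, hs, rfl⟩
    have : (0 : ℝ) < s := hs
    exact div_pos hD this
  · intro ht
    have ht' : (0 : ℝ) < t := ht
    exact ⟨D / t, div_pos hD ht', by field_simp⟩

lemma lintegral_gaussian_density :
    ∫⁻ g : ℝ, ENNReal.ofReal ((2 * Real.pi) ^ (-(1 : ℝ) / 2) * Real.exp (-g ^ 2 / 2)) = 1 := by
  have h := lintegral_gaussianReal_zero_one (f := fun _ => 1) measurable_const
  simpa using h.symm

/-- Splitting the Gaussian normalisation into two halves under the substitution
`g = c (ρ ξ - B / ξ)`. -/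
lemma lintegral_gaussian_half {B c ρ : ℝ} (hB : 0 < B) (hc : 0 < c) (hρ : 0 < ρ) :
    (∫⁻ ξ in Ioi (0 : ℝ), ENNReal.ofReal (c * ρ * ((2 * Real.pi) ^ (-(1 : ℝ) / 2) *
        Real.exp (-(c * (ρ * ξ - B / ξ)) ^ 2 / 2))) = ENNReal.ofReal (1 / 2)) ∧
    (∫⁻ ξ in Ioi (0 : ℝ), ENNReal.ofReal (c * (B / ξ ^ 2) * ((2 * Real.pi) ^ (-(1 : ℝ) / 2) *
        Real.exp (-(c * (ρ * ξ - B / ξ)) ^ 2 / 2))) = ENNReal.ofReal (1 / 2)) := by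
  set I₁ := ∫⁻ ξ in Ioi (0 : ℝ), ENNReal.ofReal (c * ρ * ((2 * Real.pi) ^ (-(1 : ℝ) / 2) *
        Real.exp (-(c * (ρ * ξ - B / ξ)) ^ 2 / 2))) with hI₁
  set I₂ := ∫⁻ ξ in Ioi (0 : ℝ), ENNReal.ofReal (c * (B / ξ ^ 2) *
    ((2 * Real.pi) ^ (-(1 : ℝ) / 2) * Real.exp (-(c * (ρ * ξ - B / ξ)) ^ 2 / 2))) with hI₂
  have h12 : I₁ = I₂ := by
    rw [hI₁, lintegral_Ioi_comp_const_div (D := B / ρ) (by positivity)]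
    refine setLIntegral_congr_fun measurableSet_Ioi fun ξ hξ => ?_
    have hξ' : 0 < ξ := hξ
    rw [← ENNReal.ofReal_mul (by positivity)]
    have e : (-(c * (ρ * (B / ρ / ξ) - B / (B / ρ / ξ))) ^ 2 / 2)
        = (-(c * (ρ * ξ - B / ξ)) ^ 2 / 2) := by
      field_simp
      ring
    rw [e]
    congr 1
    field_simp
  have hsum : I₁ + I₂ = 1 := by
    rw [← lintegral_gaussian_density, lintegral_eq_lintegral_sub_div (B := B / ρ) (c := c * ρ)
      (by positivity) (by positivity), hI₁, hI₂, ← lintegral_add_left (by fun_prop)]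
    refine setLIntegral_congr_fun measurableSet_Ioi fun ξ hξ => ?_
    have hξ' : 0 < ξ := hξ
    rw [← ENNReal.ofReal_mul (by positivity), ← ENNReal.ofReal_add (by positivity) (by positivity)]
    have e : c * ρ * (ξ - B / ρ / ξ) = c * (ρ * ξ - B / ξ) := by field_simp
    rw [e]
    congr 1
    field_simp
  rw [← h12] at hsum ⊢
  have : I₁ = ENNReal.ofReal (1 / 2) := by
    have hfin : I₁ ≠ ⊤ := fun h => by simp [h] at hsum
    rw [← ENNReal.ofReal_toReal hfin]
    congr 1
    have := congrArg ENNReal.toReal hsum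
    rw [ENNReal.toReal_add hfin hfin, ENNReal.toReal_one] at this
    linarith
  exact ⟨this, this⟩

lemma lintegral_exp_neg_sq_conditional {B Q k : ℝ} (hB : 0 < B) (hQ : 0 < Q) (hk : 0 ≤ k) :
    ∫⁻ ξ in Ioi (0 : ℝ), ENNReal.ofReal ((1 / (2 * Q)) * (1 + B / ξ ^ 2)) *
          (ENNReal.ofReal ((2 * Real.pi) ^ (-(1 : ℝ) / 2) *
            Real.exp (-((1 / (2 * Q)) * (ξ - B / ξ)) ^ 2 / 2)) *
          ENNReal.ofReal (Real.exp (-((k + 2 * Q ^ 2 * k ^ 2) * ξ ^ 2))))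
      = ENNReal.ofReal ((1 + 2 * Q ^ 2 * k) / (1 + 4 * Q ^ 2 * k) * Real.exp (-(B * k))) := by
  set ρ : ℝ := 1 + 4 * Q ^ 2 * k with hρ
  have hρp : 0 < ρ := by positivity
  obtain ⟨h1, h2⟩ := lintegral_gaussian_half (c := 1 / (2 * Q)) hB (by positivity) hρp
  have hstep : ∀ ξ ∈ Ioi (0 : ℝ), ENNReal.ofReal ((1 / (2 * Q)) * (1 + B / ξ ^ 2)) *
          (ENNReal.ofReal ((2 * Real.pi) ^ (-(1 : ℝ) / 2) *
            Real.exp (-((1 / (2 * Q)) * (ξ - B / ξ)) ^ 2 / 2)) *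
          ENNReal.ofReal (Real.exp (-((k + 2 * Q ^ 2 * k ^ 2) * ξ ^ 2))))
      = ENNReal.ofReal (ρ⁻¹ * Real.exp (-(B * k))) * ENNReal.ofReal (1 / (2 * Q) * ρ *
          ((2 * Real.pi) ^ (-(1 : ℝ) / 2) *
            Real.exp (-(1 / (2 * Q) * (ρ * ξ - B / ξ)) ^ 2 / 2)))
        + ENNReal.ofReal (Real.exp (-(B * k))) * ENNReal.ofReal (1 / (2 * Q) * (B / ξ ^ 2) *
          ((2 * Real.pi) ^ (-(1 : ℝ) / 2) *
            Real.exp (-(1 / (2 * Q) * (ρ * ξ - B / ξ)) ^ 2 / 2))) := by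
    intro ξ hξ
    have hξ' : 0 < ξ := hξ
    rw [← ENNReal.ofReal_mul (by positivity), ← ENNReal.ofReal_mul (by positivity),
      ← ENNReal.ofReal_mul (by positivity), ← ENNReal.ofReal_mul (by positivity),
      ← ENNReal.ofReal_add (by positivity) (by positivity)]
    have e : Real.exp (-((1 / (2 * Q)) * (ξ - B / ξ)) ^ 2 / 2) *
        Real.exp (-((k + 2 * Q ^ 2 * k ^ 2) * ξ ^ 2))
        = Real.exp (-(B * k)) * Real.exp (-(1 / (2 * Q) * (ρ * ξ - B / ξ)) ^ 2 / 2) := by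
      rw [← Real.exp_add, ← Real.exp_add, hρ]
      congr 1
      field_simp
      ring
    rw [mul_assoc ((2 * Real.pi) ^ (-(1 : ℝ) / 2)), e]
    congr 1
    field_simp
  rw [setLIntegral_congr_fun measurableSet_Ioi hstep, lintegral_add_left (by fun_prop),
    lintegral_const_mul _ (by fun_prop), lintegral_const_mul _ (by fun_prop), h1, h2,
    ← ENNReal.ofReal_mul (by positivity), ← ENNReal.ofReal_mul (by positivity),
    ← ENNReal.ofReal_add (by positivity) (by positivity)]
  congr 1
  rw [hρ]
  field_simp
  ring

/-- The Gaussian-type Laplace transform of `iwPsi`. -/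
lemma lintegral_exp_neg_sq_iwPsi {A P Q k : ℝ} (hA : 0 < A) (hP : 0 < P) (hQ : 0 < Q)
    (hk : 0 ≤ k) :
    ∫⁻ ω, ENNReal.ofReal (Real.exp (-((k + 2 * Q ^ 2 * k ^ 2) * iwPsi P Q ω ^ 2))) ∂(gaussGamma A)
      = ENNReal.ofReal ((1 + 2 * Q ^ 2 * k) ^ (1 - A) / (1 + 4 * Q ^ 2 * k) *
          Real.exp (-(P * k))) := by
  have hGA : 0 < Real.Gamma A := Real.Gamma_pos_of_pos hA
  rw [lintegral_iwPsi (f := fun ξ => ENNReal.ofReal (Real.exp (-((k + 2 * Q ^ 2 * k ^ 2) * ξ ^ 2))))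
    hA hP hQ (by fun_prop)]
  have hstep : ∀ γ ∈ Ioi (0 : ℝ),
      ENNReal.ofReal ((Real.Gamma A)⁻¹ * (γ ^ (A - 1) * Real.exp (-γ))) *
        ∫⁻ ξ in Ioi (0 : ℝ), ENNReal.ofReal ((1 / (2 * Q)) * (1 + (P + 2 * Q ^ 2 * γ) / ξ ^ 2)) *
          (ENNReal.ofReal ((2 * Real.pi) ^ (-(1 : ℝ) / 2) *
            Real.exp (-((1 / (2 * Q)) * (ξ - (P + 2 * Q ^ 2 * γ) / ξ)) ^ 2 / 2)) *
          ENNReal.ofReal (Real.exp (-((k + 2 * Q ^ 2 * k ^ 2) * ξ ^ 2))))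
      = ENNReal.ofReal ((Real.Gamma A)⁻¹ * ((1 + 2 * Q ^ 2 * k) / (1 + 4 * Q ^ 2 * k) *
          Real.exp (-(P * k)))) *
        ENNReal.ofReal (γ ^ (A - 1) * Real.exp (-((1 + 2 * Q ^ 2 * k) * γ))) := by
    intro γ hγ
    have hγ' : 0 < γ := hγ
    rw [lintegral_exp_neg_sq_conditional (by positivity) hQ hk, ← ENNReal.ofReal_mul (by positivity),
      ← ENNReal.ofReal_mul (by positivity)]
    have e : Real.exp (-γ) * Real.exp (-((P + 2 * Q ^ 2 * γ) * k))
        = Real.exp (-(P * k)) * Real.exp (-((1 + 2 * Q ^ 2 * k) * γ)) := by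
      rw [← Real.exp_add, ← Real.exp_add]
      congr 1
      ring
    congr 1
    linear_combination ((Real.Gamma A)⁻¹ * γ ^ (A - 1) * ((1 + 2 * Q ^ 2 * k) /
      (1 + 4 * Q ^ 2 * k))) * e
  rw [setLIntegral_congr_fun measurableSet_Ioi hstep, lintegral_const_mul _ (by fun_prop),
    lintegral_rpow_mul_exp_neg_mul hA (by positivity), ← ENNReal.ofReal_mul (by positivity)]
  congr 1
  rw [Real.rpow_sub (by positivity), Real.rpow_one, Real.rpow_neg (by positivity)]
  field_simp

lemma iwPsi_zero_right (P : ℝ) (ω : ℝ × ℝ) : iwPsi P 0 ω = √P := by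
  simp [iwPsi]

lemma lintegral_exp_neg_sq_iwPsi' {A P Q k : ℝ} (hA : 0 < A) (hP : 0 < P) (hQ : 0 ≤ Q)
    (hk : 0 ≤ k) :
    ∫⁻ ω, ENNReal.ofReal (Real.exp (-((k + 2 * Q ^ 2 * k ^ 2) * iwPsi P Q ω ^ 2))) ∂(gaussGamma A)
      = ENNReal.ofReal ((1 + 2 * Q ^ 2 * k) ^ (1 - A) / (1 + 4 * Q ^ 2 * k) *
          Real.exp (-(P * k))) := by
  rcases hQ.eq_or_lt with rfl | hQ
  · have := isProbabilityMeasure_gaussGamma hA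
    simp [iwPsi_zero_right, Real.sq_sqrt hP.le, mul_comm]
  · exact lintegral_exp_neg_sq_iwPsi hA hP hQ hk

lemma lintegral_Ioi_comp_of_monotoneOn {f f' : ℝ → ℝ} (hc : ContinuousOn f (Ici 0)) (h0 : f 0 = 0)
    (hpos : ∀ k, 0 < k → 0 < f k) (hmono : MonotoneOn f (Ioi 0))
    (hd : ∀ k, 0 < k → HasDerivAt f (f' k) k) (hunb : ∀ τ, 0 < τ → ∃ K, 0 < K ∧ τ ≤ f K)
    (F : ℝ → ENNReal) :
    ∫⁻ t in Ioi (0 : ℝ), F t = ∫⁻ k in Ioi (0 : ℝ), ENNReal.ofReal (f' k) * F (f k) := by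
  rw [← lintegral_image_eq_lintegral_deriv_mul_of_monotoneOn measurableSet_Ioi
    (fun k hk => (hd k hk).hasDerivWithinAt) hmono F]
  congr 2
  ext τ
  constructor
  · intro hτ
    obtain ⟨K, hK, hle⟩ := hunb τ hτ
    obtain ⟨k, hk, rfl⟩ := intermediate_value_Icc hK.le (hc.mono Icc_subset_Ici_self)
      ⟨h0.le.trans (le_of_lt hτ), hle⟩
    refine ⟨k, lt_of_le_of_ne hk.1 ?_, rfl⟩
    rintro rfl
    exact hτ.ne' h0
  · rintro ⟨k, hk, rfl⟩
    exact hpos k hk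

/-- The parameter `r` with `2 r² = k + 2 Q² k²`. -/
def iwRad (Q k : ℝ) : ℝ := √((k + 2 * Q ^ 2 * k ^ 2) / 2)

lemma iwRad_sq {k : ℝ} (Q : ℝ) (hk : 0 ≤ k) : 2 * iwRad Q k ^ 2 = k + 2 * Q ^ 2 * k ^ 2 := by
  rw [iwRad, Real.sq_sqrt (by positivity)]
  ring

lemma iwRad_pos {k : ℝ} (Q : ℝ) (hk : 0 < k) : 0 < iwRad Q k :=
  Real.sqrt_pos.2 (by positivity)

lemma iwRad_zero (Q : ℝ) : iwRad Q 0 = 0 := by simp [iwRad]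

lemma monotoneOn_iwRad (Q : ℝ) : MonotoneOn (iwRad Q) (Ioi 0) := by
  intro a ha b _ hab
  have : (0 : ℝ) < a := ha
  unfold iwRad
  gcongr

lemma continuous_iwRad (Q : ℝ) : Continuous (iwRad Q) := by
  unfold iwRad
  fun_prop

lemma hasDerivAt_iwRad {k : ℝ} (Q : ℝ) (hk : 0 < k) :
    HasDerivAt (iwRad Q) ((1 + 4 * Q ^ 2 * k) / (4 * iwRad Q k)) k := by
  have h1 : HasDerivAt (fun k => (k + 2 * Q ^ 2 * k ^ 2) / 2) ((1 + 2 * Q ^ 2 * (2 * k)) / 2) k := by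
    have := ((hasDerivAt_id k).add ((hasDerivAt_pow 2 k).const_mul (2 * Q ^ 2))).div_const 2
    simpa using this
  have h2 := h1.sqrt (by positivity)
  refine h2.congr_deriv ?_
  rw [iwRad]
  field_simp
  ring

/-- Laplace-type transform underlying the multiplicative functions of the convolution. -/
def iwG (A ρ x : ℝ) : ENNReal :=
  ∫⁻ t in Ioi (0 : ℝ), ENNReal.ofReal (t ^ (A - 1) * Real.exp (-((1 + ρ) * t) - 2 * ρ * x ^ 2 * t ^ 2))

/-- The common value of the two sides of `lintegral_iwG_iwPsi`. -/
def iwGProd (A s x y : ℝ) : ENNReal :=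
  ∫⁻ k in Ioi (0 : ℝ), ENNReal.ofReal (1 / (4 * iwRad (x * y) k * s) *
    ((k / (2 * iwRad (x * y) k * s)) ^ (A - 1) *
      Real.exp (-((s + 1 / s) * iwRad (x * y) k + (x ^ 2 + y ^ 2) * k))))

lemma lintegral_iwG_left {A s x y : ℝ} (hA : 0 < A) (hs : 0 < s) (hx : 0 ≤ x) (hy : 0 < y) :
    ∫⁻ ω, iwG A (s ^ 2) (iwPsi (x ^ 2 + y ^ 2) (x * y) ω) ∂(gaussGamma A) = iwGProd A s x y := by
  have := isProbabilityMeasure_gaussGamma hA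
  unfold iwG
  rw [lintegral_lintegral_swap (by fun_prop), lintegral_Ioi_comp_of_monotoneOn
    (f := fun k => iwRad (x * y) k / s)
    (f' := fun k => ((1 + 4 * (x * y) ^ 2 * k) / (4 * iwRad (x * y) k)) / s)
    ((continuous_iwRad _).div_const s).continuousOn (by simp [iwRad_zero])
    (fun k hk => div_pos (iwRad_pos _ hk) hs)
    (fun a ha b hb hab => by
      have := monotoneOn_iwRad (x * y) ha hb hab
      beta_reduce; gcongr)
    (fun k hk => (hasDerivAt_iwRad _ hk).div_const s)
    (fun τ hτ => ⟨2 * (τ * s) ^ 2, by positivity, by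
      rw [le_div_iff₀ hs]
      refine Real.le_sqrt_of_sq_le ?_
      have : 0 ≤ 2 * (x * y) ^ 2 * (2 * (τ * s) ^ 2) ^ 2 := by positivity
      linarith⟩)]
  refine setLIntegral_congr_fun measurableSet_Ioi fun k hk => ?_
  have hk' : 0 < k := hk
  have hr := iwRad_pos (x * y) hk'
  have hr2 := iwRad_sq (x * y) hk'.le
  set r := iwRad (x * y) k
  have hstep : ∀ ω : ℝ × ℝ, ENNReal.ofReal ((r / s) ^ (A - 1) * Real.exp (-((1 + s ^ 2) * (r / s))
        - 2 * s ^ 2 * iwPsi (x ^ 2 + y ^ 2) (x * y) ω ^ 2 * (r / s) ^ 2))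
      = ENNReal.ofReal ((r / s) ^ (A - 1) * Real.exp (-((s + 1 / s) * r))) *
        ENNReal.ofReal (Real.exp (-((k + 2 * (x * y) ^ 2 * k ^ 2) *
          iwPsi (x ^ 2 + y ^ 2) (x * y) ω ^ 2))) := by
    intro ω
    rw [← ENNReal.ofReal_mul (by positivity), mul_assoc _ (Real.exp _) (Real.exp _), ← Real.exp_add,
      ← hr2]
    congr 3
    field_simp
    ring
  simp_rw [hstep]
  rw [lintegral_const_mul _ (by fun_prop), lintegral_exp_neg_sq_iwPsi' hA (by positivity)
    (by positivity) hk'.le, ← ENNReal.ofReal_mul (by positivity), ← ENNReal.ofReal_mul (by positivity)]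
  congr 1
  have e1 : 1 + 2 * (x * y) ^ 2 * k = 2 * r ^ 2 / k := by
    rw [hr2]; field_simp
  have e2 : k / (2 * r * s) = (r / s) / (2 * r ^ 2 / k) := by field_simp
  rw [e1, e2, neg_add, Real.exp_add, Real.div_rpow (by positivity) (by positivity) (x := r / s),
    show 1 - A = -(A - 1) by ring, Real.rpow_neg (by positivity)]
  have h4 : 0 < 1 + 4 * (x * y) ^ 2 * k := by positivity
  field_simp

lemma lintegral_iwG_right {A s x y : ℝ} (hA : 0 < A) (hs : 0 < s) (hy : 0 < y) :
    ∫⁻ ω, iwG A (s ^ 2 * iwPsi 1 y ω ^ 2) x ∂(gaussGamma A) = iwGProd A s x y := by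
  have := isProbabilityMeasure_gaussGamma hA
  unfold iwG
  rw [lintegral_lintegral_swap (by fun_prop), lintegral_Ioi_comp_of_monotoneOn
    (f := fun k => iwRad (x * y) k / s + y ^ 2 * k)
    (f' := fun k => ((1 + 4 * (x * y) ^ 2 * k) / (4 * iwRad (x * y) k)) / s + y ^ 2)
    (((continuous_iwRad _).div_const s).add (by fun_prop)).continuousOn (by simp [iwRad_zero])
    (fun k hk => add_pos (div_pos (iwRad_pos _ hk) hs) (by positivity))
    (fun a ha b hb hab => by
      have := monotoneOn_iwRad (x * y) ha hb hab
      beta_reduce; gcongr)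
    (fun k hk => by
      have h2 : HasDerivAt (fun k => y ^ 2 * k) (y ^ 2) k := by
        simpa using (hasDerivAt_id k).const_mul (y ^ 2)
      exact ((hasDerivAt_iwRad (x * y) hk).div_const s).add h2)
    (fun τ hτ => ⟨τ / y ^ 2, by positivity, by
      have := iwRad_pos (x * y) (k := τ / y ^ 2) (by positivity)
      rw [mul_div_cancel₀ _ (by positivity : y ^ 2 ≠ 0)]
      have : 0 < iwRad (x * y) (τ / y ^ 2) / s := by positivity
      linarith⟩)]
  refine setLIntegral_congr_fun measurableSet_Ioi fun k hk => ?_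
  have hk' : 0 < k := hk
  have hr := iwRad_pos (x * y) hk'
  have hr2 := iwRad_sq (x * y) hk'.le
  set r := iwRad (x * y) k
  set k₁ := x ^ 2 * k + s * r with hk₁
  have hk₁p : 0 < k₁ := by positivity
  have hκ : s * (r + y ^ 2 * s * k) + 2 * x ^ 2 * (r + y ^ 2 * s * k) ^ 2
      = k₁ + 2 * y ^ 2 * k₁ ^ 2 := by
    rw [hk₁]
    linear_combination (x ^ 2 - y ^ 2 * s ^ 2) * hr2
  have hstep : ∀ ω : ℝ × ℝ, ENNReal.ofReal ((r / s + y ^ 2 * k) ^ (A - 1) *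
        Real.exp (-((1 + s ^ 2 * iwPsi 1 y ω ^ 2) * (r / s + y ^ 2 * k))
        - 2 * (s ^ 2 * iwPsi 1 y ω ^ 2) * x ^ 2 * (r / s + y ^ 2 * k) ^ 2))
      = ENNReal.ofReal ((r / s + y ^ 2 * k) ^ (A - 1) * Real.exp (-(r / s + y ^ 2 * k))) *
        ENNReal.ofReal (Real.exp (-((k₁ + 2 * y ^ 2 * k₁ ^ 2) * iwPsi 1 y ω ^ 2))) := by
    intro ω
    rw [← ENNReal.ofReal_mul (by positivity), mul_assoc _ (Real.exp _) (Real.exp _), ← Real.exp_add,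
      ← hκ]
    congr 3
    field_simp
    ring
  simp_rw [hstep]
  rw [lintegral_const_mul _ (by fun_prop), lintegral_exp_neg_sq_iwPsi' hA (by positivity)
    (by positivity) hk₁p.le, ← ENNReal.ofReal_mul (by positivity), ← ENNReal.ofReal_mul (by positivity)]
  congr 1
  have e1 : 1 + 2 * y ^ 2 * k₁ = 2 * r * s / k * (r / s + y ^ 2 * k) := by
    rw [hk₁]
    field_simp
    linear_combination -hr2
  have e3 : 1 + 4 * y ^ 2 * k₁ = 4 * r * s * ((1 + 4 * (x * y) ^ 2 * k) / (4 * r) / s + y ^ 2) := by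
    rw [hk₁]
    field_simp
    ring
  have e2 : k / (2 * r * s) = (r / s + y ^ 2 * k) / (2 * r * s / k * (r / s + y ^ 2 * k)) := by
    have : 0 < r / s + y ^ 2 * k := by positivity
    field_simp
  have e4 : Real.exp (-((s + 1 / s) * r + (x ^ 2 + y ^ 2) * k))
      = Real.exp (-(r / s + y ^ 2 * k)) * Real.exp (-(1 * k₁)) := by
    rw [← Real.exp_add, hk₁]
    congr 1
    field_simp
    ring
  have h4 : 0 < (1 + 4 * (x * y) ^ 2 * k) / (4 * r) / s + y ^ 2 := by positivity
  have h5 : 0 < r / s + y ^ 2 * k := by positivity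
  rw [e4, e1, e3, e2]
  generalize (1 + 4 * (x * y) ^ 2 * k) / (4 * r) / s + y ^ 2 = u at *
  generalize r / s + y ^ 2 * k = v at *
  rw [Real.div_rpow h5.le (by positivity) (x := v),
    show 1 - A = -(A - 1) by ring, Real.rpow_neg (by positivity)]
  field_simp

/-- The key symmetry behind the product formula. -/
lemma lintegral_iwG_iwPsi {A s x y : ℝ} (hA : 0 < A) (hs : 0 < s) (hx : 0 ≤ x) (hy : 0 < y) :
    ∫⁻ ω, iwG A (s ^ 2) (iwPsi (x ^ 2 + y ^ 2) (x * y) ω) ∂(gaussGamma A)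
      = ∫⁻ ω, iwG A (s ^ 2 * iwPsi 1 y ω ^ 2) x ∂(gaussGamma A) := by
  rw [lintegral_iwG_left hA hs hx hy, lintegral_iwG_right hA hs hy]

lemma measurable_iwG (A : ℝ) : Measurable fun p : ℝ × ℝ => iwG A p.1 p.2 := by
  unfold iwG
  exact Measurable.lintegral_prod_right' (f := fun q : (ℝ × ℝ) × ℝ => ENNReal.ofReal (q.2 ^ (A - 1) *
    Real.exp (-((1 + q.1.1) * q.2) - 2 * q.1.1 * q.1.2 ^ 2 * q.2 ^ 2))) (by fun_prop)

attribute [local irreducible] iwG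

@[fun_prop]
lemma measurable_iwG_comp {β : Type*} [MeasurableSpace β] {A : ℝ} {f g : β → ℝ} (hf : Measurable f)
    (hg : Measurable g) : Measurable fun b => iwG A (f b) (g b) := by
  have := (measurable_iwG A).comp (hf.prodMk hg)
  exact this

/-- Mellin transform of `iwG` in the parameter `ρ`. -/
def iwN (A a x : ℝ) : ENNReal :=
  ∫⁻ ρ in Ioi (0 : ℝ), ENNReal.ofReal (ρ ^ (a - 1)) * iwG A ρ x

lemma iwPsi_one_pos (y : ℝ) (ω : ℝ × ℝ) : 0 < iwPsi 1 y ω := by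
  have h : |y * ω.1| < √(1 + y ^ 2 * (ω.1 ^ 2 + 2 * |ω.2|)) := by
    apply Real.lt_sqrt_of_sq_lt
    rw [sq_abs]
    have := abs_nonneg ω.2
    nlinarith [mul_nonneg (sq_nonneg y) this]
  have := neg_abs_le (y * ω.1)
  rw [iwPsi]
  linarith

/-- The multiplier relating `iwN` under the product formula. -/
def iwMult (A a y : ℝ) : ENNReal := ∫⁻ ω, ENNReal.ofReal (iwPsi 1 y ω ^ (-2 * a)) ∂(gaussGamma A)

lemma lintegral_iwN_iwPsi {A a x y : ℝ} (hA : 0 < A) (hx : 0 ≤ x) (hy : 0 < y) :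
    ∫⁻ ω, iwN A a (iwPsi (x ^ 2 + y ^ 2) (x * y) ω) ∂(gaussGamma A) = iwMult A a y * iwN A a x := by
  have := isProbabilityMeasure_gaussGamma hA
  have hL : ∫⁻ ω, iwN A a (iwPsi (x ^ 2 + y ^ 2) (x * y) ω) ∂(gaussGamma A)
      = ∫⁻ ρ in Ioi (0 : ℝ), ∫⁻ ω, ENNReal.ofReal (ρ ^ (a - 1)) *
        iwG A (ρ * iwPsi 1 y ω ^ 2) x ∂(gaussGamma A) := by
    unfold iwN
    rw [lintegral_lintegral_swap (by fun_prop)]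
    refine setLIntegral_congr_fun measurableSet_Ioi fun ρ hρ => ?_
    have hρ' : 0 < ρ := hρ
    rw [lintegral_const_mul _ (by fun_prop), lintegral_const_mul _ (by fun_prop)]
    have := lintegral_iwG_iwPsi (A := A) (s := √ρ) hA (Real.sqrt_pos.2 hρ') hx hy
    rw [Real.sq_sqrt hρ'.le] at this
    rw [this]
  rw [hL, ← lintegral_lintegral_swap (by fun_prop), iwMult, ← lintegral_mul_const _ (by fun_prop)]
  refine lintegral_congr fun ω => ?_
  have hM := iwPsi_one_pos y ω
  set M := iwPsi 1 y ω
  rw [lintegral_Ioi_comp_mul_left (c := (M ^ 2)⁻¹) (by positivity), iwN,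
    ← lintegral_const_mul _ (by fun_prop)]
  refine setLIntegral_congr_fun measurableSet_Ioi fun ρ hρ => ?_
  have hρ' : 0 < ρ := hρ
  rw [← mul_assoc, ← mul_assoc, ← ENNReal.ofReal_mul (by positivity),
    ← ENNReal.ofReal_mul (by positivity)]
  congr 2
  · rw [Real.mul_rpow (by positivity) hρ'.le, Real.inv_rpow (by positivity), ← Real.rpow_natCast M 2,
      ← Real.rpow_mul hM.le, ← Real.rpow_neg hM.le, ← Real.rpow_neg hM.le, ← mul_assoc,
      ← Real.rpow_add hM]
    congr 2
    push_cast
    ring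
  · field_simp

/-- The product of two gamma laws whose mixture represents the multiplicative functions. -/
def iwMix (A a : ℝ) : Measure (ℝ × ℝ) :=
  (ProbabilityTheory.gammaMeasure a 1).prod (ProbabilityTheory.gammaMeasure (A - a) 1)

lemma isProbabilityMeasure_iwMix {A a : ℝ} (ha : 0 < a) (haA : a < A) :
    IsProbabilityMeasure (iwMix A a) := by
  have h1 := ProbabilityTheory.isProbabilityMeasure_gammaMeasure ha one_pos
  have h2 := ProbabilityTheory.isProbabilityMeasure_gammaMeasure (sub_pos.2 haA) one_pos
  unfold iwMix
  infer_instance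

/-- The multiplicative functions of the index Whittaker convolution with parameter `a ∈ (0, A)`. -/
def iwChi (A a x : ℝ) : ℝ :=
  ∫ p, Real.exp (-(x ^ 2 * (2 * |p.1 * p.2|))) ∂(iwMix A a)

lemma integrable_exp_neg_mul_abs {β : Type*} [MeasurableSpace β] (μ : Measure β) [IsFiniteMeasure μ]
    {f : β → ℝ} (hf : Measurable f) (h0 : ∀ b, 0 ≤ f b) :
    Integrable (fun b => Real.exp (-f b)) μ := by
  refine Integrable.of_bound (C := 1) (by fun_prop) (.of_forall fun b => ?_)
  rw [Real.norm_of_nonneg (Real.exp_pos _).le]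
  exact Real.exp_le_one_iff.2 (by linarith [h0 b])

lemma iwN_eq_iwChi {A a : ℝ} (ha : 0 < a) (haA : a < A) (x : ℝ) :
    iwN A a x = ENNReal.ofReal (Real.Gamma a * Real.Gamma (A - a)) * ENNReal.ofReal (iwChi A a x) := by
  have h1 := ProbabilityTheory.isProbabilityMeasure_gammaMeasure ha one_pos
  have h2 := ProbabilityTheory.isProbabilityMeasure_gammaMeasure (sub_pos.2 haA) one_pos
  have hG1 : 0 < Real.Gamma a := Real.Gamma_pos_of_pos ha
  have hG2 : 0 < Real.Gamma (A - a) := Real.Gamma_pos_of_pos (sub_pos.2 haA)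
  rw [iwChi, iwMix, ofReal_integral_eq_lintegral_ofReal
    (integrable_exp_neg_mul_abs _ (by fun_prop) (fun p => by positivity))
    (.of_forall fun p => (Real.exp_pos _).le), lintegral_prod_symm _ (by fun_prop),
    lintegral_gammaMeasure_one (by fun_prop), iwN]
  have hN : ∫⁻ ρ in Ioi (0 : ℝ), ENNReal.ofReal (ρ ^ (a - 1)) * iwG A ρ x
      = ∫⁻ ρ in Ioi (0 : ℝ), ∫⁻ t in Ioi (0 : ℝ), ENNReal.ofReal (ρ ^ (a - 1)) *
        ENNReal.ofReal (t ^ (A - 1) * Real.exp (-((1 + ρ) * t) - 2 * ρ * x ^ 2 * t ^ 2)) := by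
    refine lintegral_congr fun ρ => ?_
    rw [iwG, lintegral_const_mul _ (by fun_prop)]
  rw [hN, lintegral_lintegral_swap (by fun_prop), ← lintegral_const_mul _ (by fun_prop)]
  refine setLIntegral_congr_fun measurableSet_Ioi fun t ht => ?_
  have ht' : 0 < t := ht
  rw [lintegral_gammaMeasure_one (by fun_prop), lintegral_Ioi_comp_mul_left (c := t⁻¹) (by positivity),
    ← lintegral_const_mul _ (by fun_prop), ← lintegral_const_mul _ (by fun_prop)]
  refine setLIntegral_congr_fun measurableSet_Ioi fun s hs => ?_
  have hs' : 0 < s := hs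
  rw [← ENNReal.ofReal_mul (by positivity), ← ENNReal.ofReal_mul (by positivity),
    ← ENNReal.ofReal_mul (by positivity), ← ENNReal.ofReal_mul (by positivity),
    ← ENNReal.ofReal_mul (by positivity)]
  congr 1
  rw [abs_of_pos (by positivity : 0 < s * t), Real.mul_rpow (by positivity) hs'.le,
    Real.inv_rpow ht'.le, Real.rpow_sub ht' a 1, Real.rpow_sub ht' A 1, Real.rpow_sub ht' (A - a) 1,
    Real.rpow_sub ht' A a]
  have e : Real.exp (-((1 + t⁻¹ * s) * t) - 2 * (t⁻¹ * s) * x ^ 2 * t ^ 2)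
      = Real.exp (-t) * (Real.exp (-s) * Real.exp (-(x ^ 2 * (2 * (s * t))))) := by
    rw [← Real.exp_add, ← Real.exp_add]
    congr 1
    field_simp
    ring
  rw [e]
  have := Real.rpow_pos_of_pos ht' a
  have := Real.rpow_pos_of_pos ht' A
  simp only [Real.rpow_one]
  field_simp

lemma integrable_iwChi_integrand {A a : ℝ} (ha : 0 < a) (haA : a < A) (x : ℝ) :
    Integrable (fun p : ℝ × ℝ => Real.exp (-(x ^ 2 * (2 * |p.1 * p.2|)))) (iwMix A a) := by
  have := isProbabilityMeasure_iwMix ha haA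
  exact integrable_exp_neg_mul_abs _ (by fun_prop) (fun p => by positivity)

lemma iwChi_zero {A a : ℝ} (ha : 0 < a) (haA : a < A) : iwChi A a 0 = 1 := by
  have := isProbabilityMeasure_iwMix ha haA
  simp [iwChi]

lemma iwChi_nonneg (A a x : ℝ) : 0 ≤ iwChi A a x := integral_nonneg fun _ => (Real.exp_pos _).le

lemma iwChi_pos {A a : ℝ} (ha : 0 < a) (haA : a < A) (x : ℝ) : 0 < iwChi A a x := by
  have := isProbabilityMeasure_iwMix ha haA
  exact integral_exp_pos (integrable_iwChi_integrand ha haA x)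

lemma iwChi_anti {A a : ℝ} (ha : 0 < a) (haA : a < A) {x y : ℝ} (hx : 0 ≤ x) (hxy : x ≤ y) :
    iwChi A a y ≤ iwChi A a x :=
  integral_mono (integrable_iwChi_integrand ha haA y) (integrable_iwChi_integrand ha haA x)
    fun p => by dsimp only; gcongr

lemma iwChi_abs (A a x : ℝ) : iwChi A a |x| = iwChi A a x := by
  simp [iwChi, sq_abs]

lemma iwChi_le_one {A a : ℝ} (ha : 0 < a) (haA : a < A) (x : ℝ) : iwChi A a x ≤ 1 := by
  rw [← iwChi_abs, ← iwChi_zero ha haA]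
  exact iwChi_anti ha haA le_rfl (abs_nonneg x)

lemma continuous_iwChi {A a : ℝ} (ha : 0 < a) (haA : a < A) : Continuous (iwChi A a) := by
  have := isProbabilityMeasure_iwMix ha haA
  refine continuous_of_dominated (bound := fun _ => 1) (fun x => by fun_prop) (fun x => ?_)
    (integrable_const _) (.of_forall fun p => by fun_prop)
  refine .of_forall fun p => ?_
  rw [Real.norm_of_nonneg (Real.exp_pos _).le]
  exact Real.exp_le_one_iff.2 (neg_nonpos.2 (by positivity))

lemma ae_ne_zero_gammaMeasure (a : ℝ) : ∀ᵐ s ∂(ProbabilityTheory.gammaMeasure a 1), s ≠ 0 :=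
  (withDensity_absolutelyContinuous _ _).ae_le (Measure.ae_ne volume 0)

lemma ae_iwMix_pos {A a : ℝ} (ha : 0 < a) (haA : a < A) :
    ∀ᵐ p ∂(iwMix A a), 0 < 2 * |p.1 * p.2| := by
  have h1 := ProbabilityTheory.isProbabilityMeasure_gammaMeasure ha one_pos
  have h2 := ProbabilityTheory.isProbabilityMeasure_gammaMeasure (sub_pos.2 haA) one_pos
  have e1 : ∀ᵐ p ∂(iwMix A a), p.1 ≠ 0 := quasiMeasurePreserving_fst.ae (ae_ne_zero_gammaMeasure a)
  have e2 : ∀ᵐ p ∂(iwMix A a), p.2 ≠ 0 :=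
    quasiMeasurePreserving_snd.ae (ae_ne_zero_gammaMeasure (A - a))
  filter_upwards [e1, e2] with p h1 h2
  positivity

lemma tendsto_iwChi_atTop {A a : ℝ} (ha : 0 < a) (haA : a < A) :
    Tendsto (iwChi A a) atTop (𝓝 0) := by
  have := isProbabilityMeasure_iwMix ha haA
  have h := tendsto_integral_filter_of_dominated_convergence (μ := iwMix A a) (l := atTop)
    (F := fun (x : ℝ) (p : ℝ × ℝ) => Real.exp (-(x ^ 2 * (2 * |p.1 * p.2|)))) (f := fun _ => 0)
    (fun _ => 1) (.of_forall fun x => by fun_prop) (.of_forall fun x => .of_forall fun p => by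
      rw [Real.norm_of_nonneg (Real.exp_pos _).le]
      exact Real.exp_le_one_iff.2 (neg_nonpos.2 (by positivity))) (integrable_const _) (by
      filter_upwards [ae_iwMix_pos ha haA] with p hp
      exact Real.tendsto_exp_atBot.comp (tendsto_neg_atTop_atBot.comp
        ((tendsto_pow_atTop two_ne_zero).atTop_mul_const hp)))
  rwa [integral_zero] at h

lemma iwChi_lt_one {A a : ℝ} (ha : 0 < a) (haA : a < A) {x : ℝ} (hx : 0 < x) :
    iwChi A a x < 1 := by
  have := isProbabilityMeasure_iwMix ha haA
  have hi := (integrable_const (μ := iwMix A a) (1 : ℝ)).sub (integrable_iwChi_integrand ha haA x)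
  have hnn : ∀ p : ℝ × ℝ, 0 ≤ 1 - Real.exp (-(x ^ 2 * (2 * |p.1 * p.2|))) := fun p =>
    sub_nonneg.2 (Real.exp_le_one_iff.2 (neg_nonpos.2 (by positivity)))
  have h1 : ∫ p, (1 - Real.exp (-(x ^ 2 * (2 * |p.1 * p.2|)))) ∂(iwMix A a) = 1 - iwChi A a x := by
    rw [integral_sub (integrable_const _) (integrable_iwChi_integrand ha haA x)]
    simp [iwChi]
  have h2 := iwChi_le_one ha haA x
  refine h2.lt_of_ne fun h => ?_
  rw [h, sub_self, integral_eq_zero_iff_of_nonneg hnn hi] at h1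
  have : ∀ᵐ p ∂(iwMix A a), False := by
    filter_upwards [h1, ae_iwMix_pos ha haA] with p h3 hp
    have : Real.exp (-(x ^ 2 * (2 * |p.1 * p.2|))) < 1 :=
      Real.exp_lt_one_iff.2 (neg_neg_of_pos (by positivity))
    simp only [Pi.zero_apply] at h3
    linarith
  simp at this
  exact IsProbabilityMeasure.ne_zero _ this

lemma integral_gammaMeasure_abs {a : ℝ} (ha : 0 < a) :
    ∫⁻ s, ENNReal.ofReal |s| ∂(ProbabilityTheory.gammaMeasure a 1) = ENNReal.ofReal a := by
  have h := lintegral_rpow_mul_exp_neg_mul (a := a + 1) (r := 1) (by linarith) one_pos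
  have hG := Real.Gamma_pos_of_pos ha
  rw [lintegral_gammaMeasure_one (by fun_prop)]
  calc _ = ∫⁻ t in Ioi (0 : ℝ), ENNReal.ofReal ((Real.Gamma a)⁻¹) *
        ENNReal.ofReal (t ^ (a + 1 - 1) * Real.exp (-(1 * t))) := by
        refine setLIntegral_congr_fun measurableSet_Ioi fun t ht => ?_
        have ht' : 0 < t := ht
        rw [abs_of_pos ht', ← ENNReal.ofReal_mul (by positivity), ← ENNReal.ofReal_mul (by positivity)]
        congr 1
        rw [show a + 1 - 1 = a - 1 + 1 by ring, Real.rpow_add_one ht'.ne']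
        ring_nf
    _ = _ := by
        rw [lintegral_const_mul _ (by fun_prop), h, ← ENNReal.ofReal_mul (by positivity),
          Real.Gamma_add_one ha.ne']
        congr 1
        simp
        field_simp

lemma one_sub_iwChi_le {A a : ℝ} (ha : 0 < a) (haA : a < A) (x : ℝ) :
    1 - iwChi A a x ≤ 2 * x ^ 2 * (a * (A - a)) := by
  have hp := isProbabilityMeasure_iwMix ha haA
  have hp1 := ProbabilityTheory.isProbabilityMeasure_gammaMeasure ha one_pos
  have hp2 := ProbabilityTheory.isProbabilityMeasure_gammaMeasure (sub_pos.2 haA) one_pos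
  have h1 : ∫⁻ p, ENNReal.ofReal |p.1 * p.2| ∂(iwMix A a) = ENNReal.ofReal (a * (A - a)) := by
    rw [iwMix]
    simp_rw [abs_mul, ENNReal.ofReal_mul (abs_nonneg _)]
    rw [lintegral_prod_mul (f := fun s : ℝ => ENNReal.ofReal |s|)
      (g := fun s : ℝ => ENNReal.ofReal |s|) (by fun_prop) (by fun_prop),
      integral_gammaMeasure_abs ha, integral_gammaMeasure_abs (sub_pos.2 haA),
      ENNReal.ofReal_mul ha.le]
  have h0 : 0 ≤ a * (A - a) := mul_nonneg ha.le (sub_pos.2 haA).le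
  have hint : Integrable (fun p : ℝ × ℝ => |p.1 * p.2|) (iwMix A a) := by
    refine ⟨by fun_prop, ?_⟩
    rw [hasFiniteIntegral_iff_ofReal (.of_forall fun p => abs_nonneg _), h1]
    exact ENNReal.ofReal_lt_top
  have h2 : ∫ p, |p.1 * p.2| ∂(iwMix A a) = a * (A - a) := by
    rw [integral_eq_lintegral_of_nonneg_ae (.of_forall fun p => abs_nonneg _) (by fun_prop), h1,
      ENNReal.toReal_ofReal h0]
  have h3 : ∫ p, (1 - 2 * x ^ 2 * |p.1 * p.2|) ∂(iwMix A a) ≤ iwChi A a x := by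
    refine integral_mono ((integrable_const _).sub (hint.const_mul _))
      (integrable_iwChi_integrand ha haA x) fun p => ?_
    have := Real.add_one_le_exp (-(x ^ 2 * (2 * |p.1 * p.2|)))
    dsimp only
    linarith
  rw [integral_sub (integrable_const _) (hint.const_mul _), integral_const_mul, h2] at h3
  simp at h3
  linarith

lemma sq_mul_one_sub_iwChi_le {A a : ℝ} (ha : 0 < a) (haA : a < A) {x : ℝ} (hx : 0 ≤ x)
    (hx1 : x ≤ 1) : x ^ 2 * (1 - iwChi A a 1) ≤ 1 - iwChi A a x := by
  have hp := isProbabilityMeasure_iwMix ha haA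
  have h3 : iwChi A a x ≤ ∫ p : ℝ × ℝ, ((1 - x ^ 2) + x ^ 2 *
      Real.exp (-((1 : ℝ) ^ 2 * (2 * |p.1 * p.2|)))) ∂(iwMix A a) := by
    refine integral_mono (integrable_iwChi_integrand ha haA x)
      ((integrable_const _).add ((integrable_iwChi_integrand ha haA 1).const_mul _)) fun p => ?_
    have hx2 : x ^ 2 ≤ 1 := by nlinarith
    have := convexOn_exp.2 (mem_univ 0) (mem_univ (-((1 : ℝ) ^ 2 * (2 * |p.1 * p.2|))))
      (sub_nonneg.2 hx2) (sq_nonneg x) (by ring)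
    simp only [smul_eq_mul, mul_zero, zero_add, Real.exp_zero, mul_one] at this
    dsimp only
    convert this using 2
    ring
  rw [integral_add (integrable_const _) ((integrable_iwChi_integrand ha haA 1).const_mul _),
    integral_const_mul] at h3
  change _ ≤ _ + _ * iwChi A a 1 at h3
  simp at h3
  linarith

lemma iwPsi_zero_left {y : ℝ} (hy : 0 ≤ y) (ω : ℝ × ℝ) :
    iwPsi (0 ^ 2 + y ^ 2) (0 * y) ω = y := by
  simp [iwPsi_zero_right, Real.sqrt_sq hy]

lemma integral_iwChi_iwPsi {A a x y : ℝ} (ha : 0 < a) (haA : a < A) (hx : 0 ≤ x) (hy : 0 ≤ y) :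
    ∫ ω, iwChi A a (iwPsi (x ^ 2 + y ^ 2) (x * y) ω) ∂(gaussGamma A)
      = iwChi A a x * iwChi A a y := by
  have hA : 0 < A := ha.trans haA
  have := isProbabilityMeasure_gaussGamma hA
  rcases hy.eq_or_lt with rfl | hy
  · simp [iwPsi_zero_right, Real.sqrt_sq hx, iwChi_zero ha haA]
  have hK : ENNReal.ofReal (Real.Gamma a * Real.Gamma (A - a)) ≠ 0 := by
    have := Real.Gamma_pos_of_pos ha
    have := Real.Gamma_pos_of_pos (sub_pos.2 haA)
    simp only [ne_eq, ENNReal.ofReal_eq_zero, not_le]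
    positivity
  have hK' := ENNReal.ofReal_ne_top (r := Real.Gamma a * Real.Gamma (A - a))
  have hm : Measurable (fun ω => ENNReal.ofReal (iwChi A a (iwPsi (x ^ 2 + y ^ 2) (x * y) ω))) :=
    ENNReal.measurable_ofReal.comp ((continuous_iwChi ha haA).measurable.comp (measurable_iwPsi _ _))
  have hM : iwMult A a y = ENNReal.ofReal (iwChi A a y) := by
    have h := lintegral_iwN_iwPsi (A := A) (a := a) (x := 0) hA le_rfl hy
    simp_rw [iwPsi_zero_left hy.le, iwN_eq_iwChi ha haA, iwChi_zero ha haA] at h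
    simp only [lintegral_const, measure_univ, mul_one, ENNReal.ofReal_one] at h
    rw [mul_comm] at h
    exact ((ENNReal.mul_left_inj hK hK').1 h).symm
  have h := lintegral_iwN_iwPsi (A := A) (a := a) hA hx hy
  simp_rw [iwN_eq_iwChi ha haA] at h
  rw [lintegral_const_mul _ hm, mul_left_comm, ENNReal.mul_right_inj hK hK', hM] at h
  rw [integral_eq_lintegral_of_nonneg_ae (.of_forall fun _ => iwChi_nonneg _ _ _)
    ((continuous_iwChi ha haA).measurable.comp (measurable_iwPsi _ _)).aestronglyMeasurable, h,
    ENNReal.toReal_mul, ENNReal.toReal_ofReal (iwChi_nonneg _ _ _),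
    ENNReal.toReal_ofReal (iwChi_nonneg _ _ _), mul_comm]

lemma ext_of_lintegral_exp {P Q : Measure ℝ} {X g : ℝ → ℝ} (hX : Measurable X) (hg : Measurable g)
    (hP : ∀ᵐ ω ∂P, g (X ω) = ω) (hQ : ∀ᵐ ω ∂Q, g (X ω) = ω) {δ : ℝ} (hδ : 0 < δ)
    (hfin : ∀ u, |u| < δ → ∫⁻ ω, ENNReal.ofReal (Real.exp (u * X ω)) ∂P ≠ ⊤)
    (h : ∀ u, |u| < δ → ∫⁻ ω, ENNReal.ofReal (Real.exp (u * X ω)) ∂P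
      = ∫⁻ ω, ENNReal.ofReal (Real.exp (u * X ω)) ∂Q) : P = Q := by
  have hfP : IsFiniteMeasure P := ⟨by simpa [lt_top_iff_ne_top] using hfin 0 (by simpa)⟩
  have hfQ : IsFiniteMeasure Q := ⟨by
    have := hfin 0 (by simpa)
    rw [h 0 (by simpa)] at this
    simpa [lt_top_iff_ne_top] using this⟩
  have hm : ∀ u, Measurable fun ω => Real.exp (u * X ω) := fun u => by fun_prop
  have hiP : ∀ u, |u| < δ → Integrable (fun ω => Real.exp (u * X ω)) P := fun u hu =>
    ⟨(hm u).aestronglyMeasurable, by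
      rw [hasFiniteIntegral_iff_ofReal (.of_forall fun p => (Real.exp_pos _).le)]
      exact (hfin u hu).lt_top⟩
  have hiQ : ∀ u, |u| < δ → Integrable (fun ω => Real.exp (u * X ω)) Q := fun u hu =>
    ⟨(hm u).aestronglyMeasurable, by
      rw [hasFiniteIntegral_iff_ofReal (.of_forall fun p => (Real.exp_pos _).le), ← h u hu]
      exact (hfin u hu).lt_top⟩
  have hmgf : ∀ u, |u| < δ → ProbabilityTheory.mgf X P u = ProbabilityTheory.mgf X Q u := by
    intro u hu
    rw [ProbabilityTheory.mgf, ProbabilityTheory.mgf,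
      integral_eq_lintegral_of_nonneg_ae (.of_forall fun p => (Real.exp_pos _).le)
        (hm u).aestronglyMeasurable,
      integral_eq_lintegral_of_nonneg_ae (.of_forall fun p => (Real.exp_pos _).le)
        (hm u).aestronglyMeasurable, h u hu]
  set S : Set ℂ := {z | z.re ∈ Ioo (-δ) δ} with hS
  have hsub : ∀ M : Measure ℝ, (∀ u, |u| < δ → Integrable (fun ω => Real.exp (u * X ω)) M) →
      AnalyticOnNhd ℂ (ProbabilityTheory.complexMGF X M) S := by
    intro M hM
    refine ProbabilityTheory.analyticOnNhd_complexMGF.mono fun z hz => ?_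
    exact interior_maximal (fun u hu => hM u (abs_lt.2 hu)) isOpen_Ioo hz
  have hEq : EqOn (ProbabilityTheory.complexMGF X P) (ProbabilityTheory.complexMGF X Q) S := by
    refine AnalyticOnNhd.eqOn_of_preconnected_of_frequently_eq (hsub P hiP) (hsub Q hiQ)
      ((convex_Ioo (-δ) δ).linear_preimage Complex.reLm).isPreconnected
      (z₀ := ((0 : ℝ) : ℂ)) (by simp [hS, hδ]) ?_
    have h_real : ∃ᶠ x : ℝ in 𝓝[≠] 0,
        ProbabilityTheory.complexMGF X P x = ProbabilityTheory.complexMGF X Q x := by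
      refine Eventually.frequently (Filter.Eventually.filter_mono nhdsWithin_le_nhds ?_)
      filter_upwards [Ioo_mem_nhds (neg_lt_zero.2 hδ) hδ] with x hx
      rw [ProbabilityTheory.complexMGF_ofReal, ProbabilityTheory.complexMGF_ofReal,
        hmgf x (abs_lt.2 hx)]
    rw [frequently_iff_seq_forall] at h_real ⊢
    obtain ⟨xs, hx_tendsto, hx_eq⟩ := h_real
    refine ⟨fun n => xs n, ?_, fun n => hx_eq n⟩
    rw [tendsto_nhdsWithin_iff] at hx_tendsto ⊢
    exact ⟨(Complex.continuous_ofReal.tendsto 0).comp hx_tendsto.1, by simpa using hx_tendsto.2⟩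
  have hmap : P.map X = Q.map X := by
    refine Measure.ext_of_charFun (funext fun t => ?_)
    rw [← ProbabilityTheory.complexMGF_mul_I hX.aemeasurable,
      ← ProbabilityTheory.complexMGF_mul_I hX.aemeasurable]
    exact hEq (by simp [hS, hδ])
  have hback : ∀ M : Measure ℝ, (∀ᵐ ω ∂M, g (X ω) = ω) → (M.map X).map g = M := by
    intro M hM
    rw [Measure.map_map hg hX, Measure.map_congr (f := g ∘ X) (g := id) hM, Measure.map_id]
  rw [← hback P hP, hmap, hback Q hQ]

lemma ae_eq_of_lintegral_exp {F G : ℝ → ENNReal} (hF : Measurable F) (hG : Measurable G)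
    {X g : ℝ → ℝ} (hX : Measurable X) (hg : Measurable g) (hXg : ∀ ω, 0 < ω → g (X ω) = ω)
    {δ : ℝ} (hδ : 0 < δ)
    (hfin : ∀ u, |u| < δ → ∫⁻ ω in Ioi 0, F ω * ENNReal.ofReal (Real.exp (u * X ω)) ≠ ⊤)
    (h : ∀ u, |u| < δ → ∫⁻ ω in Ioi 0, F ω * ENNReal.ofReal (Real.exp (u * X ω))
      = ∫⁻ ω in Ioi 0, G ω * ENNReal.ofReal (Real.exp (u * X ω))) :
    F =ᵐ[volume.restrict (Ioi 0)] G := by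
  have hl : ∀ F : ℝ → ENNReal, Measurable F → ∀ u,
      ∫⁻ ω, ENNReal.ofReal (Real.exp (u * X ω)) ∂((volume.restrict (Ioi 0)).withDensity F)
      = ∫⁻ ω in Ioi 0, F ω * ENNReal.ofReal (Real.exp (u * X ω)) := by
    intro F hF u
    rw [lintegral_withDensity_eq_lintegral_mul _ hF (by fun_prop)]
    rfl
  have hae : ∀ F : ℝ → ENNReal, ∀ᵐ ω ∂((volume.restrict (Ioi 0)).withDensity F), g (X ω) = ω := by
    intro F
    refine (withDensity_absolutelyContinuous _ _).ae_le ?_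
    exact (ae_restrict_iff' measurableSet_Ioi).2 (.of_forall fun ω hω => hXg ω hω)
  have key := ext_of_lintegral_exp hX hg (hae F) (hae G) hδ (fun u hu => by
    rw [hl F hF]; exact hfin u hu) (fun u hu => by rw [hl F hF, hl G hG]; exact h u hu)
  refine (withDensity_eq_iff hF.aemeasurable hG.aemeasurable ?_).1 key
  simpa using hfin 0 (by simpa)

/-- Laplace transform in the variable `x ^ 2`. -/
def sqLaplace (μ : Measure ℝ) (κ : ℝ) : ENNReal := ∫⁻ x, ENNReal.ofReal (Real.exp (-(κ * x ^ 2))) ∂μ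

lemma measurable_sqLaplace (μ : Measure ℝ) [SFinite μ] : Measurable (sqLaplace μ) := by
  unfold sqLaplace
  exact Measurable.lintegral_prod_right' (f := fun q : ℝ × ℝ =>
    ENNReal.ofReal (Real.exp (-(q.1 * q.2 ^ 2)))) (by fun_prop)

lemma sqLaplace_le (μ : Measure ℝ) {κ : ℝ} (hκ : 0 ≤ κ) : sqLaplace μ κ ≤ μ univ := by
  calc sqLaplace μ κ ≤ ∫⁻ _, 1 ∂μ := by
        refine lintegral_mono fun x => ?_
        rw [← ENNReal.ofReal_one]
        exact ENNReal.ofReal_le_ofReal (Real.exp_le_one_iff.2 (neg_nonpos.2 (by positivity)))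
    _ = _ := by simp

lemma continuousOn_sqLaplace (μ : Measure ℝ) [IsFiniteMeasure μ] :
    ContinuousOn (sqLaplace μ) (Ioi 0) := by
  intro κ₀ _
  refine tendsto_lintegral_filter_of_dominated_convergence (fun _ => 1)
    (.of_forall fun κ => by fun_prop) ?_ (by simp) (.of_forall fun x => ?_)
  · filter_upwards [self_mem_nhdsWithin] with κ hκ
    have hκ' : 0 < κ := hκ
    refine .of_forall fun x => ?_
    rw [← ENNReal.ofReal_one]
    exact ENNReal.ofReal_le_ofReal (Real.exp_le_one_iff.2 (neg_nonpos.2 (by positivity)))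
  · exact ((ENNReal.continuous_ofReal.comp
      (by fun_prop : Continuous fun κ : ℝ => Real.exp (-(κ * x ^ 2)))).tendsto κ₀).mono_left
      nhdsWithin_le_nhds

lemma onHalfLine_iff {μ : Measure ℝ} : OnHalfLine μ ↔ ∀ᵐ x ∂μ, 0 ≤ x := by
  simp [OnHalfLine, ae_iff]

lemma ext_of_sqLaplace {μ ν : Measure ℝ} [IsFiniteMeasure μ] (hμ : OnHalfLine μ) (hν : OnHalfLine ν)
    (h : ∀ κ, 0 < κ → sqLaplace μ κ = sqLaplace ν κ) : μ = ν := by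
  have hw : Measurable fun x : ℝ => ENNReal.ofReal (Real.exp (-(x ^ 2))) := by fun_prop
  have hl : ∀ (μ : Measure ℝ) (u : ℝ), ∫⁻ x, ENNReal.ofReal (Real.exp (u * x ^ 2))
      ∂(μ.withDensity fun x => ENNReal.ofReal (Real.exp (-(x ^ 2)))) = sqLaplace μ (1 - u) := by
    intro μ u
    rw [lintegral_withDensity_eq_lintegral_mul _ hw (by fun_prop)]
    refine lintegral_congr fun x => ?_
    rw [Pi.mul_apply, ← ENNReal.ofReal_mul (Real.exp_pos _).le, ← Real.exp_add]
    congr 2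
    ring
  have hae : ∀ μ : Measure ℝ, OnHalfLine μ → ∀ᵐ x ∂(μ.withDensity fun x =>
      ENNReal.ofReal (Real.exp (-(x ^ 2)))), √(x ^ 2) = x := by
    intro μ hμ
    refine (withDensity_absolutelyContinuous _ _).ae_le ?_
    filter_upwards [onHalfLine_iff.1 hμ] with x hx using Real.sqrt_sq hx
  have key := ext_of_lintegral_exp (X := fun x => x ^ 2) (g := fun x => √x) (by fun_prop)
    (by fun_prop) (hae μ hμ) (hae ν hν) one_pos
    (fun u hu => by
      rw [hl μ]
      exact ((sqLaplace_le μ (by linarith [(abs_lt.1 hu).2])).trans_lt (measure_lt_top μ univ)).ne)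
    (fun u hu => by rw [hl μ, hl ν]; exact h _ (by linarith [(abs_lt.1 hu).2]))
  have hback : ∀ μ : Measure ℝ, (μ.withDensity fun x => ENNReal.ofReal (Real.exp (-(x ^ 2)))).withDensity
      (fun x => ENNReal.ofReal (Real.exp (-(x ^ 2))))⁻¹ = μ := fun μ =>
    withDensity_inv_same hw (.of_forall fun x => by simp [Real.exp_pos]) (.of_forall fun x => by simp)
  rw [← hback μ, key, hback ν]

lemma lintegral_iwN {A a : ℝ} (ha : 0 < a) (haA : a < A) (μ : Measure ℝ) [IsFiniteMeasure μ] :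
    ∫⁻ ρ in Ioi (0 : ℝ), ENNReal.ofReal (ρ ^ (a - 1)) * ∫⁻ x, iwG A ρ x ∂μ
      = ENNReal.ofReal (Real.Gamma a * Real.Gamma (A - a)) *
        ENNReal.ofReal (∫ x, iwChi A a x ∂μ) := by
  have hm := (continuous_iwChi ha haA).measurable
  have hi : Integrable (iwChi A a) μ := Integrable.of_bound (C := 1) hm.aestronglyMeasurable
    (.of_forall fun x => by
      rw [Real.norm_of_nonneg (iwChi_nonneg _ _ _)]
      exact iwChi_le_one ha haA x)
  rw [ofReal_integral_eq_lintegral_ofReal hi (.of_forall fun _ => iwChi_nonneg _ _ _),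
    ← lintegral_const_mul _ (by fun_prop)]
  simp_rw [← iwN_eq_iwChi ha haA]
  unfold iwN
  rw [lintegral_lintegral_swap (by fun_prop)]
  refine lintegral_congr fun ρ => ?_
  rw [lintegral_const_mul _ (by fun_prop)]

/-- Laplace transform against `r ^ (A - 1)` of `r ↦ sqLaplace μ (2 * r ^ 2)`. -/
def iwLaplace (A : ℝ) (μ : Measure ℝ) (v : ℝ) : ENNReal :=
  ∫⁻ r in Ioi (0 : ℝ), ENNReal.ofReal (r ^ (A - 1) * Real.exp (-(v * r))) * sqLaplace μ (2 * r ^ 2)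

lemma lintegral_iwG_eq_iwLaplace {A ρ : ℝ} (hρ : 0 < ρ) (μ : Measure ℝ) [IsFiniteMeasure μ] :
    ∫⁻ x, iwG A ρ x ∂μ = ENNReal.ofReal (ρ ^ (-(A / 2))) * iwLaplace A μ (√ρ + 1 / √ρ) := by
  have hs : 0 < √ρ := Real.sqrt_pos.2 hρ
  have hm := measurable_sqLaplace μ
  have hm2 : Measurable fun r : ℝ => sqLaplace μ (2 * r ^ 2) := hm.comp (by fun_prop)
  unfold iwG
  rw [lintegral_lintegral_swap (by fun_prop), lintegral_Ioi_comp_mul_left (c := (√ρ)⁻¹)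
    (by positivity), iwLaplace, ← lintegral_const_mul _ (by fun_prop)]
  refine setLIntegral_congr_fun measurableSet_Ioi fun r hr => ?_
  have hr' : 0 < r := hr
  rw [sqLaplace, ← lintegral_const_mul _ (by fun_prop), ← lintegral_const_mul _ (by fun_prop),
    ← lintegral_const_mul _ (by fun_prop)]
  refine lintegral_congr fun x => ?_
  rw [← ENNReal.ofReal_mul (by positivity), ← ENNReal.ofReal_mul (by positivity),
    ← ENNReal.ofReal_mul (by positivity)]
  congr 1
  have e1 : ρ ^ (-(A / 2)) = (√ρ)⁻¹ * (√ρ)⁻¹ ^ (A - 1) := by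
    rw [Real.rpow_sub_one (by positivity), Real.inv_rpow hs.le, Real.sqrt_eq_rpow,
      ← Real.rpow_mul hρ.le, Real.rpow_neg hρ.le]
    have : 0 < ρ ^ (1 / 2 : ℝ) := by positivity
    field_simp
  rw [e1, Real.mul_rpow (by positivity) hr'.le]
  have e2 : Real.exp (-((1 + ρ) * ((√ρ)⁻¹ * r)) - 2 * ρ * x ^ 2 * ((√ρ)⁻¹ * r) ^ 2)
      = Real.exp (-((√ρ + 1 / √ρ) * r)) * Real.exp (-(2 * r ^ 2 * x ^ 2)) := by
    rw [← Real.exp_add]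
    congr 1
    have hρ2 : ρ = √ρ ^ 2 := (Real.sq_sqrt hρ.le).symm
    generalize √ρ = s at *
    subst hρ2
    field_simp
    ring
  rw [e2]
  ring

lemma lintegral_rpow_mul_exp_mul_sqLaplace_ne_top {A v : ℝ} (hA : 0 < A) (hv : 0 < v)
    (μ : Measure ℝ) [IsFiniteMeasure μ] : iwLaplace A μ v ≠ ⊤ := by
  refine ne_top_of_le_ne_top ?_ (lintegral_mono (g := fun r =>
    ENNReal.ofReal (r ^ (A - 1) * Real.exp (-(v * r))) * μ univ) fun r => ?_)
  · rw [lintegral_mul_const _ (by fun_prop), lintegral_rpow_mul_exp_neg_mul hA hv]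
    exact ENNReal.mul_ne_top ENNReal.ofReal_ne_top (measure_ne_top _ _)
  · exact mul_le_mul_right (sqLaplace_le μ (by positivity)) _

lemma continuousOn_iwLaplace {A : ℝ} (hA : 0 < A) (μ : Measure ℝ) [IsFiniteMeasure μ] :
    ContinuousOn (iwLaplace A μ) (Ici 2) := by
  have hm2 : Measurable fun r : ℝ => sqLaplace μ (2 * r ^ 2) :=
    (measurable_sqLaplace μ).comp (by fun_prop)
  intro v₀ _
  refine tendsto_lintegral_filter_of_dominated_convergence
    (fun r => ENNReal.ofReal (r ^ (A - 1) * Real.exp (-(2 * r))) * sqLaplace μ (2 * r ^ 2))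
    (.of_forall fun v => by fun_prop) ?_
    (lintegral_rpow_mul_exp_mul_sqLaplace_ne_top hA two_pos μ) (.of_forall fun r => ?_)
  · filter_upwards [self_mem_nhdsWithin] with v hv
    have hv' : 2 ≤ v := hv
    refine (ae_restrict_iff' measurableSet_Ioi).2 (.of_forall fun r hr => ?_)
    have hr' : 0 < r := hr
    gcongr
  · refine ENNReal.Tendsto.mul_const ?_ (.inr ?_)
    · exact ((ENNReal.continuous_ofReal.comp
        (by fun_prop : Continuous fun v : ℝ => r ^ (A - 1) * Real.exp (-(v * r)))).tendsto
        v₀).mono_left nhdsWithin_le_nhds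
    · exact ne_top_of_le_ne_top (measure_ne_top μ univ) (sqLaplace_le μ (by positivity))

/-- Uniqueness theorem for the transform given by the multiplicative functions `iwChi`. -/
lemma ext_of_integral_iwChi {A : ℝ} (hA : 0 < A) {μ ν : Measure ℝ} [IsFiniteMeasure μ]
    [IsFiniteMeasure ν] (hμ : OnHalfLine μ) (hν : OnHalfLine ν)
    (h : ∀ a, 0 < a → a < A → ∫ x, iwChi A a x ∂μ = ∫ x, iwChi A a x ∂ν) : μ = ν := by
  have hmG : ∀ (μ : Measure ℝ) [IsFiniteMeasure μ], Measurable fun ρ => ∫⁻ x, iwG A ρ x ∂μ :=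
    fun μ _ => Measurable.lintegral_prod_right' (f := fun q : ℝ × ℝ => iwG A q.1 q.2) (by fun_prop)
  have hexp : ∀ (μ : Measure ℝ) [IsFiniteMeasure μ] (u : ℝ),
      ∫⁻ ρ in Ioi (0 : ℝ), ENNReal.ofReal (ρ ^ (A / 2 - 1)) * (∫⁻ x, iwG A ρ x ∂μ) *
        ENNReal.ofReal (Real.exp (u * Real.log ρ))
      = ∫⁻ ρ in Ioi (0 : ℝ), ENNReal.ofReal (ρ ^ ((A / 2 + u) - 1)) * ∫⁻ x, iwG A ρ x ∂μ := by
    intro μ _ u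
    refine setLIntegral_congr_fun measurableSet_Ioi fun ρ hρ => ?_
    have hρ' : 0 < ρ := hρ
    rw [mul_right_comm, ← ENNReal.ofReal_mul (by positivity), mul_comm u, ← Real.rpow_def_of_pos hρ',
      ← Real.rpow_add hρ']
    ring_nf
  have hb : ∀ u, |u| < A / 2 → 0 < A / 2 + u ∧ A / 2 + u < A := fun u hu => by
    constructor <;> linarith [(abs_lt.1 hu).1, (abs_lt.1 hu).2]
  have h1 := ae_eq_of_lintegral_exp (X := Real.log) (g := Real.exp)
    (F := fun ρ => ENNReal.ofReal (ρ ^ (A / 2 - 1)) * ∫⁻ x, iwG A ρ x ∂μ)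
    (G := fun ρ => ENNReal.ofReal (ρ ^ (A / 2 - 1)) * ∫⁻ x, iwG A ρ x ∂ν)
    (by have := hmG μ; fun_prop) (by have := hmG ν; fun_prop) Real.measurable_log
    Real.measurable_exp (fun ω hω => Real.exp_log hω) (half_pos hA)
    (fun u hu => by
      rw [hexp μ, lintegral_iwN (hb u hu).1 (hb u hu).2]
      exact ENNReal.mul_ne_top ENNReal.ofReal_ne_top ENNReal.ofReal_ne_top)
    (fun u hu => by
      rw [hexp μ, hexp ν, lintegral_iwN (hb u hu).1 (hb u hu).2,
        lintegral_iwN (hb u hu).1 (hb u hu).2, h _ (hb u hu).1 (hb u hu).2])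
  have h2 : (fun ρ => iwLaplace A μ (√ρ + 1 / √ρ)) =ᵐ[volume.restrict (Ioi 0)]
      fun ρ => iwLaplace A ν (√ρ + 1 / √ρ) := by
    filter_upwards [h1, ae_restrict_mem measurableSet_Ioi] with ρ h3 hρ
    have hρ' : 0 < ρ := hρ
    have hne : ∀ c : ℝ, ENNReal.ofReal (ρ ^ c) ≠ 0 := fun c => by
      simp only [ne_eq, ENNReal.ofReal_eq_zero, not_le]
      positivity
    rw [lintegral_iwG_eq_iwLaplace hρ', lintegral_iwG_eq_iwLaplace hρ',
      ENNReal.mul_right_inj (hne _) ENNReal.ofReal_ne_top,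
      ENNReal.mul_right_inj (hne _) ENNReal.ofReal_ne_top] at h3
    exact h3
  have hge : ∀ ρ : ℝ, 0 < ρ → 2 ≤ √ρ + 1 / √ρ := fun ρ hρ => by
    have hs : 0 < √ρ := Real.sqrt_pos.2 hρ
    have : √ρ + 1 / √ρ - 2 = (√ρ - 1) ^ 2 / √ρ := by field_simp; ring
    have : 0 ≤ (√ρ - 1) ^ 2 / √ρ := by positivity
    linarith
  have hcont : ContinuousOn (fun ρ : ℝ => √ρ + 1 / √ρ) (Ioi 0) := by
    refine ContinuousOn.add (by fun_prop) (ContinuousOn.div (by fun_prop) (by fun_prop) ?_)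
    intro ρ hρ
    exact (Real.sqrt_pos.2 hρ).ne'
  have h3 : EqOn (fun ρ => iwLaplace A μ (√ρ + 1 / √ρ)) (fun ρ => iwLaplace A ν (√ρ + 1 / √ρ))
      (Ioi 0) :=
    Measure.eqOn_open_of_ae_eq h2 isOpen_Ioi ((continuousOn_iwLaplace hA μ).comp hcont hge)
      ((continuousOn_iwLaplace hA ν).comp hcont hge)
  have h4 : ∀ v, 2 ≤ v → iwLaplace A μ v = iwLaplace A ν v := by
    intro v hv
    have hd : 0 ≤ v ^ 2 - 4 := by nlinarith
    set s := (v + √(v ^ 2 - 4)) / 2 with hs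
    have hs0 : 0 < s := by have := Real.sqrt_nonneg (v ^ 2 - 4); positivity
    have hq : s + 1 / s = v := by
      have : s ^ 2 - v * s + 1 = 0 := by
        rw [hs]
        nlinarith [Real.sq_sqrt hd]
      field_simp
      linarith
    have := h3 (show s ^ 2 ∈ Ioi (0 : ℝ) from by rw [mem_Ioi]; positivity)
    simpa only [Real.sqrt_sq hs0.le, hq] using this
  have hmL : ∀ (μ : Measure ℝ) [IsFiniteMeasure μ], Measurable fun r : ℝ => sqLaplace μ (2 * r ^ 2) :=
    fun μ _ => (measurable_sqLaplace μ).comp (by fun_prop)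
  have hlap : ∀ (μ : Measure ℝ) (u : ℝ),
      ∫⁻ r in Ioi (0 : ℝ), ENNReal.ofReal (r ^ (A - 1) * Real.exp (-(3 * r))) *
        sqLaplace μ (2 * r ^ 2) * ENNReal.ofReal (Real.exp (u * r)) = iwLaplace A μ (3 - u) := by
    intro μ u
    refine setLIntegral_congr_fun measurableSet_Ioi fun r hr => ?_
    have hr' : 0 < r := hr
    rw [mul_right_comm, ← ENNReal.ofReal_mul (by positivity), mul_assoc, ← Real.exp_add]
    ring_nf
  have h5 := ae_eq_of_lintegral_exp (X := id) (g := id)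
    (F := fun r => ENNReal.ofReal (r ^ (A - 1) * Real.exp (-(3 * r))) * sqLaplace μ (2 * r ^ 2))
    (G := fun r => ENNReal.ofReal (r ^ (A - 1) * Real.exp (-(3 * r))) * sqLaplace ν (2 * r ^ 2))
    (by have := hmL μ; fun_prop) (by have := hmL ν; fun_prop) measurable_id measurable_id
    (fun _ _ => rfl) one_pos
    (fun u hu => by
      simp only [id, hlap μ]
      exact lintegral_rpow_mul_exp_mul_sqLaplace_ne_top hA (by linarith [(abs_lt.1 hu).2]) μ)
    (fun u hu => by
      simp only [id, hlap μ, hlap ν]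
      exact h4 _ (by linarith [(abs_lt.1 hu).2]))
  have h6 : (fun r : ℝ => sqLaplace μ (2 * r ^ 2)) =ᵐ[volume.restrict (Ioi 0)]
      fun r => sqLaplace ν (2 * r ^ 2) := by
    filter_upwards [h5, ae_restrict_mem measurableSet_Ioi] with r h7 hr
    have hr' : 0 < r := hr
    refine (ENNReal.mul_right_inj ?_ ENNReal.ofReal_ne_top).1 h7
    simp only [ne_eq, ENNReal.ofReal_eq_zero, not_le]
    positivity
  have hc2 : ContinuousOn (fun r : ℝ => 2 * r ^ 2) (Ioi 0) := by fun_prop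
  have hmaps : MapsTo (fun r : ℝ => 2 * r ^ 2) (Ioi 0) (Ioi 0) := fun r hr => by
    have : (0 : ℝ) < r := hr
    show (0 : ℝ) < 2 * r ^ 2
    positivity
  have h7 := Measure.eqOn_open_of_ae_eq h6 isOpen_Ioi ((continuousOn_sqLaplace μ).comp hc2 hmaps)
    ((continuousOn_sqLaplace ν).comp hc2 hmaps)
  refine ext_of_sqLaplace hμ hν fun κ hκ => ?_
  have := h7 (show √(κ / 2) ∈ Ioi (0 : ℝ) from Real.sqrt_pos.2 (half_pos hκ))
  simp only [Real.sq_sqrt (half_pos hκ).le] at this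
  convert this using 2 <;> ring

/-- The parametrised product law as a function of both points and the random element. -/
def iwPhi (q : (ℝ × ℝ) × (ℝ × ℝ)) : ℝ := iwPsi (q.1.1 ^ 2 + q.1.2 ^ 2) (q.1.1 * q.1.2) q.2

lemma measurable_iwPhi : Measurable iwPhi := by
  unfold iwPhi iwPsi
  fun_prop

lemma iwPhi_nonneg (q : (ℝ × ℝ) × (ℝ × ℝ)) : 0 ≤ iwPhi q := iwPsi_nonneg (by positivity) _

lemma iwKernel_eq_map {α x y : ℝ} (hα : α < 1 / 2) (hx : 0 ≤ x) (hy : 0 ≤ y) :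
    iwKernel α x y = (gaussGamma (1 - 2 * α)).map fun ω => iwPhi ((x, y), ω) := by
  have := isProbabilityMeasure_gaussGamma (A := 1 - 2 * α) (by linarith)
  have hm : Measurable fun ω => iwPhi ((x, y), ω) := measurable_iwPhi.comp measurable_prodMk_left
  rcases hx.eq_or_lt with rfl | hx
  · simp [iwKernel, iwPhi, iwPsi_zero_right, Real.sqrt_sq hy]
  rcases hy.eq_or_lt with rfl | hy
  · simp [iwKernel, iwPhi, iwPsi_zero_right, Real.sqrt_sq hx.le, hx.ne']
  rw [iwKernel, if_neg hx.ne', if_neg hy.ne']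
  ext S hS
  have h := lintegral_iwKernel_of_pos (f := S.indicator fun _ => 1) hα hx hy
    (measurable_const.indicator hS)
  rw [withDensity_apply _ hS, Measure.map_apply hm hS, ← lintegral_indicator_one (hm hS)]
  rw [← lintegral_indicator hS]
  refine Eq.trans (lintegral_congr fun ξ => ?_) (h.symm.trans (lintegral_congr fun ω => ?_))
  · by_cases hξ : ξ ∈ S <;> simp [hξ]
  · rfl

lemma iwConv_eq_map {α : ℝ} (hα : α < 1 / 2) {μ ν : Measure ℝ} [SFinite μ] [SFinite ν]
    (hμ : OnHalfLine μ) (hν : OnHalfLine ν) :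
    iwConv α μ ν = ((μ.prod ν).prod (gaussGamma (1 - 2 * α))).map iwPhi := by
  have := isProbabilityMeasure_gaussGamma (A := 1 - 2 * α) (by linarith)
  have hm : Measurable fun p : ℝ × ℝ =>
      (gaussGamma (1 - 2 * α)).map fun ω => iwPhi (p, ω) := by
    have h := (Measure.measurable_map iwPhi measurable_iwPhi).comp
      (Measurable.map_prodMk_left (ν := gaussGamma (1 - 2 * α)) (α := ℝ × ℝ))
    convert h using 2 with p
    simp only [Function.comp]
    rw [Measure.map_map measurable_iwPhi measurable_prodMk_left]
    rfl
  have hae : (fun p : ℝ × ℝ => iwKernel α p.1 p.2) =ᵐ[μ.prod ν]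
      fun p => (gaussGamma (1 - 2 * α)).map fun ω => iwPhi (p, ω) := by
    have e1 : ∀ᵐ p ∂(μ.prod ν), 0 ≤ p.1 := quasiMeasurePreserving_fst.ae (onHalfLine_iff.1 hμ)
    have e2 : ∀ᵐ p ∂(μ.prod ν), 0 ≤ p.2 := quasiMeasurePreserving_snd.ae (onHalfLine_iff.1 hν)
    filter_upwards [e1, e2] with p h1 h2 using iwKernel_eq_map hα h1 h2
  rw [iwConv, Measure.bind_congr_right hae]
  ext S hS
  rw [Measure.bind_apply hS hm.aemeasurable, Measure.map_apply measurable_iwPhi hS,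
    Measure.prod_apply (measurable_iwPhi hS)]
  refine lintegral_congr fun p => ?_
  exact Measure.map_apply (measurable_iwPhi.comp measurable_prodMk_left) hS

lemma isProbabilityMeasure_iwConv {α : ℝ} (hα : α < 1 / 2) {μ ν : Measure ℝ}
    [IsProbabilityMeasure μ] [IsProbabilityMeasure ν] (hμ : OnHalfLine μ) (hν : OnHalfLine ν) :
    IsProbabilityMeasure (iwConv α μ ν) := by
  have := isProbabilityMeasure_gaussGamma (A := 1 - 2 * α) (by linarith)
  rw [iwConv_eq_map hα hμ hν]
  exact Measure.isProbabilityMeasure_map measurable_iwPhi.aemeasurable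

lemma onHalfLine_iwConv {α : ℝ} (hα : α < 1 / 2) {μ ν : Measure ℝ} [SFinite μ] [SFinite ν]
    (hμ : OnHalfLine μ) (hν : OnHalfLine ν) : OnHalfLine (iwConv α μ ν) := by
  rw [iwConv_eq_map hα hμ hν, onHalfLine_iff, ae_map_iff measurable_iwPhi.aemeasurable
    measurableSet_Ici]
  exact .of_forall iwPhi_nonneg

lemma norm_iwChi_le {A a : ℝ} (ha : 0 < a) (haA : a < A) (x : ℝ) : ‖iwChi A a x‖ ≤ 1 := by
  rw [Real.norm_of_nonneg (iwChi_nonneg _ _ _)]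
  exact iwChi_le_one ha haA x

lemma integrable_iwChi {A a : ℝ} (ha : 0 < a) (haA : a < A) (μ : Measure ℝ) [IsFiniteMeasure μ] :
    Integrable (iwChi A a) μ :=
  Integrable.of_bound (C := 1) (continuous_iwChi ha haA).aestronglyMeasurable
    (.of_forall (norm_iwChi_le ha haA))

lemma integral_iwChi_iwConv {α a : ℝ} (ha : 0 < a) (haA : a < 1 - 2 * α) {μ ν : Measure ℝ}
    [IsFiniteMeasure μ] [IsFiniteMeasure ν] (hμ : OnHalfLine μ) (hν : OnHalfLine ν) :
    ∫ x, iwChi (1 - 2 * α) a x ∂(iwConv α μ ν)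
      = (∫ x, iwChi (1 - 2 * α) a x ∂μ) * ∫ x, iwChi (1 - 2 * α) a x ∂ν := by
  have := isProbabilityMeasure_gaussGamma (A := 1 - 2 * α) (by linarith)
  have hc := continuous_iwChi ha haA
  have hm : Measurable fun q => iwChi (1 - 2 * α) a (iwPhi q) := by
    have := hc.measurable.comp measurable_iwPhi
    exact this
  rw [iwConv_eq_map (by linarith) hμ hν, integral_map measurable_iwPhi.aemeasurable
    hc.aestronglyMeasurable, integral_prod, ← integral_prod_mul]
  · refine integral_congr_ae ?_
    have e1 : ∀ᵐ p ∂(μ.prod ν), 0 ≤ p.1 := quasiMeasurePreserving_fst.ae (onHalfLine_iff.1 hμ)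
    have e2 : ∀ᵐ p ∂(μ.prod ν), 0 ≤ p.2 := quasiMeasurePreserving_snd.ae (onHalfLine_iff.1 hν)
    filter_upwards [e1, e2] with p h1 h2
    simp only [iwPhi]
    exact integral_iwChi_iwPsi ha haA h1 h2
  · exact Integrable.of_bound (C := 1) hm.aestronglyMeasurable
      (.of_forall fun q => norm_iwChi_le ha haA _)

lemma onHalfLine_dirac {x : ℝ} (hx : 0 ≤ x) : OnHalfLine (dirac x) := by
  rw [onHalfLine_iff, ae_dirac_iff measurableSet_Ici]
  exact hx

lemma iwConvPow_prob {α : ℝ} (hα : α < 1 / 2) {μ : Measure ℝ} [IsProbabilityMeasure μ]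
    (hμ : OnHalfLine μ) (n : ℕ) :
    IsProbabilityMeasure (iwConvPow α μ n) ∧ OnHalfLine (iwConvPow α μ n) := by
  induction n with
  | zero => exact ⟨by rw [iwConvPow]; infer_instance, onHalfLine_dirac le_rfl⟩
  | succ n ih =>
    have := ih.1
    exact ⟨isProbabilityMeasure_iwConv hα ih.2 hμ, onHalfLine_iwConv hα ih.2 hμ⟩

lemma integral_iwChi_iwConvPow {α a : ℝ} (ha : 0 < a) (haA : a < 1 - 2 * α) {μ : Measure ℝ}
    [IsProbabilityMeasure μ] (hμ : OnHalfLine μ) (n : ℕ) :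
    ∫ x, iwChi (1 - 2 * α) a x ∂(iwConvPow α μ n) = (∫ x, iwChi (1 - 2 * α) a x ∂μ) ^ n := by
  have hα : α < 1 / 2 := by linarith
  induction n with
  | zero => simp [iwConvPow, iwChi_zero ha haA]
  | succ n ih =>
    have := (iwConvPow_prob hα hμ n).1
    rw [iwConvPow, integral_iwChi_iwConv ha haA (iwConvPow_prob hα hμ n).2 hμ, ih, pow_succ]

lemma isProbabilityMeasure_iwCompoundPoisson {α b : ℝ} (hα : α < 1 / 2) (hb : 0 ≤ b)
    {μ : Measure ℝ} [IsProbabilityMeasure μ] (hμ : OnHalfLine μ) :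
    IsProbabilityMeasure (iwCompoundPoisson α b μ) := by
  constructor
  rw [iwCompoundPoisson, Measure.sum_apply _ MeasurableSet.univ]
  have h1 : ∀ k, iwConvPow α μ k univ = 1 := fun k => (iwConvPow_prob hα hμ k).1.measure_univ
  have h2 : HasSum (fun k : ℕ => Real.exp (-b) * b ^ k / k.factorial) 1 := by
    have := (NormedSpace.expSeries_div_hasSum_exp b).mul_left (Real.exp (-b))
    rw [← Real.exp_eq_exp_ℝ, ← Real.exp_add, neg_add_cancel, Real.exp_zero] at this
    simpa only [mul_div_assoc] using this
  simp only [Measure.smul_apply, h1, smul_eq_mul, mul_one]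
  rw [← ENNReal.ofReal_tsum_of_nonneg (fun k => by positivity) h2.summable, h2.tsum_eq,
    ENNReal.ofReal_one]

lemma onHalfLine_iwCompoundPoisson {α b : ℝ} (hα : α < 1 / 2)
    {μ : Measure ℝ} [IsProbabilityMeasure μ] (hμ : OnHalfLine μ) :
    OnHalfLine (iwCompoundPoisson α b μ) := by
  rw [OnHalfLine, iwCompoundPoisson, Measure.sum_apply_eq_zero]
  intro k
  rw [Measure.smul_apply, (iwConvPow_prob hα hμ k).2, smul_zero]

lemma integral_iwChi_iwCompoundPoisson {α a b : ℝ} (ha : 0 < a) (haA : a < 1 - 2 * α) (hb : 0 ≤ b)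
    {μ : Measure ℝ} [IsProbabilityMeasure μ] (hμ : OnHalfLine μ) :
    ∫ x, iwChi (1 - 2 * α) a x ∂(iwCompoundPoisson α b μ)
      = Real.exp (-(b * (1 - ∫ x, iwChi (1 - 2 * α) a x ∂μ))) := by
  have hα : α < 1 / 2 := by linarith
  have := isProbabilityMeasure_iwCompoundPoisson hα hb hμ
  have h := hasSum_integral_measure (f := iwChi (1 - 2 * α) a) (μ := fun k : ℕ =>
    (ENNReal.ofReal (Real.exp (-b) * b ^ k / k.factorial)) • iwConvPow α μ k)
    (integrable_iwChi ha haA (iwCompoundPoisson α b μ))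
  refine h.unique ?_
  set c := ∫ x, iwChi (1 - 2 * α) a x ∂μ with hc
  have h2 := (NormedSpace.expSeries_div_hasSum_exp (b * c)).mul_left (Real.exp (-b))
  rw [← Real.exp_eq_exp_ℝ, ← Real.exp_add] at h2
  have e : (fun k : ℕ => ∫ x, iwChi (1 - 2 * α) a x ∂((ENNReal.ofReal
      (Real.exp (-b) * b ^ k / k.factorial)) • iwConvPow α μ k))
      = fun k : ℕ => Real.exp (-b) * ((b * c) ^ k / k.factorial) := by
    funext k
    rw [integral_smul_measure, ENNReal.toReal_ofReal (by positivity),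
      integral_iwChi_iwConvPow ha haA hμ, mul_pow, smul_eq_mul]
    ring
  rw [e]
  rw [show -(b * (1 - c)) = -b + b * c by ring]
  exact h2

lemma eq_mul_of_additive_nonneg {g : ℝ → ℝ} (hadd : ∀ s t, 0 ≤ s → 0 ≤ t → g (s + t) = g s + g t)
    (h0 : ∀ t, 0 ≤ t → 0 ≤ g t) {t : ℝ} (ht : 0 ≤ t) : g t = t * g 1 := by
  have hmono : ∀ s t, 0 ≤ s → s ≤ t → g s ≤ g t := fun s t hs hst => by
    have := hadd s (t - s) hs (sub_nonneg.2 hst)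
    rw [add_sub_cancel] at this
    linarith [h0 (t - s) (sub_nonneg.2 hst)]
  have hz : g 0 = 0 := by
    have := hadd 0 0 le_rfl le_rfl
    simp at this
    linarith
  have hn : ∀ (n : ℕ) (s : ℝ), 0 ≤ s → g (n * s) = n * g s := by
    intro n s hs
    induction n with
    | zero => simp [hz]
    | succ n ih =>
      rw [Nat.cast_succ, add_mul, one_mul, hadd _ _ (by positivity) hs, ih]
      ring
  have h1 := h0 1 zero_le_one
  have hb : ∀ n : ℕ, n * |g t - t * g 1| ≤ g 1 := by
    intro n
    have hnt : 0 ≤ n * t := by positivity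
    have l1 := hmono _ _ (Nat.cast_nonneg ⌊n * t⌋₊) (Nat.floor_le hnt)
    have l2 := hmono _ _ hnt (Nat.lt_floor_add_one (n * t)).le
    have e1 := hn ⌊n * t⌋₊ 1 zero_le_one
    have e2 := hn (⌊n * t⌋₊ + 1) 1 zero_le_one
    rw [mul_one] at e1 e2
    push_cast at e2
    rw [e1, hn n t ht] at l1
    rw [e2, hn n t ht] at l2
    have m1 := mul_le_mul_of_nonneg_right (Nat.floor_le hnt) h1
    have m2 := mul_le_mul_of_nonneg_right (Nat.lt_floor_add_one (n * t)).le h1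
    rw [show n * |g t - t * g 1| = |n * (g t - t * g 1)| by rw [abs_mul, Nat.abs_cast], abs_le]
    constructor <;> nlinarith
  by_contra hne
  have hpos : 0 < |g t - t * g 1| := abs_pos.2 (sub_ne_zero.2 hne)
  obtain ⟨n, hn⟩ := exists_nat_gt (g 1 / |g t - t * g 1|)
  rw [div_lt_iff₀ hpos] at hn
  linarith [hb n]

lemma integral_iwChi_pos {A a : ℝ} (ha : 0 < a) (haA : a < A) (μ : Measure ℝ)
    [IsProbabilityMeasure μ] : 0 < ∫ x, iwChi A a x ∂μ := by
  rw [integral_pos_iff_support_of_nonneg (iwChi_nonneg A a) (integrable_iwChi ha haA μ)]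
  have : Function.support (iwChi A a) = univ := by
    ext x
    simp [(iwChi_pos ha haA x).ne']
  rw [this, measure_univ]
  exact one_pos

lemma integral_iwChi_le_one {A a : ℝ} (ha : 0 < a) (haA : a < A) (μ : Measure ℝ)
    [IsProbabilityMeasure μ] : ∫ x, iwChi A a x ∂μ ≤ 1 := by
  have := integral_mono (integrable_iwChi ha haA μ) (integrable_const 1) (iwChi_le_one ha haA)
  simpa using this

/-- The exponent of a convolution semigroup, read off at time one. -/
def iwExponent (α a : ℝ) (μ : Measure ℝ) : ℝ := -Real.log (∫ x, iwChi (1 - 2 * α) a x ∂μ)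

lemma iwExponent_nonneg {α a : ℝ} (ha : 0 < a) (haA : a < 1 - 2 * α) (μ : Measure ℝ)
    [IsProbabilityMeasure μ] : 0 ≤ iwExponent α a μ :=
  neg_nonneg.2 (Real.log_nonpos (integral_iwChi_pos ha haA μ).le (integral_iwChi_le_one ha haA μ))

lemma exp_neg_iwExponent {α a : ℝ} (ha : 0 < a) (haA : a < 1 - 2 * α) (μ : Measure ℝ)
    [IsProbabilityMeasure μ] :
    Real.exp (-iwExponent α a μ) = ∫ x, iwChi (1 - 2 * α) a x ∂μ := by
  rw [iwExponent, neg_neg, Real.exp_log (integral_iwChi_pos ha haA μ)]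

lemma IsIWConvSemigroup.integral_iwChi {α a : ℝ} (ha : 0 < a) (haA : a < 1 - 2 * α)
    {μ : ℝ → Measure ℝ} (h : IsIWConvSemigroup α μ) {t : ℝ} (ht : 0 ≤ t) :
    ∫ x, iwChi (1 - 2 * α) a x ∂(μ t) = Real.exp (-(t * iwExponent α a (μ 1))) := by
  have hp := h.prob
  have hadd : ∀ s t, 0 ≤ s → 0 ≤ t →
      iwExponent α a (μ (s + t)) = iwExponent α a (μ s) + iwExponent α a (μ t) := by
    intro s t hs ht
    have := hp s hs
    have := hp t ht
    rw [iwExponent, h.conv s t hs ht, integral_iwChi_iwConv ha haA (h.half s hs) (h.half t ht),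
      Real.log_mul (integral_iwChi_pos ha haA _).ne' (integral_iwChi_pos ha haA _).ne', iwExponent,
      iwExponent]
    ring
  have := hp t ht
  rw [← exp_neg_iwExponent ha haA, eq_mul_of_additive_nonneg (g := fun t => iwExponent α a (μ t))
    hadd (fun t ht => by have := hp t ht; exact iwExponent_nonneg ha haA _) ht]

lemma tendsto_iwExponent {α : ℝ} (hα : α < 1 / 2) (μ : Measure ℝ) [IsProbabilityMeasure μ] :
    Tendsto (fun a => iwExponent α a μ) (𝓝[>] 0) (𝓝 0) := by
  have hA : 0 < 1 - 2 * α := by linarith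
  have hev : ∀ᶠ a : ℝ in 𝓝[>] 0, 0 < a ∧ a < 1 - 2 * α := by
    filter_upwards [self_mem_nhdsWithin, nhdsWithin_le_nhds (Iio_mem_nhds hA)] with a h1 h2
      using ⟨h1, h2⟩
  have h1 : Tendsto (fun a => ∫ x, iwChi (1 - 2 * α) a x ∂μ) (𝓝[>] 0) (𝓝 (∫ _, (1 : ℝ) ∂μ)) := by
    refine tendsto_integral_filter_of_dominated_convergence (fun _ => 1) ?_ ?_ (integrable_const _)
      (.of_forall fun x => ?_)
    · filter_upwards [hev] with a ha using (continuous_iwChi ha.1 ha.2).aestronglyMeasurable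
    · filter_upwards [hev] with a ha using .of_forall (norm_iwChi_le ha.1 ha.2)
    · have hl : Tendsto (fun a : ℝ => 1 - 2 * x ^ 2 * (a * (1 - 2 * α - a))) (𝓝[>] 0) (𝓝 1) := by
        have : Continuous fun a : ℝ => 1 - 2 * x ^ 2 * (a * (1 - 2 * α - a)) := by fun_prop
        have := (this.tendsto 0).mono_left (nhdsWithin_le_nhds (s := Ioi (0 : ℝ)))
        simpa using this
      refine tendsto_of_tendsto_of_tendsto_of_le_of_le' hl tendsto_const_nhds ?_ ?_
      · filter_upwards [hev] with a ha
        linarith [one_sub_iwChi_le ha.1 ha.2 x]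
      · filter_upwards [hev] with a ha using iwChi_le_one ha.1 ha.2 x
  simp only [integral_const, probReal_univ, smul_eq_mul, mul_one] at h1
  have := (Real.continuousAt_log one_ne_zero).tendsto.comp h1
  simpa [iwExponent, Function.comp_def] using this.neg

lemma integral_iwChi_dirac {A a x : ℝ} : ∫ y, iwChi A a y ∂(dirac x) = iwChi A a x :=
  integral_dirac _ _

lemma iwConv_dirac_zero {α : ℝ} (hα : α < 1 / 2) {μ : Measure ℝ} [IsProbabilityMeasure μ]
    (hμ : OnHalfLine μ) : iwConv α μ (dirac 0) = μ := by
  have := isProbabilityMeasure_iwConv hα hμ (onHalfLine_dirac le_rfl)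
  refine ext_of_integral_iwChi (A := 1 - 2 * α) (by linarith)
    (onHalfLine_iwConv hα hμ (onHalfLine_dirac le_rfl)) hμ fun a ha haA => ?_
  rw [integral_iwChi_iwConv ha haA hμ (onHalfLine_dirac le_rfl), integral_iwChi_dirac,
    iwChi_zero ha haA, mul_one]

lemma iwConvPow_one {α : ℝ} (hα : α < 1 / 2) {μ : Measure ℝ} [IsProbabilityMeasure μ]
    (hμ : OnHalfLine μ) : iwConvPow α μ 1 = μ := by
  have := (iwConvPow_prob hα hμ 1).1
  refine ext_of_integral_iwChi (A := 1 - 2 * α) (by linarith)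
    (iwConvPow_prob hα hμ 1).2 hμ fun a ha haA => ?_
  rw [integral_iwChi_iwConvPow ha haA hμ, pow_one]

lemma integrable_sq_gammaMeasure {a : ℝ} (ha : 0 < a) :
    Integrable (fun s : ℝ => s ^ 2) (ProbabilityTheory.gammaMeasure a 1) := by
  have h := lintegral_rpow_mul_exp_neg_mul (a := a + 2) (r := 1) (by linarith) one_pos
  have hG := Real.Gamma_pos_of_pos ha
  refine ⟨by fun_prop, ?_⟩
  rw [hasFiniteIntegral_iff_ofReal (.of_forall fun p => sq_nonneg _),
    lintegral_gammaMeasure_one (by fun_prop)]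
  have e : ∫⁻ t in Ioi (0 : ℝ), ENNReal.ofReal ((Real.Gamma a)⁻¹ * (t ^ (a - 1) * Real.exp (-t))) *
      ENNReal.ofReal (t ^ 2) = ∫⁻ t in Ioi (0 : ℝ), ENNReal.ofReal ((Real.Gamma a)⁻¹) *
        ENNReal.ofReal (t ^ (a + 2 - 1) * Real.exp (-(1 * t))) := by
    refine setLIntegral_congr_fun measurableSet_Ioi fun t ht => ?_
    have ht' : 0 < t := ht
    rw [← ENNReal.ofReal_mul (by positivity), ← ENNReal.ofReal_mul (by positivity)]
    congr 1
    rw [show a + 2 - 1 = a - 1 + (2 : ℕ) by push_cast; ring, Real.rpow_add_natCast ht'.ne']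
    ring_nf
  rw [e, lintegral_const_mul _ (by fun_prop), h]
  exact ENNReal.mul_lt_top ENNReal.ofReal_lt_top ENNReal.ofReal_lt_top

lemma integrable_pow_four_gaussianReal :
    Integrable (fun s : ℝ => s ^ 4) (ProbabilityTheory.gaussianReal 0 1) := by
  have h := (ProbabilityTheory.memLp_id_gaussianReal (μ := 0) (v := 1) 4).integrable_norm_pow
    (p := 4) (by norm_num)
  refine h.congr (.of_forall fun s => ?_)
  simp only [id, Real.norm_eq_abs]
  exact Even.pow_abs (by decide) s

/-- Quadratic control of the displacement of `iwPhi`. -/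
def iwSpread (x : ℝ) (ω : ℝ × ℝ) : ℝ := 2 + 4 * x ^ 2 * ω.1 ^ 2 + 4 * x ^ 2 * |ω.2|

lemma integrable_sq_iwSpread {A : ℝ} (hA : 0 < A) (x : ℝ) :
    Integrable (fun ω => iwSpread x ω ^ 2) (gaussGamma A) := by
  have hp := isProbabilityMeasure_gaussGamma hA
  have hp2 := ProbabilityTheory.isProbabilityMeasure_gammaMeasure hA one_pos
  have i1 : Integrable (fun ω : ℝ × ℝ => ω.1 ^ 4) (gaussGamma A) :=
    integrable_pow_four_gaussianReal.comp_fst _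
  have i2 : Integrable (fun ω : ℝ × ℝ => ω.2 ^ 2) (gaussGamma A) :=
    (integrable_sq_gammaMeasure hA).comp_snd _
  refine Integrable.mono' (((integrable_const 12).add (i1.const_mul (48 * x ^ 4))).add
    (i2.const_mul (48 * x ^ 4))) (by unfold iwSpread; fun_prop) (.of_forall fun ω => ?_)
  rw [Real.norm_of_nonneg (sq_nonneg _), iwSpread]
  simp only [Pi.add_apply]
  have h2 : |ω.2| ^ 2 = ω.2 ^ 2 := sq_abs _
  rw [← h2]
  nlinarith [sq_nonneg (2 - 4 * x ^ 2 * ω.1 ^ 2), sq_nonneg (2 - 4 * x ^ 2 * |ω.2|),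
    sq_nonneg (4 * x ^ 2 * ω.1 ^ 2 - 4 * x ^ 2 * |ω.2|)]

lemma sq_iwPhi_sub_le {x y : ℝ} (hx : 0 ≤ x) (hy : 0 ≤ y) (ω : ℝ × ℝ) :
    (iwPhi ((y, x), ω) - x) ^ 2 ≤ y ^ 2 * iwSpread x ω := by
  have hc := abs_nonneg ω.2
  have hT0 : 0 ≤ 1 + x ^ 2 * (ω.1 ^ 2 + 2 * |ω.2|) := by positivity
  have hT := Real.sq_sqrt hT0
  have hTn := Real.sqrt_nonneg (1 + x ^ 2 * (ω.1 ^ 2 + 2 * |ω.2|))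
  simp only [iwPhi, iwPsi, iwSpread]
  set T := √(1 + x ^ 2 * (ω.1 ^ 2 + 2 * |ω.2|))
  have e : y ^ 2 + x ^ 2 + (y * x) ^ 2 * (ω.1 ^ 2 + 2 * |ω.2|) = x ^ 2 + y ^ 2 * T ^ 2 := by
    rw [hT]; ring
  rw [e]
  have l1 : x ≤ √(x ^ 2 + y ^ 2 * T ^ 2) := Real.le_sqrt_of_sq_le (by nlinarith [mul_nonneg (sq_nonneg y) (sq_nonneg T)])
  have l2 : √(x ^ 2 + y ^ 2 * T ^ 2) ≤ x + y * T := by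
    rw [Real.sqrt_le_left (by positivity)]
    nlinarith [mul_nonneg hx (mul_nonneg hy hTn)]
  set S := √(x ^ 2 + y ^ 2 * T ^ 2)
  have l3 : (S - x) ^ 2 ≤ (y * T) ^ 2 := pow_le_pow_left₀ (by linarith) (by linarith) 2
  have l4 : (y * T) ^ 2 = y ^ 2 * (1 + x ^ 2 * (ω.1 ^ 2 + 2 * |ω.2|)) := by rw [mul_pow, hT]
  nlinarith [sq_nonneg (y * x * ω.1 - (S - x))]

lemma exists_gaussGamma_far_le {A x ε : ℝ} (hA : 0 < A) (hx : 0 ≤ x) (hε : 0 < ε) :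
    ∃ C : ℝ, 0 ≤ C ∧ ∀ y, 0 ≤ y →
      gaussGamma A {ω | iwPhi ((y, x), ω) ∉ Ioo (x - ε) (x + ε)} ≤ ENNReal.ofReal (C * y ^ 4) := by
  have hp := isProbabilityMeasure_gaussGamma hA
  have hI : 0 ≤ ∫ ω, iwSpread x ω ^ 2 ∂(gaussGamma A) := integral_nonneg fun ω => sq_nonneg _
  refine ⟨(∫ ω, iwSpread x ω ^ 2 ∂(gaussGamma A)) / ε ^ 4, by positivity, fun y hy => ?_⟩
  have hsub : {ω | iwPhi ((y, x), ω) ∉ Ioo (x - ε) (x + ε)}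
      ⊆ {ω | ε ^ 4 ≤ y ^ 4 * iwSpread x ω ^ 2} := by
    intro ω hω
    have h1 : ε ^ 2 ≤ (iwPhi ((y, x), ω) - x) ^ 2 := by
      rw [sq_le_sq, abs_of_pos hε, le_abs]
      by_contra hcon
      push Not at hcon
      exact hω ⟨by linarith [hcon.2], by linarith [hcon.1]⟩
    have h2 := h1.trans (sq_iwPhi_sub_le hx hy ω)
    have h3 := pow_le_pow_left₀ (by positivity) h2 2
    simp only [mem_ofPred_eq]
    linarith [h3, (by ring : (y ^ 2 * iwSpread x ω) ^ 2 = y ^ 4 * iwSpread x ω ^ 2),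
      (by ring : (ε ^ 2) ^ 2 = ε ^ 4)]
  refine (measure_mono hsub).trans ?_
  have hm := mul_meas_ge_le_integral_of_nonneg (μ := gaussGamma A)
    (f := fun ω => y ^ 4 * iwSpread x ω ^ 2) (.of_forall fun ω => by positivity)
    ((integrable_sq_iwSpread hA x).const_mul _) (ε ^ 4)
  rw [integral_const_mul] at hm
  rw [← ofReal_measureReal]
  refine ENNReal.ofReal_le_ofReal ?_
  rw [div_mul_eq_mul_div, le_div_iff₀ (by positivity)]
  linarith

lemma exists_iwConv_dirac_far_le {α a x ε : ℝ} (ha : 0 < a) (haA : a < 1 - 2 * α) (hx : 0 ≤ x)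
    (hε : 0 < ε) : ∃ C : ℝ, 0 ≤ C ∧ ∀ δ, 0 < δ → δ ≤ 1 → ∀ μ : Measure ℝ, IsProbabilityMeasure μ →
      OnHalfLine μ → (iwConv α μ (dirac x)).real (Ici 0 \ Ioo (x - ε) (x + ε))
        ≤ C * δ ^ 2 * (1 - ∫ y, iwChi (1 - 2 * α) a y ∂μ) + μ.real (Ici δ) := by
  obtain ⟨C, hC, hfar⟩ := exists_gaussGamma_far_le (A := 1 - 2 * α) (by linarith) hx hε
  have hp := isProbabilityMeasure_gaussGamma (A := 1 - 2 * α) (by linarith)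
  have hχ : 0 < 1 - iwChi (1 - 2 * α) a 1 := sub_pos.2 (iwChi_lt_one ha haA one_pos)
  refine ⟨C / (1 - iwChi (1 - 2 * α) a 1), by positivity, fun δ hδ hδ1 μ _ hμ => ?_⟩
  set χ := iwChi (1 - 2 * α) a with hχdef
  set K := C / (1 - χ 1)
  have hK : 0 ≤ K := by positivity
  have hS : MeasurableSet (Ici 0 \ Ioo (x - ε) (x + ε)) := measurableSet_Ici.diff measurableSet_Ioo
  have hχm : Measurable χ := (continuous_iwChi ha haA).measurable
  have hint : Integrable (fun y => K * δ ^ 2 * (1 - χ y)) μ :=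
    ((integrable_const 1).sub (integrable_iwChi ha haA μ)).const_mul _
  have hnn : ∀ y, 0 ≤ K * δ ^ 2 * (1 - χ y) := fun y =>
    mul_nonneg (by positivity) (sub_nonneg.2 (iwChi_le_one ha haA y))
  have hle : iwConv α μ (dirac x) (Ici 0 \ Ioo (x - ε) (x + ε))
      ≤ ENNReal.ofReal (K * δ ^ 2 * (1 - ∫ y, χ y ∂μ)) + μ (Ici δ) := by
    rw [iwConv_eq_map (by linarith) hμ (onHalfLine_dirac hx), Measure.map_apply measurable_iwPhi hS,
      Measure.prod_apply (measurable_iwPhi hS), Measure.prod_dirac,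
      lintegral_map (measurable_measure_prodMk_left (measurable_iwPhi hS)) (by fun_prop)]
    have e1 : ENNReal.ofReal (K * δ ^ 2 * (1 - ∫ y, χ y ∂μ))
        = ∫⁻ y, ENNReal.ofReal (K * δ ^ 2 * (1 - χ y)) ∂μ := by
      rw [← ofReal_integral_eq_lintegral_ofReal hint (.of_forall hnn), integral_const_mul,
        integral_sub (integrable_const 1) (integrable_iwChi ha haA μ)]
      simp [hχdef]
    rw [e1, ← lintegral_indicator_one measurableSet_Ici, ← lintegral_add_left (by fun_prop)]
    refine lintegral_mono_ae ?_
    filter_upwards [onHalfLine_iff.1 hμ] with y hy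
    by_cases hyδ : δ ≤ y
    · refine le_add_left ?_
      rw [indicator_of_mem (by exact hyδ)]
      exact prob_le_one
    · refine le_add_right ?_
      push Not at hyδ
      refine (measure_mono (t := {ω | iwPhi ((y, x), ω) ∉ Ioo (x - ε) (x + ε)})
        fun ω hω => hω.2).trans ((hfar y hy).trans (ENNReal.ofReal_le_ofReal ?_))
      have h1 := sq_mul_one_sub_iwChi_le ha haA hy (hyδ.le.trans hδ1)
      have h2 : y ^ 2 ≤ δ ^ 2 := pow_le_pow_left₀ hy hyδ.le 2
      have h3 : C = K * (1 - χ 1) := (div_mul_cancel₀ _ hχ.ne').symm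
      calc C * y ^ 4 = K * y ^ 2 * (y ^ 2 * (1 - χ 1)) := by rw [h3]; ring
        _ ≤ K * δ ^ 2 * (1 - χ y) := by gcongr
  have h0 : 0 ≤ K * δ ^ 2 * (1 - ∫ y, χ y ∂μ) :=
    mul_nonneg (by positivity) (sub_nonneg.2 (integral_iwChi_le_one ha haA μ))
  have := ENNReal.toReal_mono (by finiteness) hle
  rwa [ENNReal.toReal_add (by finiteness) (by finiteness), ENNReal.toReal_ofReal h0] at this

lemma tendsto_iwConv_dirac_iff {α : ℝ} (hα : α < 1 / 2) {μ : ℝ → Measure ℝ}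
    (hμ : IsIWConvSemigroup α μ) :
    (∀ ε : ℝ, 0 < ε → Tendsto (fun t : ℝ => (μ t (Ici ε)).toReal / t) (𝓝[>] (0 : ℝ)) (𝓝 0)) ↔
      ∀ x : ℝ, 0 ≤ x → ∀ ε : ℝ, 0 < ε →
        Tendsto (fun t : ℝ =>
            ((iwConv α (μ t) (Measure.dirac x)) (Ici 0 \ Ioo (x - ε) (x + ε))).toReal / t)
          (𝓝[>] (0 : ℝ)) (𝓝 0) := by
  constructor
  · intro h x hx ε hε
    have ha : 0 < (1 - 2 * α) / 2 := by linarith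
    have haA : (1 - 2 * α) / 2 < 1 - 2 * α := by linarith
    obtain ⟨C, hC, hfar⟩ := exists_iwConv_dirac_far_le ha haA hx hε
    have := hμ.prob 1 zero_le_one
    set ψ := iwExponent α ((1 - 2 * α) / 2) (μ 1)
    have hψ : 0 ≤ ψ := iwExponent_nonneg ha haA _
    rw [Metric.tendsto_nhds]
    intro η hη
    have hcont : Tendsto (fun δ : ℝ => C * δ ^ 2 * ψ) (𝓝[>] 0) (𝓝 0) := by
      have : Continuous fun δ : ℝ => C * δ ^ 2 * ψ := by fun_prop
      simpa using (this.tendsto 0).mono_left (nhdsWithin_le_nhds (s := Ioi (0 : ℝ)))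
    have e1 : ∀ᶠ δ in 𝓝[>] (0 : ℝ), 0 < δ := self_mem_nhdsWithin
    have e2 : ∀ᶠ δ in 𝓝[>] (0 : ℝ), δ ≤ 1 := nhdsWithin_le_nhds (Iic_mem_nhds one_pos)
    obtain ⟨δ, hδη, hδ, hδ1⟩ :=
      ((hcont.eventually (gt_mem_nhds (half_pos hη))).and (e1.and e2)).exists
    filter_upwards [(h δ hδ).eventually (gt_mem_nhds (half_pos hη)), self_mem_nhdsWithin]
      with t ht1 ht
    have ht' : 0 < t := ht
    have := hμ.prob t ht'.le
    have hb := hfar δ hδ hδ1 (μ t) (hμ.prob t ht'.le) (hμ.half t ht'.le)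
    rw [hμ.integral_iwChi ha haA ht'.le] at hb
    have he := Real.add_one_le_exp (-(t * ψ))
    rw [Real.dist_eq, sub_zero, abs_of_nonneg (by positivity), div_lt_iff₀ ht']
    rw [div_lt_iff₀ ht'] at ht1
    have h2 : C * δ ^ 2 * (1 - Real.exp (-(t * ψ))) ≤ C * δ ^ 2 * (t * ψ) := by
      gcongr
      linarith
    have h3 : C * δ ^ 2 * (t * ψ) ≤ η / 2 * t := by nlinarith
    change (iwConv α (μ t) (dirac x)).real _ < _
    change (μ t).real (Ici δ) < _ at ht1
    linarith
  · intro h ε hε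
    have h0 := h 0 le_rfl ε hε
    refine h0.congr' ?_
    filter_upwards [self_mem_nhdsWithin] with t ht
    have ht' : 0 < t := ht
    have := hμ.prob t ht'.le
    rw [iwConv_dirac_zero hα (hμ.half t ht'.le)]
    congr 3
    ext y
    simp only [Set.mem_sdiff, mem_Ici, mem_Ioo, not_and, not_lt, zero_sub, zero_add]
    exact ⟨fun hy => hy.2 (by linarith [hy.1]), fun hy => ⟨by linarith, fun _ => hy⟩⟩

lemma smul_iwConv_le_iwConv_iwCompoundPoisson {α b : ℝ} (hα : α < 1 / 2)
    {ν ϑ : Measure ℝ} [IsProbabilityMeasure ν] [IsProbabilityMeasure ϑ] (hb : 0 ≤ b)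
    (hν : OnHalfLine ν) (hϑ : OnHalfLine ϑ) :
    ENNReal.ofReal (Real.exp (-b) * b) • iwConv α ν ϑ
      ≤ iwConv α (iwCompoundPoisson α b ν) ϑ := by
  have := isProbabilityMeasure_iwCompoundPoisson hα hb hν
  have := isProbabilityMeasure_gaussGamma (A := 1 - 2 * α) (by linarith)
  rw [iwConv_eq_map hα hν hϑ, iwConv_eq_map hα (onHalfLine_iwCompoundPoisson hα hν) hϑ,
    ← Measure.map_smul, ← Measure.prod_smul_left, ← Measure.prod_smul_left]
  refine Measure.map_mono (Measure.prod_mono (Measure.prod_mono ?_ le_rfl) le_rfl)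
    measurable_iwPhi
  have h := Measure.le_sum (fun k : ℕ =>
    (ENNReal.ofReal (Real.exp (-b) * b ^ k / k.factorial)) • iwConvPow α ν k) 1
  rw [iwCompoundPoisson]
  simpa [iwConvPow_one hα hν] using h

lemma iwChi_mul_le_integral {A a ε : ℝ} (ha : 0 < a) (haA : a < A) {μ : Measure ℝ}
    [IsProbabilityMeasure μ] (hμ : OnHalfLine μ) :
    iwChi A a ε * (1 - μ.real (Ici ε)) ≤ ∫ x, iwChi A a x ∂μ := by
  have h1 : ∫ x in Iio ε, iwChi A a x ∂μ ≤ ∫ x, iwChi A a x ∂μ :=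
    setIntegral_le_integral (integrable_iwChi ha haA μ) (.of_forall (iwChi_nonneg A a))
  have h2 : ∫ x in Iio ε, iwChi A a ε ∂μ ≤ ∫ x in Iio ε, iwChi A a x ∂μ := by
    refine setIntegral_mono_on_ae (integrable_const _).integrableOn
      (integrable_iwChi ha haA μ).integrableOn measurableSet_Iio ?_
    filter_upwards [onHalfLine_iff.1 hμ] with x hx hxε
    exact iwChi_anti ha haA hx hxε.le
  have h3 : μ.real (Iio ε) = 1 - μ.real (Ici ε) := by
    rw [← probReal_compl_eq_one_sub measurableSet_Ici, compl_Ici]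
  rw [setIntegral_const, h3, smul_eq_mul] at h2
  linarith

lemma isIWGaussian_of_tendsto {α : ℝ} (hα : α < 1 / 2) {μ : ℝ → Measure ℝ}
    (hμ : IsIWConvSemigroup α μ) (hdiv : IsIWInfDiv α (μ 1))
    (h : ∀ ε : ℝ, 0 < ε → Tendsto (fun t : ℝ => (μ t (Ici ε)).toReal / t) (𝓝[>] (0 : ℝ)) (𝓝 0)) :
    IsIWGaussian α (μ 1) := by
  refine ⟨hdiv, fun b hb ν ϑ _ hν hϑ heq => ?_⟩
  obtain ⟨_, hϑh, hroot⟩ := hϑ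
  choose! θ hθ using hroot
  have hroot1 : ∀ n : ℕ, 0 < n →
      μ (1 / n) = iwConv α (iwCompoundPoisson α (b / n) ν) (θ n) := by
    intro n hn
    obtain ⟨_, hθh, hθe⟩ := hθ n hn
    have hn' : (0 : ℝ) < n := Nat.cast_pos.2 hn
    have := hμ.prob (1 / n) (by positivity)
    have := hμ.prob 1 zero_le_one
    have hbn : 0 ≤ b / n := by positivity
    have := isProbabilityMeasure_iwCompoundPoisson hα hbn hν
    have := isProbabilityMeasure_iwCompoundPoisson hα hb.le hν
    have hcp := onHalfLine_iwCompoundPoisson (b := b / n) hα hν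
    have hcp' := onHalfLine_iwCompoundPoisson (b := b) hα hν
    have := isProbabilityMeasure_iwConv hα hcp hθh
    refine ext_of_integral_iwChi (A := 1 - 2 * α) (by linarith) (hμ.half _ (by positivity))
      (onHalfLine_iwConv hα hcp hθh) fun a ha haA => ?_
    refine (pow_left_inj₀ (integral_iwChi_pos ha haA _).le (integral_iwChi_pos ha haA _).le
      hn.ne').1 ?_
    have e : ∫ x, iwChi (1 - 2 * α) a x ∂(μ 1) = Real.exp (-(b * (1 - ∫ x, iwChi (1 - 2 * α) a x ∂ν)))
        * (∫ x, iwChi (1 - 2 * α) a x ∂(θ n)) ^ n := by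
      rw [heq, integral_iwChi_iwConv ha haA hcp' hϑh,
        integral_iwChi_iwCompoundPoisson ha haA hb.le hν, hθe, integral_iwChi_iwConvPow ha haA hθh]
    rw [integral_iwChi_iwConv ha haA hcp hθh, integral_iwChi_iwCompoundPoisson ha haA hbn hν,
      mul_pow, ← Real.exp_nat_mul, hμ.integral_iwChi ha haA (by positivity), ← Real.exp_nat_mul]
    rw [hμ.integral_iwChi ha haA zero_le_one] at e
    convert e using 2
    · field_simp
    · congr 1; field_simp
  have hfar : ∀ ε : ℝ, 0 < ε →
      Tendsto (fun n : ℕ => (iwConv α ν (θ n)).real (Ici ε)) atTop (𝓝 0) := by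
    intro ε hε
    have ht : Tendsto (fun n : ℕ => 1 / (n : ℝ)) atTop (𝓝[>] 0) := by
      refine tendsto_nhdsWithin_iff.2 ⟨tendsto_one_div_atTop_nhds_zero_nat, ?_⟩
      filter_upwards [eventually_gt_atTop 0] with n hn
      have : (0 : ℝ) < n := Nat.cast_pos.2 hn
      exact one_div_pos.2 this
    have h1 := ((h ε hε).comp ht).const_mul (Real.exp b / b)
    rw [mul_zero] at h1
    refine squeeze_zero' (.of_forall fun n => measureReal_nonneg) ?_ h1
    filter_upwards [eventually_gt_atTop 0] with n hn
    obtain ⟨_, hθh, -⟩ := hθ n hn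
    have hn' : (0 : ℝ) < n := Nat.cast_pos.2 hn
    have hn1 : (1 : ℝ) ≤ n := Nat.one_le_cast.2 hn
    have hbn : 0 ≤ b / n := by positivity
    have := hμ.prob (1 / n) (by positivity)
    have hle := smul_iwConv_le_iwConv_iwCompoundPoisson hα hbn hν hθh (Ici ε)
    rw [← hroot1 n hn, Measure.smul_apply, smul_eq_mul] at hle
    have hle' := ENNReal.toReal_mono (by finiteness) hle
    rw [ENNReal.toReal_mul, ENNReal.toReal_ofReal (by positivity)] at hle'
    simp only [Function.comp]
    change (iwConv α ν (θ n) (Ici ε)).toReal ≤ _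
    have hexp : Real.exp (-b) ≤ Real.exp (-(b / n)) :=
      Real.exp_le_exp.2 (neg_le_neg (div_le_self hb.le hn1))
    set u := (iwConv α ν (θ n) (Ici ε)).toReal
    have hu : 0 ≤ u := ENNReal.toReal_nonneg
    set m := (μ (1 / n) (Ici ε)).toReal
    have h2 : Real.exp (-b) * (b / n) * u ≤ m := le_trans (by gcongr) hle'
    have h3 : Real.exp b * Real.exp (-b) = 1 := by rw [← Real.exp_add]; simp
    calc u = (Real.exp b * Real.exp (-b)) * (n / b * (b / n)) * u := by
          rw [h3]; field_simp
      _ = Real.exp b * n / b * (Real.exp (-b) * (b / n) * u) := by ring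
      _ ≤ Real.exp b * n / b * m := by gcongr
      _ = _ := by field_simp
  refine ext_of_integral_iwChi (A := 1 - 2 * α) (by linarith) hν (onHalfLine_dirac le_rfl)
    fun a ha haA => ?_
  rw [integral_iwChi_dirac, iwChi_zero ha haA]
  refine le_antisymm (integral_iwChi_le_one ha haA ν) ?_
  have hlow : ∀ ε : ℝ, 0 < ε → iwChi (1 - 2 * α) a ε ≤ ∫ x, iwChi (1 - 2 * α) a x ∂ν := by
    intro ε hε
    have h1 := ((hfar ε hε).const_sub 1).const_mul (iwChi (1 - 2 * α) a ε)
    rw [sub_zero, mul_one] at h1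
    refine le_of_tendsto h1 ?_
    filter_upwards [eventually_gt_atTop 0] with n hn
    obtain ⟨_, hθh, -⟩ := hθ n hn
    have := isProbabilityMeasure_iwConv hα hν hθh
    refine (iwChi_mul_le_integral ha haA (onHalfLine_iwConv hα hν hθh)).trans ?_
    rw [integral_iwChi_iwConv ha haA hν hθh]
    exact mul_le_of_le_one_right (integral_iwChi_pos ha haA ν).le (integral_iwChi_le_one ha haA _)
  have hc := ((continuous_iwChi ha haA).tendsto 0).mono_left (nhdsWithin_le_nhds (s := Ioi (0 : ℝ)))
  rw [iwChi_zero ha haA] at hc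
  exact le_of_tendsto hc (eventually_nhdsWithin_of_forall hlow)

/-- `iwChi` as a bounded continuous function. -/
def iwChiBCF {A a : ℝ} (ha : 0 < a) (haA : a < A) : BoundedContinuousFunction ℝ ℝ :=
  BoundedContinuousFunction.ofNormedAddCommGroup (iwChi A a) (continuous_iwChi ha haA) 1
    (norm_iwChi_le ha haA)

lemma measureReal_Ici_mul_le {A a r : ℝ} (ha : 0 < a) (haA : a < A) {ρ : Measure ℝ}
    [IsFiniteMeasure ρ] (hr : 0 ≤ r) :
    ρ.real (Ici r) * (1 - iwChi A a r) ≤ ∫ x, (1 - iwChi A a x) ∂ρ := by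
  have hint : Integrable (fun x => 1 - iwChi A a x) ρ :=
    (integrable_const 1).sub (integrable_iwChi ha haA ρ)
  have h1 : ∫ x in Ici r, (1 - iwChi A a x) ∂ρ ≤ ∫ x, (1 - iwChi A a x) ∂ρ :=
    setIntegral_le_integral hint (.of_forall fun x => sub_nonneg.2 (iwChi_le_one ha haA x))
  have h2 : ∫ x in Ici r, (1 - iwChi A a r) ∂ρ ≤ ∫ x in Ici r, (1 - iwChi A a x) ∂ρ :=
    setIntegral_mono_on (integrable_const _).integrableOn hint.integrableOn measurableSet_Ici
      fun x hx => sub_le_sub_left (iwChi_anti ha haA hr hx) 1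
  rw [setIntegral_const, smul_eq_mul] at h2
  exact h2.trans h1

lemma exists_measureReal_compl_Icc_le {A η : ℝ} (hA : 0 < A) (hη : 0 < η) {g : ℝ → ℝ}
    (hg : Tendsto g (𝓝[>] 0) (𝓝 0)) :
    ∃ r : ℝ, ∀ ρ : Measure ℝ, IsFiniteMeasure ρ → OnHalfLine ρ →
      (∀ a, 0 < a → a < A → ∫ x, (1 - iwChi A a x) ∂ρ ≤ g a) → ρ.real (Icc 0 r)ᶜ ≤ η := by
  have e1 : ∀ᶠ a in 𝓝[>] (0 : ℝ), 0 < a := self_mem_nhdsWithin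
  have e2 : ∀ᶠ a in 𝓝[>] (0 : ℝ), a < A := nhdsWithin_le_nhds (Iio_mem_nhds hA)
  obtain ⟨a, hga, ha, haA⟩ := ((hg.eventually (gt_mem_nhds (half_pos hη))).and (e1.and e2)).exists
  obtain ⟨r, hr, hr0⟩ := (((tendsto_iwChi_atTop ha haA).eventually
    (gt_mem_nhds (half_pos one_pos))).and (eventually_ge_atTop 0)).exists
  refine ⟨r, fun ρ _ hρ h => ?_⟩
  have h1 := (measureReal_Ici_mul_le ha haA (ρ := ρ) hr0).trans (h a ha haA)
  have h2 : ρ.real (Icc 0 r)ᶜ ≤ ρ.real (Ici r) := by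
    refine ENNReal.toReal_mono (by finiteness) (measure_mono_ae ?_)
    filter_upwards [onHalfLine_iff.1 hρ] with x hx hxr
    by_contra hcon
    exact hxr ⟨hx, (not_le.1 hcon).le⟩
  have h3 : 0 ≤ ρ.real (Ici r) := measureReal_nonneg
  nlinarith

lemma exists_tendsto_of_integral_one_sub_iwChi_le {ι : Type*} (𝒰 : Ultrafilter ι) {A C : ℝ}
    (hA : 0 < A) {ρ : ι → Measure ℝ} [∀ i, IsFiniteMeasure (ρ i)] (hρ : ∀ i, OnHalfLine (ρ i))
    {g : ℝ → ℝ} (hg : Tendsto g (𝓝[>] 0) (𝓝 0)) (hC : ∀ i, (ρ i).real univ ≤ C)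
    (h : ∀ i a, 0 < a → a < A → ∫ x, (1 - iwChi A a x) ∂(ρ i) ≤ g a) :
    ∃ τ : Measure ℝ, IsFiniteMeasure τ ∧ OnHalfLine τ ∧
      Tendsto (fun i => (ρ i).real univ) 𝒰 (𝓝 (τ.real univ)) ∧
      ∀ a, 0 < a → a < A →
        Tendsto (fun i => ∫ x, iwChi A a x ∂(ρ i)) 𝒰 (𝓝 (∫ x, iwChi A a x ∂τ)) := by
  have hη : ∀ n : ℕ, (0 : ℝ) < 1 / ((n : ℝ) + 1) := fun n => Nat.one_div_pos_of_nat
  choose r hr using fun n => exists_measureReal_compl_Icc_le hA (hη n) hg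
  set u : ℕ → NNReal := fun n => Real.toNNReal (1 / ((n : ℝ) + 1))
  have hu : Tendsto u atTop (𝓝 0) := by
    have := (continuous_real_toNNReal.tendsto 0).comp
      (tendsto_one_div_add_atTop_nhds_zero_nat (𝕜 := ℝ))
    rwa [Real.toNNReal_zero] at this
  have hcomp := isCompact_setOfPred_finiteMeasure_mass_le_compl_isCompact_le (E := ℝ) (u := u)
    (K := fun n => Icc 0 (r n)) C.toNNReal hu (fun n => isCompact_Icc) (.inl inferInstance)
  let F : ι → FiniteMeasure ℝ := fun i => ⟨ρ i, inferInstance⟩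
  have hF : ∀ i, F i ∈ {τ : FiniteMeasure ℝ | τ.mass ≤ C.toNNReal ∧ ∀ n, τ (Icc 0 (r n))ᶜ ≤ u n} := by
    intro i
    constructor
    · exact NNReal.le_toNNReal_of_coe_le (hC i)
    · intro n
      exact NNReal.le_toNNReal_of_coe_le (hr n (ρ i) inferInstance (hρ i) (h i))
  obtain ⟨τ, hτ, hlim⟩ := isCompact_iff_ultrafilter_le_nhds'.1 hcomp (𝒰.map F)
    (mem_map.2 (Eventually.of_forall hF))
  have hlim' : Tendsto F 𝒰 (𝓝 τ) := hlim
  have hint := FiniteMeasure.tendsto_iff_forall_integral_tendsto.1 hlim'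
  refine ⟨τ, inferInstance, ?_, ?_, fun a ha haA => hint (iwChiBCF ha haA)⟩
  · have h0 : τ (Iio 0) = 0 := by
      refine le_antisymm (ge_of_tendsto' hu fun n => (τ.apply_mono ?_).trans (hτ.2 n)) zero_le
      intro x hx hx'
      exact absurd hx'.1 (not_le.2 hx)
    have h1 : (τ : Measure ℝ) (Iio 0) = 0 := (τ.null_iff_toMeasure_null _).1 h0
    rw [onHalfLine_iff, ae_iff]
    simp only [not_le]
    exact h1
  · have := hlim'.mass
    exact (NNReal.continuous_coe.tendsto _).comp this

/-- Moves the mass in `[ε, ∞)` to the origin. -/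
def zeroAbove (ε x : ℝ) : ℝ := if x < ε then x else 0

lemma measurable_zeroAbove (ε : ℝ) : Measurable (zeroAbove ε) :=
  Measurable.ite measurableSet_Iio measurable_id measurable_const

lemma onHalfLine_map_zeroAbove {μ : Measure ℝ} (hμ : OnHalfLine μ) (ε : ℝ) :
    OnHalfLine (μ.map (zeroAbove ε)) := by
  rw [onHalfLine_iff, ae_map_iff (measurable_zeroAbove ε).aemeasurable measurableSet_Ici]
  filter_upwards [onHalfLine_iff.1 hμ] with x hx
  unfold zeroAbove
  split_ifs
  · exact hx
  · exact le_rfl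

lemma one_sub_integral_iwChi_map_zeroAbove {A a ε : ℝ} (ha : 0 < a) (haA : a < A) (μ : Measure ℝ)
    [IsProbabilityMeasure μ] :
    1 - ∫ x, iwChi A a x ∂(μ.map (zeroAbove ε)) = ∫ x in Iio ε, (1 - iwChi A a x) ∂μ := by
  have hp : IsProbabilityMeasure (μ.map (zeroAbove ε)) :=
    Measure.isProbabilityMeasure_map (measurable_zeroAbove ε).aemeasurable
  have hint : Integrable (fun x => iwChi A a (zeroAbove ε x)) μ :=
    (integrable_iwChi ha haA (μ.map (zeroAbove ε))).comp_measurable (measurable_zeroAbove ε)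
  rw [integral_map (measurable_zeroAbove ε).aemeasurable
    (continuous_iwChi ha haA).aestronglyMeasurable, ← integral_indicator measurableSet_Iio]
  have e : (1 : ℝ) = ∫ _, (1 : ℝ) ∂μ := by simp
  nth_rewrite 1 [e]
  rw [← integral_sub (integrable_const 1) hint]
  refine integral_congr_ae (.of_forall fun x => ?_)
  by_cases hx : x < ε
  · simp [zeroAbove, hx]
  · simp [zeroAbove, hx, iwChi_zero ha haA]

lemma integral_one_sub_iwChi {A a : ℝ} (ha : 0 < a) (haA : a < A) (μ : Measure ℝ)
    [IsFiniteMeasure μ] :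
    ∫ x, (1 - iwChi A a x) ∂μ = μ.real univ - ∫ x, iwChi A a x ∂μ := by
  rw [integral_sub (integrable_const 1) (integrable_iwChi ha haA μ)]
  simp

lemma tendsto_one_sub_exp_div {c : ℝ} :
    Tendsto (fun t : ℝ => (1 - Real.exp (-(t * c))) / t) (𝓝[>] 0) (𝓝 c) := by
  have h : HasDerivAt (fun t : ℝ => 1 - Real.exp (-(t * c))) c 0 := by
    have := ((hasDerivAt_id (0 : ℝ)).mul_const c).neg.exp.const_sub 1
    simpa using this
  have := h.tendsto_slope_zero_right
  refine this.congr fun t => ?_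
  simp [div_eq_inv_mul]

lemma tendsto_of_isIWGaussian {α : ℝ} (hα : α < 1 / 2) {μ : ℝ → Measure ℝ}
    (hμ : IsIWConvSemigroup α μ) (hG : IsIWGaussian α (μ 1)) {ε : ℝ} (hε : 0 < ε) :
    Tendsto (fun t : ℝ => (μ t (Ici ε)).toReal / t) (𝓝[>] (0 : ℝ)) (𝓝 0) := by
  have hA : 0 < 1 - 2 * α := by linarith
  have hp1 := hμ.prob 1 zero_le_one
  by_contra hcon
  rw [Metric.tendsto_nhds] at hcon
  push Not at hcon
  obtain ⟨δ, hδ, hfreq⟩ := hcon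
  obtain ⟨t, htlim, ht⟩ := exists_seq_forall_of_frequently
    (hfreq.and_eventually (self_mem_nhdsWithin : ∀ᶠ t in 𝓝[>] (0 : ℝ), t ∈ Ioi 0))
  have ht0 : ∀ k, 0 < t k := fun k => (ht k).2
  have hδt : ∀ k, δ ≤ (μ (t k)).real (Ici ε) / t k := fun k => by
    have := (ht k).1
    rwa [Real.dist_eq, sub_zero, abs_of_nonneg
      (div_nonneg ENNReal.toReal_nonneg (ht0 k).le)] at this
  have hprob : ∀ k, IsProbabilityMeasure (μ (t k)) := fun k => hμ.prob _ (ht0 k).le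
  have hhalf : ∀ k, OnHalfLine (μ (t k)) := fun k => hμ.half _ (ht0 k).le
  let 𝒰 : Ultrafilter ℕ := Ultrafilter.of atTop
  have h𝒰 : (𝒰 : Filter ℕ) ≤ atTop := Ultrafilter.of_le atTop
  let χ : ℝ → ℝ → ℝ := iwChi (1 - 2 * α)
  let ψ : ℝ → ℝ := fun a => iwExponent α a (μ 1)
  have hψ : Tendsto ψ (𝓝[>] 0) (𝓝 0) := tendsto_iwExponent hα (μ 1)
  -- The near and far parts of the exponent.
  let near : ℕ → ℝ → ℝ := fun k a => ∫ x in Iio ε, (1 - χ a x) ∂(μ (t k))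
  let far : ℕ → ℝ → ℝ := fun k a => ∫ x in Ici ε, (1 - χ a x) ∂(μ (t k))
  have hnear0 : ∀ k a, 0 < a → a < 1 - 2 * α → 0 ≤ near k a := fun k a ha haA =>
    integral_nonneg fun x => sub_nonneg.2 (iwChi_le_one ha haA x)
  have hfar0 : ∀ k a, 0 < a → a < 1 - 2 * α → 0 ≤ far k a := fun k a ha haA =>
    integral_nonneg fun x => sub_nonneg.2 (iwChi_le_one ha haA x)
  have hsum : ∀ k a, 0 < a → a < 1 - 2 * α →
      near k a + far k a = 1 - Real.exp (-(t k * ψ a)) := by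
    intro k a ha haA
    have hint : Integrable (fun x => 1 - χ a x) (μ (t k)) :=
      (integrable_const 1).sub (integrable_iwChi ha haA _)
    have := integral_add_compl (measurableSet_Iio (a := ε)) hint
    rw [compl_Iio] at this
    rw [this, integral_one_sub_iwChi ha haA, hμ.integral_iwChi ha haA (ht0 k).le, probReal_univ]
  have hsum_le : ∀ k a, 0 < a → a < 1 - 2 * α → (near k a + far k a) / t k ≤ ψ a := by
    intro k a ha haA
    rw [div_le_iff₀ (ht0 k), hsum k a ha haA]
    linarith [Real.add_one_le_exp (-(t k * ψ a))]
  have hsum_lim : ∀ a, 0 < a → a < 1 - 2 * α →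
      Tendsto (fun k => (near k a + far k a) / t k) 𝒰 (𝓝 (ψ a)) := by
    intro a ha haA
    refine ((tendsto_one_sub_exp_div.comp htlim).mono_left h𝒰).congr fun k => ?_
    rw [hsum k a ha haA]
    rfl
  -- The limiting jump measure.
  let σ : ℕ → Measure ℝ := fun k => ENNReal.ofReal (t k)⁻¹ • (μ (t k)).restrict (Ici ε)
  have hσfin : ∀ k, IsFiniteMeasure (σ k) := fun k => Measure.smul_finite _ ENNReal.ofReal_ne_top
  have hσhalf : ∀ k, OnHalfLine (σ k) := fun k => by
    rw [onHalfLine_iff]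
    exact Measure.ae_smul_measure (ae_restrict_of_ae (onHalfLine_iff.1 (hhalf k))) _
  have hσint : ∀ k (f : ℝ → ℝ), ∫ x, f x ∂(σ k) = (∫ x in Ici ε, f x ∂(μ (t k))) / t k := by
    intro k f
    rw [integral_smul_measure, ENNReal.toReal_ofReal (inv_pos.2 (ht0 k)).le, smul_eq_mul,
      div_eq_inv_mul]
  have hσmass : ∀ k, (σ k).real univ = (μ (t k)).real (Ici ε) / t k := by
    intro k
    have := hσint k fun _ => 1
    simpa using this
  have hσle : ∀ k a, 0 < a → a < 1 - 2 * α → ∫ x, (1 - χ a x) ∂(σ k) ≤ ψ a := by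
    intro k a ha haA
    rw [hσint]
    refine le_trans ?_ (hsum_le k a ha haA)
    have := hnear0 k a ha haA
    have := ht0 k
    gcongr
    exact le_add_of_nonneg_left (hnear0 k a ha haA)
  have hb : 0 < (1 - 2 * α) / 2 := by linarith
  have hbA : (1 - 2 * α) / 2 < 1 - 2 * α := by linarith
  have hgap : 0 < 1 - χ ((1 - 2 * α) / 2) ε := sub_pos.2 (iwChi_lt_one hb hbA hε)
  have hσC : ∀ k, (σ k).real univ ≤ ψ ((1 - 2 * α) / 2) / (1 - χ ((1 - 2 * α) / 2) ε) := by
    intro k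
    rw [le_div_iff₀ hgap]
    refine le_trans ?_ (hσle k _ hb hbA)
    have h1 := measureReal_Ici_mul_le hb hbA (ρ := σ k) hε.le
    have h2 : (σ k).real (Ici ε) = (σ k).real univ := by
      simp [σ, measureReal_def]
    rwa [h2] at h1
  obtain ⟨τ, hτfin, hτhalf, hτmass, hτlim⟩ :=
    exists_tendsto_of_integral_one_sub_iwChi_le 𝒰 hA hσhalf hψ hσC hσle
  -- The limiting continuous part, with all its roots.
  let κ : ℕ → Measure ℝ := fun k => (μ (t k)).map (zeroAbove ε)
  have hκprob : ∀ k, IsProbabilityMeasure (κ k) := fun k =>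
    Measure.isProbabilityMeasure_map (measurable_zeroAbove ε).aemeasurable
  have hκhalf : ∀ k, OnHalfLine (κ k) := fun k => onHalfLine_map_zeroAbove (hhalf k) ε
  have hroots : ∀ n : ℕ, 0 < n → ∃ ϑ : Measure ℝ, IsProbabilityMeasure ϑ ∧ OnHalfLine ϑ ∧
      ∀ a, 0 < a → a < 1 - 2 * α →
        Tendsto (fun k => Real.exp (-(near k a / (t k * n)))) 𝒰 (𝓝 (∫ x, χ a x ∂ϑ)) := by
    intro n hn
    have hn1 : (1 : ℝ) ≤ n := Nat.one_le_cast.2 hn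
    have hc : ∀ k, 0 ≤ (t k * n)⁻¹ := fun k => by
      have := ht0 k
      positivity
    have hep : ∀ k, IsProbabilityMeasure (iwCompoundPoisson α (t k * n)⁻¹ (κ k)) := fun k =>
      isProbabilityMeasure_iwCompoundPoisson hα (hc k) (hκhalf k)
    have hhat : ∀ k a, 0 < a → a < 1 - 2 * α →
        ∫ x, χ a x ∂(iwCompoundPoisson α (t k * n)⁻¹ (κ k))
          = Real.exp (-(near k a / (t k * n))) := by
      intro k a ha haA
      rw [integral_iwChi_iwCompoundPoisson ha haA (hc k) (hκhalf k),
        one_sub_integral_iwChi_map_zeroAbove ha haA, div_eq_inv_mul]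
    obtain ⟨ϑ, hϑfin, hϑhalf, hϑmass, hϑlim⟩ :=
      exists_tendsto_of_integral_one_sub_iwChi_le 𝒰 (C := 1) hA
        (ρ := fun k => iwCompoundPoisson α (t k * n)⁻¹ (κ k))
        (fun k => onHalfLine_iwCompoundPoisson hα (hκhalf k)) hψ
        (fun k => have := hep k; probReal_univ.le) (by
          intro k a ha haA
          rw [integral_one_sub_iwChi ha haA]
          refine le_trans ?_ (hsum_le k a ha haA)
          have h1 := hhat k a ha haA
          rw [h1, probReal_univ]
          have h2 := Real.add_one_le_exp (-(near k a / (t k * n)))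
          have h3 := hnear0 k a ha haA
          have h4 := ht0 k
          have h5 : near k a / (t k * n) ≤ near k a / t k :=
            div_le_div_of_nonneg_left h3 h4 (le_mul_of_one_le_right h4.le hn1)
          have h6 : near k a / t k ≤ (near k a + far k a) / t k := by
            gcongr
            exact le_add_of_nonneg_right (hfar0 k a ha haA)
          linarith)
    refine ⟨ϑ, ⟨?_⟩, hϑhalf, fun a ha haA => (hϑlim a ha haA).congr fun k => hhat k a ha haA⟩
    simp only [probReal_univ] at hϑmass
    have h1 : ϑ.real univ = 1 := tendsto_nhds_unique hϑmass tendsto_const_nhds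
    rwa [measureReal_def, ENNReal.toReal_eq_one_iff] at h1
  choose! ϑ hϑprob hϑhalf hϑlim using hroots
  have hϑ1 := hϑprob 1 one_pos
  have hdiv : IsIWInfDiv α (ϑ 1) := by
    refine ⟨hϑ1, hϑhalf 1 one_pos, fun n hn => ⟨ϑ n, hϑprob n hn, hϑhalf n hn, ?_⟩⟩
    have := hϑprob n hn
    obtain ⟨_, hph⟩ := iwConvPow_prob hα (hϑhalf n hn) n
    refine ext_of_integral_iwChi hA (hϑhalf 1 one_pos) hph fun a ha haA => ?_
    rw [integral_iwChi_iwConvPow ha haA (hϑhalf n hn)]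
    refine tendsto_nhds_unique (hϑlim 1 one_pos a ha haA)
      (((hϑlim n hn a ha haA).pow n).congr fun k => ?_)
    rw [← Real.exp_nat_mul]
    have h4 := (ht0 k).ne'
    have h5 : (n : ℝ) ≠ 0 := Nat.cast_ne_zero.2 hn.ne'
    congr 1
    field_simp
    simp
  -- The normalised jump measure.
  set m := τ.real univ with hm
  have hm0 : 0 < m := hδ.trans_le (ge_of_tendsto' hτmass fun k => (hδt k).trans (hσmass k).ge)
  let ν : Measure ℝ := ENNReal.ofReal m⁻¹ • τ
  have hνint : ∀ f : ℝ → ℝ, ∫ x, f x ∂ν = m⁻¹ * ∫ x, f x ∂τ := by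
    intro f
    rw [integral_smul_measure, ENNReal.toReal_ofReal (inv_pos.2 hm0).le, smul_eq_mul]
  have hνprob : IsProbabilityMeasure ν := by
    refine ⟨?_⟩
    rw [Measure.smul_apply, smul_eq_mul, ← ofReal_measureReal, ← hm,
      ← ENNReal.ofReal_mul (inv_pos.2 hm0).le, inv_mul_cancel₀ hm0.ne', ENNReal.ofReal_one]
  have hνhalf : OnHalfLine ν :=
    onHalfLine_iff.2 (Measure.ae_smul_measure (onHalfLine_iff.1 hτhalf) _)
  have hcp := onHalfLine_iwCompoundPoisson (b := m) hα hνhalf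
  have hcpp := isProbabilityMeasure_iwCompoundPoisson hα hm0.le hνhalf
  have hdecomp : μ 1 = iwConv α (iwCompoundPoisson α m ν) (ϑ 1) := by
    have := isProbabilityMeasure_iwConv hα hcp (hϑhalf 1 one_pos)
    refine ext_of_integral_iwChi hA (hμ.half 1 zero_le_one)
      (onHalfLine_iwConv hα hcp (hϑhalf 1 one_pos)) fun a ha haA => ?_
    rw [integral_iwChi_iwConv ha haA hcp (hϑhalf 1 one_pos),
      integral_iwChi_iwCompoundPoisson ha haA hm0.le hνhalf, hνint, mul_sub, mul_one,
      mul_inv_cancel_left₀ hm0.ne', ← exp_neg_iwExponent ha haA]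
    have l1 : Tendsto (fun k => Real.exp (-((near k a + far k a) / t k))) 𝒰
        (𝓝 (Real.exp (-ψ a))) :=
      (Real.continuous_exp.tendsto _).comp (hsum_lim a ha haA).neg
    have l2 : Tendsto (fun k => Real.exp (-((σ k).real univ - ∫ x, χ a x ∂(σ k)))) 𝒰
        (𝓝 (Real.exp (-(m - ∫ x, χ a x ∂τ)))) :=
      (Real.continuous_exp.tendsto _).comp (hτmass.sub (hτlim a ha haA)).neg
    refine tendsto_nhds_unique l1 ((l2.mul (hϑlim 1 one_pos a ha haA)).congr fun k => ?_)
    rw [← integral_one_sub_iwChi ha haA, hσint, ← Real.exp_add]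
    congr 1
    simp only [Nat.cast_one, mul_one]
    ring
  have hν0 := hG.2 m hm0 ν (ϑ 1) hνprob hνhalf hdiv hdecomp
  have e1 := hνint (χ ((1 - 2 * α) / 2))
  have e2 : ∫ x, χ ((1 - 2 * α) / 2) x ∂ν = 1 := by
    rw [hν0]
    exact integral_iwChi_dirac.trans (iwChi_zero hb hbA)
  have l1 : m * (1 - χ ((1 - 2 * α) / 2) ε) ≤ m - ∫ x, χ ((1 - 2 * α) / 2) x ∂τ := by
    refine le_of_tendsto_of_tendsto' (hτmass.mul_const _) (hτmass.sub (hτlim _ hb hbA)) fun k => ?_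
    have h1 := measureReal_Ici_mul_le hb hbA (ρ := σ k) hε.le
    have h2 : (σ k).real (Ici ε) = (σ k).real univ := by
      simp [σ, measureReal_def]
    rwa [h2, integral_one_sub_iwChi hb hbA] at h1
  rw [e2] at e1
  have e3 : ∫ x, χ ((1 - 2 * α) / 2) x ∂τ = m := by
    field_simp at e1
    linarith
  rw [e3, sub_self] at l1
  exact absurd l1 (not_le.2 (mul_pos hm0 hgap))

/-- Lemma 6.7: for `α < 1/2`, a `*`-infinitely divisible probability
measure `μ` on `[0,∞)` with associated `*`-convolution semigroup `{μ_t}` (so `μ₁ = μ`) is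
`*`-Gaussian iff `(1/t) μ_t[ε,∞) → 0` as `t ↓ 0` for each `ε > 0`, iff
`(1/t)(μ_t * δ_x)([0,∞) ∖ (x−ε, x+ε)) → 0` as `t ↓ 0` for each `x ≥ 0`, `ε > 0`. -/
theorem iwGaussian_equivalent_characterizations (α : ℝ) (hα : α < 1 / 2)
    (μc : Measure ℝ) (hμc : IsIWInfDiv α μc)
    (μ : ℝ → Measure ℝ) (hμ : IsIWConvSemigroup α μ) (h1 : μ 1 = μc) :
    (IsIWGaussian α μc ↔
      ∀ ε : ℝ, 0 < ε →
        Tendsto (fun t : ℝ => (μ t (Ici ε)).toReal / t) (𝓝[>] (0 : ℝ)) (𝓝 0)) ∧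
    (IsIWGaussian α μc ↔
      ∀ x : ℝ, 0 ≤ x → ∀ ε : ℝ, 0 < ε →
        Tendsto (fun t : ℝ =>
            ((iwConv α (μ t) (Measure.dirac x)) (Ici 0 \ Ioo (x - ε) (x + ε))).toReal / t)
          (𝓝[>] (0 : ℝ)) (𝓝 0)) := by
  subst h1
  have h : IsIWGaussian α (μ 1) ↔ ∀ ε : ℝ, 0 < ε →
      Tendsto (fun t : ℝ => (μ t (Ici ε)).toReal / t) (𝓝[>] (0 : ℝ)) (𝓝 0) :=
    ⟨fun hG _ hε => tendsto_of_isIWGaussian hα hμ hG hε, isIWGaussian_of_tendsto hα hμ hμc⟩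
  exact ⟨h, h.trans (tendsto_iwConv_dirac_iff hα hμ)⟩

end
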